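/- For every matroid M with finite ground set E and rank d, the h-vector of the independence complex of M is unimodal: there exists an index k₀ with 0 ≤ k₀ ≤ d such that h_0 ≤ h_1 ≤ … ≤ h_{k₀} and h_{k₀} ≥ h_{k₀+1} ≥ … ≥ h_d. -/

import Mathlib

open Polynomial

/-- The rank of a set `X` in a matroid `M`: the supremum of the cardinalities of the
independent subsets of `X`. -/
noncomputable def matroidRank {α : Type*} (M : Matroid α) (X : Set α) : ℕ :=
  sSup {m | ∃ I ⊆ X, M.Indep I ∧ I.ncard = m}

/-- The number of independent sets of cardinality `k` in the matroid `M`: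
the `k`-th entry of the f-vector of the independence complex of `M`. -/
noncomputable def indepCount {α : Type*} (M : Matroid α) (k : ℕ) : ℕ :=
  {I : Set α | M.Indep I ∧ I.ncard = k}.ncard

/-- Pure simplicial complexes with a space of linear functions that make them a unimodular fan
satisfying the balancing condition with all weights equal to one. -/
structure BalancedFan (V : Type*) [Fintype V] [DecidableEq V] where
  Λ : Submodule ℝ (V → ℝ)
  face : Finset V → Prop
  dim : ℕ
  face_empty : face ∅
  face_mono : ∀ σ τ, face τ → σ ⊆ τ → face σ
  card_le : ∀ σ, face σ → σ.card ≤ dim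
  extend : ∀ σ, face σ → σ.card < dim → ∃ v, v ∉ σ ∧ face (insert v σ)
  unimodular : ∀ σ, face σ → ∀ v ∈ σ, ∃ ℓ ∈ Λ, ℓ v = 1 ∧ ∀ u ∈ σ, u ≠ v → ℓ u = 0
  balanced : ∀ σ, face σ → σ.card + 1 = dim → ∀ ℓ ∈ Λ, (∀ u ∈ σ, ℓ u = 0) →
    ∀ s : Finset V, (∀ v, v ∈ s ↔ v ∉ σ ∧ face (insert v σ)) → ∑ v ∈ s, ℓ v = 0

namespace BalancedFan

variable {V : Type*} [Fintype V] [DecidableEq V] (Φ : BalancedFan V)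

open Classical in
/-- The vertices of the link of `σ`. -/
noncomputable def link (σ : Finset V) : Finset V :=
  Finset.univ.filter fun v => v ∉ σ ∧ Φ.face (insert v σ)

variable {Φ}

theorem mem_link {σ : Finset V} {v : V} : v ∈ Φ.link σ ↔ v ∉ σ ∧ Φ.face (insert v σ) := by
  simp [link]

theorem exists_lift {σ : Finset V} (hσ : Φ.face σ) (x : V → ℝ) :
    ∃ ℓ ∈ Φ.Λ, ∀ u ∈ σ, ℓ u = x u := by
  choose! f hf h1 h0 using Φ.unimodular σ hσ
  refine ⟨∑ v ∈ σ, x v • f v, Submodule.sum_mem _ fun v hv => Submodule.smul_mem _ _ (hf v hv), ?_⟩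
  intro u hu
  rw [Finset.sum_apply, Finset.sum_eq_single u]
  · simp [h1 u hu]
  · intro b hb hbu
    simp [h0 b hb u hu hbu.symm]
  · exact fun h => absurd hu h

variable (Φ) in
open Classical in
/-- A linear function agreeing with `x` on the face `σ`. -/
noncomputable def lift (σ : Finset V) (x : V → ℝ) : V → ℝ :=
  if hσ : Φ.face σ then (exists_lift hσ x).choose else 0

theorem lift_mem (σ : Finset V) (x : V → ℝ) : Φ.lift σ x ∈ Φ.Λ := by
  unfold lift
  split_ifs with hσ
  · exact (exists_lift hσ x).choose_spec.1
  · exact Submodule.zero_mem _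

theorem lift_apply {σ : Finset V} (hσ : Φ.face σ) (x : V → ℝ) {u : V} (hu : u ∈ σ) :
    Φ.lift σ x u = x u := by
  unfold lift
  rw [dif_pos hσ]
  exact (exists_lift hσ x).choose_spec.2 u hu

variable (Φ) in
/-- The mixed degree of a list of piecewise linear functions on the star of `σ`. -/
noncomputable def degree : Finset V → List (V → ℝ) → ℝ
  | _, [] => 1
  | σ, x :: xs => ∑ v ∈ Φ.link σ, (x v - Φ.lift σ x v) * degree (insert v σ) xs

theorem sum_link_comm (σ : Finset V) (f : V → V → ℝ) :
    ∑ v ∈ Φ.link σ, ∑ w ∈ Φ.link (insert v σ), f v w =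
      ∑ w ∈ Φ.link σ, ∑ v ∈ Φ.link (insert w σ), f v w := by
  apply Finset.sum_comm'
  intro v w
  simp only [mem_link, Finset.mem_insert, not_or]
  constructor
  · rintro ⟨⟨h1, h2⟩, ⟨h3, h4⟩, h5⟩
    rw [Finset.insert_comm] at h5
    exact ⟨⟨⟨fun h => h3 h.symm, h1⟩, h5⟩, h4, Φ.face_mono _ _ h5 (Finset.subset_insert _ _)⟩
  · rintro ⟨⟨⟨h3, h1⟩, h5⟩, h4, h2⟩
    rw [Finset.insert_comm] at h5
    exact ⟨⟨h1, Φ.face_mono _ _ h5 (Finset.subset_insert _ _)⟩, ⟨fun h => h3 h.symm, h4⟩, h5⟩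

theorem card_insert_link {σ : Finset V} {v : V} (hv : v ∈ Φ.link σ) :
    (insert v σ).card = σ.card + 1 :=
  Finset.card_insert_of_notMem (mem_link.1 hv).1

/-- The dual function of `v` on the face `insert v σ`. -/
theorem exists_dual {σ : Finset V} {v : V} (hv : v ∈ Φ.link σ) :
    ∃ ℓ ∈ Φ.Λ, ℓ v = 1 ∧ ∀ u ∈ σ, ℓ u = 0 := by
  obtain ⟨ℓ, h, h1, h0⟩ := Φ.unimodular _ (mem_link.1 hv).2 v (Finset.mem_insert_self _ _)
  refine ⟨ℓ, h, h1, fun u hu => h0 u (Finset.mem_insert_of_mem hu) ?_⟩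
  rintro rfl
  exact (mem_link.1 hv).1 hu

theorem degree_cons_of_sum_eq_zero {σ : Finset V} (hσ : Φ.face σ) {xs : List (V → ℝ)}
    (hz : ∀ ℓ ∈ Φ.Λ, (∀ u ∈ σ, ℓ u = 0) →
      ∑ v ∈ Φ.link σ, ℓ v * Φ.degree (insert v σ) xs = 0)
    (x : V → ℝ) {ℓ : V → ℝ} (hℓ : ℓ ∈ Φ.Λ) (hx : ∀ u ∈ σ, ℓ u = x u) :
    Φ.degree σ (x :: xs) = ∑ v ∈ Φ.link σ, (x v - ℓ v) * Φ.degree (insert v σ) xs := by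
  have := hz (ℓ - Φ.lift σ x) (Submodule.sub_mem _ hℓ (lift_mem _ _)) (by
    intro u hu
    simp [hx u hu, lift_apply hσ x hu])
  rw [degree, ← sub_eq_zero, ← Finset.sum_sub_distrib, ← this]
  refine Finset.sum_congr rfl fun v _ => ?_
  simp only [Pi.sub_apply]
  ring

theorem degree_cons_cons_aux {σ : Finset V} {y : V → ℝ} {ys : List (V → ℝ)}
    (hz : ∀ v ∈ Φ.link σ, ∀ ℓ ∈ Φ.Λ, (∀ u ∈ insert v σ, ℓ u = 0) →
      ∑ w ∈ Φ.link (insert v σ), ℓ w * Φ.degree (insert w (insert v σ)) ys = 0)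
    {ℓy : V → ℝ} (hℓ : ℓy ∈ Φ.Λ) (hy : ∀ u ∈ σ, ℓy u = y u)
    {v : V} (hv : v ∈ Φ.link σ) {δ : V → ℝ} (hδ : δ ∈ Φ.Λ) (hδ1 : δ v = 1)
    (hδ0 : ∀ u ∈ σ, δ u = 0) :
    Φ.degree (insert v σ) (y :: ys) =
      ∑ w ∈ Φ.link (insert v σ), (y w - ℓy w) * Φ.degree (insert w (insert v σ)) ys -
      (y v - ℓy v) * ∑ w ∈ Φ.link (insert v σ), δ w * Φ.degree (insert w (insert v σ)) ys := by
  rw [degree_cons_of_sum_eq_zero (mem_link.1 hv).2 (hz v hv) y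
    (ℓ := ℓy + (y v - ℓy v) • δ) (Submodule.add_mem _ hℓ (Submodule.smul_mem _ _ hδ)),
    Finset.mul_sum, ← Finset.sum_sub_distrib]
  · refine Finset.sum_congr rfl fun w _ => ?_
    simp only [Pi.add_apply, Pi.smul_apply, smul_eq_mul]
    ring
  · intro u hu
    rcases Finset.mem_insert.1 hu with rfl | hu
    · simp [hδ1]
    · simp [hy u hu, hδ0 u hu]

theorem sum_link_eq_zero (xs : List (V → ℝ)) : ∀ {σ : Finset V}, Φ.face σ →
    σ.card + xs.length + 1 = Φ.dim → ∀ ℓ ∈ Φ.Λ, (∀ u ∈ σ, ℓ u = 0) →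
      ∑ v ∈ Φ.link σ, ℓ v * Φ.degree (insert v σ) xs = 0 := by
  induction xs with
  | nil =>
    intro σ hσ hd ℓ hℓ h0
    simpa [degree] using Φ.balanced σ hσ (by simpa using hd) ℓ hℓ h0 (Φ.link σ) fun _ => mem_link
  | cons y ys ih =>
    intro σ hσ hd ℓ hℓ h0
    simp only [List.length_cons] at hd
    have ih' : ∀ v ∈ Φ.link σ, ∀ ℓ ∈ Φ.Λ, (∀ u ∈ insert v σ, ℓ u = 0) →
      ∑ w ∈ Φ.link (insert v σ), ℓ w * Φ.degree (insert w (insert v σ)) ys = 0 :=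
      fun v hv => ih (mem_link.1 hv).2 (by rw [card_insert_link hv]; omega)
    have hdual : ∀ v ∈ Φ.link σ, ∃ ℓ ∈ Φ.Λ, ℓ v = 1 ∧ ∀ u ∈ σ, ℓ u = 0 :=
      fun v hv => exists_dual hv
    choose! δ hδ hδ1 hδ0 using hdual
    have key : ∀ v ∈ Φ.link σ, ℓ v * Φ.degree (insert v σ) (y :: ys) =
        ∑ w ∈ Φ.link (insert v σ),
          ℓ v * (y w - Φ.lift σ y w) * Φ.degree (insert w (insert v σ)) ys -
        (y v - Φ.lift σ y v) * ∑ w ∈ Φ.link (insert v σ),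
          ℓ w * Φ.degree (insert w (insert v σ)) ys := by
      intro v hv
      have h2 : ∑ w ∈ Φ.link (insert v σ), ℓ w * Φ.degree (insert w (insert v σ)) ys =
          ℓ v * ∑ w ∈ Φ.link (insert v σ), δ v w * Φ.degree (insert w (insert v σ)) ys := by
        have := ih' v hv (ℓ - ℓ v • δ v)
          (Submodule.sub_mem _ hℓ (Submodule.smul_mem _ _ (hδ v hv))) (by
            intro u hu
            rcases Finset.mem_insert.1 hu with rfl | hu
            · simp [hδ1 _ hv]
            · simp [h0 u hu, hδ0 v hv u hu])
        rw [← sub_eq_zero, Finset.mul_sum, ← Finset.sum_sub_distrib, ← this]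
        refine Finset.sum_congr rfl fun w _ => ?_
        simp only [Pi.sub_apply, Pi.smul_apply, smul_eq_mul]
        ring
      rw [degree_cons_cons_aux ih' (lift_mem σ y) (fun u hu => lift_apply hσ y hu) hv (hδ v hv)
        (hδ1 v hv) (hδ0 v hv), h2, mul_sub, Finset.mul_sum]
      congr 1
      · exact Finset.sum_congr rfl fun w _ => by ring
      · ring
    rw [Finset.sum_congr rfl key, Finset.sum_sub_distrib, sum_link_comm, sub_eq_zero]
    refine Finset.sum_congr rfl fun w _ => ?_
    rw [Finset.mul_sum]
    refine Finset.sum_congr rfl fun v _ => ?_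
    rw [Finset.insert_comm]
    ring

theorem degree_cons {σ : Finset V} (hσ : Φ.face σ) {xs : List (V → ℝ)}
    (hd : σ.card + xs.length + 1 = Φ.dim) (x : V → ℝ) {ℓ : V → ℝ} (hℓ : ℓ ∈ Φ.Λ)
    (hx : ∀ u ∈ σ, ℓ u = x u) :
    Φ.degree σ (x :: xs) = ∑ v ∈ Φ.link σ, (x v - ℓ v) * Φ.degree (insert v σ) xs :=
  degree_cons_of_sum_eq_zero hσ (sum_link_eq_zero xs hσ hd) x hℓ hx

theorem degree_add {σ : Finset V} (hσ : Φ.face σ) {xs : List (V → ℝ)}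
    (hd : σ.card + xs.length + 1 = Φ.dim) (x y : V → ℝ) :
    Φ.degree σ ((x + y) :: xs) = Φ.degree σ (x :: xs) + Φ.degree σ (y :: xs) := by
  rw [degree_cons hσ hd (x + y) (Submodule.add_mem _ (lift_mem σ x) (lift_mem σ y)), degree,
    degree, ← Finset.sum_add_distrib]
  · refine Finset.sum_congr rfl fun v _ => ?_
    simp only [Pi.add_apply]
    ring
  · intro u hu
    simp [lift_apply hσ _ hu]

theorem degree_smul {σ : Finset V} (hσ : Φ.face σ) {xs : List (V → ℝ)}
    (hd : σ.card + xs.length + 1 = Φ.dim) (c : ℝ) (x : V → ℝ) :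
    Φ.degree σ ((c • x) :: xs) = c * Φ.degree σ (x :: xs) := by
  rw [degree_cons hσ hd (c • x) (Submodule.smul_mem _ c (lift_mem σ x)), degree, Finset.mul_sum]
  · refine Finset.sum_congr rfl fun v _ => ?_
    simp only [Pi.smul_apply, smul_eq_mul]
    ring
  · intro u hu
    simp [lift_apply hσ _ hu]

theorem degree_congr {σ : Finset V} (hσ : Φ.face σ) {xs : List (V → ℝ)}
    (hd : σ.card + xs.length + 1 = Φ.dim) (x : V → ℝ) {ℓ : V → ℝ} (hℓ : ℓ ∈ Φ.Λ) :
    Φ.degree σ ((x - ℓ) :: xs) = Φ.degree σ (x :: xs) := by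
  rw [degree_cons hσ hd x (Submodule.add_mem _ (lift_mem σ (x - ℓ)) hℓ), degree]
  · refine Finset.sum_congr rfl fun v _ => ?_
    simp only [Pi.add_apply, Pi.sub_apply]
    ring
  · intro u hu
    simp [lift_apply hσ _ hu]

/-- Expansion of the degree in its first two arguments. -/
theorem degree_cons_cons {σ : Finset V} (hσ : Φ.face σ) {ys : List (V → ℝ)}
    (hd : σ.card + ys.length + 2 = Φ.dim) (δ : V → V → ℝ) (hδ : ∀ v ∈ Φ.link σ, δ v ∈ Φ.Λ)
    (hδ1 : ∀ v ∈ Φ.link σ, δ v v = 1) (hδ0 : ∀ v ∈ Φ.link σ, ∀ u ∈ σ, δ v u = 0)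
    (x y : V → ℝ) {ℓx ℓy : V → ℝ} (hℓx : ℓx ∈ Φ.Λ) (hx : ∀ u ∈ σ, ℓx u = x u)
    (hℓy : ℓy ∈ Φ.Λ) (hy : ∀ u ∈ σ, ℓy u = y u) :
    Φ.degree σ (x :: y :: ys) =
      ∑ v ∈ Φ.link σ, ∑ w ∈ Φ.link (insert v σ),
        (x v - ℓx v) * (y w - ℓy w) * Φ.degree (insert w (insert v σ)) ys -
      ∑ v ∈ Φ.link σ, (x v - ℓx v) * (y v - ℓy v) *
        ∑ w ∈ Φ.link (insert v σ), δ v w * Φ.degree (insert w (insert v σ)) ys := by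
  rw [degree_cons hσ (by simp only [List.length_cons]; omega) x hℓx hx, ← Finset.sum_sub_distrib]
  refine Finset.sum_congr rfl fun v hv => ?_
  rw [degree_cons_cons_aux (fun v hv => sum_link_eq_zero ys (mem_link.1 hv).2
    (by rw [card_insert_link hv]; omega)) hℓy hy hv (hδ v hv) (hδ1 v hv) (hδ0 v hv), mul_sub,
    Finset.mul_sum]
  congr 1
  · exact Finset.sum_congr rfl fun w _ => by ring
  · ring

theorem degree_swap {σ : Finset V} (hσ : Φ.face σ) {ys : List (V → ℝ)}
    (hd : σ.card + ys.length + 2 = Φ.dim) (x y : V → ℝ) :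
    Φ.degree σ (x :: y :: ys) = Φ.degree σ (y :: x :: ys) := by
  have hdual : ∀ v ∈ Φ.link σ, ∃ ℓ ∈ Φ.Λ, ℓ v = 1 ∧ ∀ u ∈ σ, ℓ u = 0 :=
    fun v hv => exists_dual hv
  choose! δ hδ hδ1 hδ0 using hdual
  rw [degree_cons_cons hσ hd δ hδ hδ1 hδ0 x y (lift_mem σ x) (fun u hu => lift_apply hσ x hu)
    (lift_mem σ y) (fun u hu => lift_apply hσ y hu),
    degree_cons_cons hσ hd δ hδ hδ1 hδ0 y x (lift_mem σ y) (fun u hu => lift_apply hσ y hu)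
    (lift_mem σ x) (fun u hu => lift_apply hσ x hu), sum_link_comm]
  congr 1
  · refine Finset.sum_congr rfl fun v _ => Finset.sum_congr rfl fun w _ => ?_
    rw [Finset.insert_comm]
    ring
  · exact Finset.sum_congr rfl fun v _ => by ring

theorem degree_perm {xs ys : List (V → ℝ)} (h : xs.Perm ys) : ∀ {σ : Finset V}, Φ.face σ →
    σ.card + xs.length = Φ.dim → Φ.degree σ xs = Φ.degree σ ys := by
  induction h with
  | nil => exact fun _ _ => rfl
  | cons x h ih =>
    intro σ hσ hd
    refine Finset.sum_congr rfl fun v hv => ?_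
    rw [ih (mem_link.1 hv).2 (by rw [card_insert_link hv, ← hd, List.length_cons]; omega)]
  | swap x y l =>
    intro σ hσ hd
    exact degree_swap hσ (by simpa [add_assoc] using hd) y x
  | trans h1 h2 ih1 ih2 =>
    intro σ hσ hd
    rw [ih1 hσ hd, ih2 hσ (by rw [← h1.length_eq]; exact hd)]

end BalancedFan

open Matrix in
theorem dotProduct_mulVec_nonpos {I : Type*} [Fintype I] [DecidableEq I] {A : Matrix I I ℝ}
    (hA : A.IsHermitian) {t : I → ℝ} (ht : ∀ v, 0 < t v) (hAt : A *ᵥ t = t)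
    (hpos : ∀ v w, v ≠ w → 0 ≤ A v w)
    (hconn : ∀ f : I → ℝ, (∀ v w, v ≠ w → A v w ≠ 0 → f v = f w) → ∀ v w, f v = f w)
    (hsq : ∀ z, z ⬝ᵥ (A *ᵥ z) ≤ (A *ᵥ z) ⬝ᵥ (A *ᵥ z)) {z : I → ℝ} (hz : z ⬝ᵥ t = 0) :
    z ⬝ᵥ (A *ᵥ z) ≤ 0 := by
  have hsymm : ∀ v w, A v w = A w v := fun v w => by
    simpa using (hA.apply v w).symm
  have hdot : ∀ x y : I → ℝ, x ⬝ᵥ (A *ᵥ y) = (A *ᵥ x) ⬝ᵥ y := by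
    intro x y
    rw [dotProduct_mulVec, ← mulVec_transpose]
    congr 2
  have hrow : ∀ v, ∑ w, A v w * t w = t v := fun v => congrFun hAt v
  set b := hA.eigenvectorBasis
  have hnorm : ∀ i, (b i).ofLp ⬝ᵥ (b i).ofLp = 1 := by
    intro i
    have := b.orthonormal.1 i
    have h2 : inner ℝ (b i) (b i) = 1 := by
      rw [real_inner_self_eq_norm_sq, this]; norm_num
    rw [PiLp.inner_apply] at h2
    simpa [dotProduct, sq] using h2
  have heig : ∀ i, A *ᵥ (b i).ofLp = hA.eigenvalues i • (b i).ofLp :=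
    fun i => hA.mulVec_eigenvectorBasis i
  have hterm : ∀ i, hA.eigenvalues i * ((b i).ofLp ⬝ᵥ z) ^ 2 ≤ 0 := by
    intro i
    set u := (b i).ofLp with hu
    set c := hA.eigenvalues i
    have h1 : c ≤ c ^ 2 := by
      have := hsq u
      rw [heig i] at this
      simp only [dotProduct_smul, smul_dotProduct, ← hu] at this
      rw [hu, hnorm i] at this
      simpa [sq] using this
    have hsum : ∑ v, ∑ w, A v w * t v * t w * (u v / t v - u w / t w) ^ 2 = 2 * (1 - c) := by
      have e1 : ∀ v w, A v w * t v * t w * (u v / t v - u w / t w) ^ 2 =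
          u v ^ 2 / t v * (A v w * t w) + u w ^ 2 / t w * (A w v * t v) -
            2 * (u v * (A v w * u w)) := by
        intro v w
        have := (ht v).ne'
        have := (ht w).ne'
        rw [hsymm w v]
        field_simp
        ring
      have huv : ∑ v, u v ^ 2 = 1 := by
        rw [← hnorm i]; simp [dotProduct, sq, hu]
      have e2 : ∑ v, ∑ w, u v ^ 2 / t v * (A v w * t w) = 1 := by
        rw [← huv]
        refine Finset.sum_congr rfl fun v _ => ?_
        rw [← Finset.mul_sum, hrow]
        have := (ht v).ne'
        field_simp
      have e3 : ∑ v, ∑ w, u v * (A v w * u w) = c := by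
        have : u ⬝ᵥ (A *ᵥ u) = c := by
          rw [heig i]
          simp only [dotProduct_smul, hu, hnorm i, smul_eq_mul, mul_one]
          rfl
        rw [← this]
        simp only [dotProduct, mulVec, Finset.mul_sum]
      simp only [e1, Finset.sum_add_distrib, Finset.sum_sub_distrib, ← Finset.mul_sum]
      simp only [← Finset.mul_sum] at e2 e3
      rw [Finset.sum_comm (f := fun v w => u w ^ 2 / t w * (A w v * t v))]
      simp only [← Finset.mul_sum]
      rw [e2, e3]
      ring
    have hnn : ∀ v w, 0 ≤ A v w * t v * t w * (u v / t v - u w / t w) ^ 2 := by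
      intro v w
      by_cases h : v = w
      · subst h; simp
      · have := hpos v w h
        have := (ht v).le
        have := (ht w).le
        positivity
    have hc : c ≤ 1 := by
      have : 0 ≤ 2 * (1 - c) := hsum ▸ Finset.sum_nonneg fun v _ =>
        Finset.sum_nonneg fun w _ => hnn v w
      linarith
    rcases hc.lt_or_eq with hlt | heq
    · have : c ≤ 0 := by nlinarith
      nlinarith [sq_nonneg (u ⬝ᵥ z)]
    · have h0 : ∀ v w, A v w * t v * t w * (u v / t v - u w / t w) ^ 2 = 0 := by
        rw [heq] at hsum
        simp only [sub_self, mul_zero] at hsum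
        intro v w
        have := (Finset.sum_eq_zero_iff_of_nonneg
          (fun v _ => Finset.sum_nonneg fun w _ => hnn v w)).1 hsum v (Finset.mem_univ _)
        exact (Finset.sum_eq_zero_iff_of_nonneg (fun w _ => hnn v w)).1 this w (Finset.mem_univ _)
      have hconst := hconn (fun v => u v / t v) (by
        intro v w _ hvw
        have := h0 v w
        simp only [mul_eq_zero, hvw, (ht v).ne', (ht w).ne', false_or, pow_eq_zero_iff,
          OfNat.ofNat_ne_zero, ne_eq, not_false_eq_true] at this
        exact sub_eq_zero.1 this)
      have : u ⬝ᵥ z = 0 := by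
        rcases isEmpty_or_nonempty I with hI | ⟨⟨v0⟩⟩
        · simp [dotProduct]
        · have hu' : u = (u v0 / t v0) • t := by
            ext v
            have := hconst v v0
            simp only [Pi.smul_apply, smul_eq_mul, ← this]
            have := (ht v).ne'
            field_simp
          rw [hu', smul_dotProduct, dotProduct_comm, hz, smul_zero]
      simp [this]
  have hexp : z ⬝ᵥ (A *ᵥ z) = ∑ i, hA.eigenvalues i * ((b i).ofLp ⬝ᵥ z) ^ 2 := by
    have := b.sum_inner_mul_inner (WithLp.toLp 2 z) (WithLp.toLp 2 (A *ᵥ z))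
    have hin : ∀ x y : I → ℝ, inner ℝ (WithLp.toLp 2 x) (WithLp.toLp 2 y) = x ⬝ᵥ y := by
      intro x y
      rw [PiLp.inner_apply]
      simp [dotProduct, mul_comm]
    rw [hin] at this
    rw [← this]
    refine Finset.sum_congr rfl fun i _ => ?_
    have e1 : inner ℝ (WithLp.toLp 2 z) (b i) = (b i).ofLp ⬝ᵥ z := by
      rw [dotProduct_comm, ← hin]
    have e2 : inner ℝ (b i) (WithLp.toLp 2 (A *ᵥ z)) = hA.eigenvalues i * ((b i).ofLp ⬝ᵥ z) := by
      have : inner ℝ (b i) (WithLp.toLp 2 (A *ᵥ z)) = (b i).ofLp ⬝ᵥ (A *ᵥ z) := by rw [← hin]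
      rw [this, hdot, heig, smul_dotProduct, smul_eq_mul]
    rw [e1, e2]
    ring
  rw [hexp]
  exact Finset.sum_nonpos fun i _ => hterm i

theorem bilin_nonpos_of_orthogonal {I : Type*} [Fintype I] [DecidableEq I] {M : I → I → ℝ}
    (hM : ∀ v w, M v w = M w v) {t n : I → ℝ} (ht : ∀ v, 0 < t v) (hn : ∀ v, 0 < n v)
    (hMt : ∀ v, ∑ w, M v w * t w = n v) (hpos : ∀ v w, v ≠ w → 0 ≤ M v w)
    (hconn : ∀ f : I → ℝ, (∀ v w, v ≠ w → M v w ≠ 0 → f v = f w) → ∀ v w, f v = f w)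
    (hsq : ∀ x : I → ℝ, ∑ v, x v * ∑ w, M v w * x w ≤ ∑ v, t v / n v * (∑ w, M v w * x w) ^ 2)
    {x : I → ℝ} (hx : ∑ v, x v * n v = 0) : ∑ v, x v * ∑ w, M v w * x w ≤ 0 := by
  set s : I → ℝ := fun v => √(t v / n v) with hs
  have hs0 : ∀ v, 0 < s v := fun v => Real.sqrt_pos.2 (div_pos (ht v) (hn v))
  have hs2 : ∀ v, s v * s v = t v / n v := fun v => Real.mul_self_sqrt (div_pos (ht v) (hn v)).le
  set A : Matrix I I ℝ := Matrix.of fun v w => s v * M v w * s w with hAdef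
  have hmul : ∀ z : I → ℝ, ∀ v, (A.mulVec z) v = s v * ∑ w, M v w * (s w * z w) := by
    intro z v
    simp only [Matrix.mulVec, dotProduct, hAdef, Matrix.of_apply, Finset.mul_sum]
    exact Finset.sum_congr rfl fun w _ => by ring
  have hcancel : ∀ v (y : ℝ), s v * (y / s v) = y := fun v y => by
    have := (hs0 v).ne'
    field_simp
  have hmain := dotProduct_mulVec_nonpos (A := A) (t := fun v => t v / s v)
    (z := fun v => x v / s v)
    (by
      ext v w
      simp only [hAdef, Matrix.conjTranspose_apply, Matrix.of_apply, star_trivial]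
      rw [hM w v]; ring)
    (fun v => div_pos (ht v) (hs0 v))
    (by
      ext v
      rw [hmul]
      simp only [hcancel, hMt]
      have h1 := hs2 v
      have := (hs0 v).ne'
      have := (hn v).ne'
      field_simp at h1 ⊢
      linarith)
    (fun v w h => mul_nonneg (mul_nonneg (hs0 v).le (hpos v w h)) (hs0 w).le)
    (by
      intro f hf
      refine hconn f fun v w h1 h2 => hf v w h1 ?_
      exact mul_ne_zero (mul_ne_zero (hs0 v).ne' h2) (hs0 w).ne')
    (by
      intro z
      have := hsq (fun v => s v * z v)
      simp only [dotProduct, hmul]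
      refine le_trans (le_of_eq ?_) (this.trans (le_of_eq ?_))
      · exact Finset.sum_congr rfl fun v _ => by ring
      · refine Finset.sum_congr rfl fun v _ => ?_
        rw [← hs2]; ring)
    (by
      rw [← hx]
      refine Finset.sum_congr rfl fun v _ => ?_
      have h1 := hs2 v
      have := (hs0 v).ne'
      have := (hn v).ne'
      field_simp at h1 ⊢
      rw [← h1])
  refine le_trans (le_of_eq ?_) hmain
  refine Finset.sum_congr rfl fun v _ => ?_
  rw [hmul]
  simp only [hcancel]
  have := (hs0 v).ne'
  field_simp

namespace BalancedFan

variable {V : Type*} [Fintype V] [DecidableEq V] {Φ : BalancedFan V}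

theorem degree_congr_link {σ : Finset V} (hσ : Φ.face σ) {xs : List (V → ℝ)}
    (hd : σ.card + xs.length + 1 = Φ.dim) {x y : V → ℝ} (h : ∀ u ∈ σ, x u = y u)
    (h' : ∀ v ∈ Φ.link σ, x v = y v) : Φ.degree σ (x :: xs) = Φ.degree σ (y :: xs) := by
  rw [degree_cons hσ hd x (lift_mem σ y) (fun u hu => by rw [lift_apply hσ y hu, h u hu]), degree]
  exact Finset.sum_congr rfl fun v hv => by rw [h' v hv]

theorem degree_cons_of_eq_zero {σ : Finset V} (hσ : Φ.face σ) {xs : List (V → ℝ)}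
    (hd : σ.card + xs.length + 1 = Φ.dim) {x : V → ℝ} (h : ∀ u ∈ σ, x u = 0) :
    Φ.degree σ (x :: xs) = ∑ v ∈ Φ.link σ, x v * Φ.degree (insert v σ) xs := by
  rw [degree_cons hσ hd x (Submodule.zero_mem _) (fun u hu => by simp [h u hu])]
  simp

/-- The degree as a linear form in its first argument. -/
noncomputable def degreeLinear {σ : Finset V} (hσ : Φ.face σ) {xs : List (V → ℝ)}
    (hd : σ.card + xs.length + 1 = Φ.dim) : (V → ℝ) →ₗ[ℝ] ℝ where
  toFun x := Φ.degree σ (x :: xs)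
  map_add' := degree_add hσ hd
  map_smul' := degree_smul hσ hd

/-- The degree as a bilinear form in its first two arguments. -/
noncomputable def degreeBilin {σ : Finset V} (hσ : Φ.face σ) {xs : List (V → ℝ)}
    (hd : σ.card + xs.length + 2 = Φ.dim) : (V → ℝ) →ₗ[ℝ] (V → ℝ) →ₗ[ℝ] ℝ :=
  have hd' : ∀ y : V → ℝ, σ.card + (y :: xs).length + 1 = Φ.dim := fun y => by
    simp only [List.length_cons]; omega
  LinearMap.mk₂ ℝ (fun x y => Φ.degree σ (x :: y :: xs))
    (fun x x' y => degree_add hσ (hd' y) x x')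
    (fun c x y => degree_smul hσ (hd' y) c x)
    (fun x y y' => by
      rw [degree_swap hσ hd, degree_add hσ (hd' x), degree_swap hσ hd y, degree_swap hσ hd y'])
    (fun c x y => by
      rw [degree_swap hσ hd, degree_smul hσ (hd' x), degree_swap hσ hd y, smul_eq_mul])

theorem degreeBilin_apply {σ : Finset V} (hσ : Φ.face σ) {xs : List (V → ℝ)}
    (hd : σ.card + xs.length + 2 = Φ.dim) (x y : V → ℝ) :
    degreeBilin hσ hd x y = Φ.degree σ (x :: y :: xs) := rfl

variable (Φ) in
/-- Strictly convex piecewise linear functions. -/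
def Ample (t : V → ℝ) : Prop :=
  ∀ σ, Φ.face σ → ∃ ℓ ∈ Φ.Λ, (∀ u ∈ σ, ℓ u = t u) ∧ ∀ v ∈ Φ.link σ, ℓ v < t v

variable (Φ) in
/-- Convex piecewise linear functions. -/
def Nef (t : V → ℝ) : Prop :=
  ∀ σ, Φ.face σ → ∃ ℓ ∈ Φ.Λ, (∀ u ∈ σ, ℓ u = t u) ∧ ∀ v ∈ Φ.link σ, ℓ v ≤ t v

theorem Ample.sub_mem {t ℓ : V → ℝ} (ht : Φ.Ample t) (hℓ : ℓ ∈ Φ.Λ) : Φ.Ample (t - ℓ) := by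
  intro σ hσ
  obtain ⟨ℓ', h, h1, h2⟩ := ht σ hσ
  exact ⟨ℓ' - ℓ, Submodule.sub_mem _ h hℓ, fun u hu => by simp [h1 u hu],
    fun v hv => by simpa using h2 v hv⟩

theorem Nef.add_smul_ample {x t : V → ℝ} (hx : Φ.Nef x) (ht : Φ.Ample t) {ε : ℝ} (hε : 0 < ε) :
    Φ.Ample (x + ε • t) := by
  intro σ hσ
  obtain ⟨ℓ, h, h1, h2⟩ := hx σ hσ
  obtain ⟨ℓ', h', h1', h2'⟩ := ht σ hσ
  refine ⟨ℓ + ε • ℓ', Submodule.add_mem _ h (Submodule.smul_mem _ _ h'),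
    fun u hu => by simp [h1 u hu, h1' u hu], fun v hv => ?_⟩
  simp only [Pi.add_apply, Pi.smul_apply, smul_eq_mul]
  have := mul_lt_mul_of_pos_left (h2' v hv) hε
  linarith [h2 v hv]

theorem degree_pos (ts : List (V → ℝ)) : ∀ {σ : Finset V}, Φ.face σ →
    σ.card + ts.length = Φ.dim → (∀ t ∈ ts, Φ.Ample t) → 0 < Φ.degree σ ts := by
  induction ts with
  | nil => intro σ _ _ _; simp [degree]
  | cons t ts ih =>
    intro σ hσ hd ht
    simp only [List.length_cons] at hd
    obtain ⟨ℓ, h, h1, h2⟩ := ht t List.mem_cons_self σ hσ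
    rw [degree_cons hσ (by omega) t h h1]
    refine Finset.sum_pos (fun v hv => mul_pos (sub_pos.2 (h2 v hv)) (ih (mem_link.1 hv).2
      (by rw [card_insert_link hv]; omega) fun t' ht' => ht t' (List.mem_cons_of_mem _ ht'))) ?_
    obtain ⟨v, hv⟩ := Φ.extend σ hσ (by omega)
    exact ⟨v, mem_link.2 hv⟩

variable (Φ) in
/-- Connected in codimension one, with the correct signature on two-dimensional links. -/
structure IsHyperbolic : Prop where
  connected : ∀ σ, Φ.face σ → σ.card + 2 ≤ Φ.dim → ∀ f : V → ℝ,
    (∀ v ∈ Φ.link σ, ∀ w ∈ Φ.link (insert v σ), f v = f w) →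
      ∀ v ∈ Φ.link σ, ∀ w ∈ Φ.link σ, f v = f w
  signature : ∀ σ, Φ.face σ → σ.card + 2 = Φ.dim → ∃ φ : (V → ℝ) →ₗ[ℝ] ℝ, ∀ x,
    (∀ u ∈ σ, x u = 0) → φ x = 0 → Φ.degree σ [x, x] ≤ 0

theorem mul_le_sq_of_functional {W : Type*} [AddCommGroup W] [Module ℝ W]
    (B : W →ₗ[ℝ] W →ₗ[ℝ] ℝ) (hB : ∀ x y, B x y = B y x) (p : W → Prop)
    (hp : ∀ (a b : ℝ) x y, p x → p y → p (a • x - b • y)) (φ : W →ₗ[ℝ] ℝ)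
    (hφ : ∀ x, p x → φ x = 0 → B x x ≤ 0) {x t : W} (hx : p x) (ht : p t) (htt : 0 < B t t) :
    B x x * B t t ≤ B x t ^ 2 := by
  have hexp : ∀ (a b : ℝ) x, B (a • x - b • t) (a • x - b • t) =
      a ^ 2 * B x x - 2 * a * b * B x t + b ^ 2 * B t t := by
    intro a b x
    simp only [map_sub, map_smul, LinearMap.sub_apply, LinearMap.smul_apply, smul_eq_mul, hB t x]
    ring
  have hφt : φ t ≠ 0 := fun h => absurd (hφ t ht h) htt.not_ge
  have hy : ∀ y, p y → B y t = 0 → B y y ≤ 0 := by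
    intro y hy hyt
    have h1 := hφ (φ t • y - φ y • t) (hp _ _ _ _ hy ht) (by simp [mul_comm])
    rw [hexp, hyt] at h1
    have h2 : 0 < φ t ^ 2 := by positivity
    by_contra! h3
    have := mul_pos h2 h3
    have := mul_nonneg (sq_nonneg (φ y)) htt.le
    linarith
  have h1 := hy (B t t • x - B x t • t) (hp _ _ _ _ hx ht) (by simp [mul_comm])
  rw [hexp] at h1
  have h2 : B t t * (B x x * B t t - B x t ^ 2) ≤ 0 := by linarith
  by_contra! h3
  have := mul_pos htt (sub_pos.2 h3)
  linarith

theorem degree_mul_le_sq_of_functional {σ : Finset V} (hσ : Φ.face σ) {ts : List (V → ℝ)}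
    (hd : σ.card + ts.length + 2 = Φ.dim) (hts : ∀ t ∈ ts, Φ.Ample t)
    (hφ : ∃ φ : (V → ℝ) →ₗ[ℝ] ℝ, ∀ x, (∀ u ∈ σ, x u = 0) → φ x = 0 →
      Φ.degree σ (x :: x :: ts) ≤ 0) (x : V → ℝ) {t : V → ℝ} (ht : Φ.Ample t) :
    Φ.degree σ (x :: x :: ts) * Φ.degree σ (t :: t :: ts) ≤ Φ.degree σ (x :: t :: ts) ^ 2 := by
  obtain ⟨φ, hφ⟩ := hφ
  have hd' : ∀ y : V → ℝ, σ.card + (y :: ts).length + 1 = Φ.dim := fun y => by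
    simp only [List.length_cons]; omega
  have hred : ∀ x y, Φ.degree σ ((x - Φ.lift σ x) :: (y - Φ.lift σ y) :: ts) =
      Φ.degree σ (x :: y :: ts) := by
    intro x y
    rw [degree_congr hσ (hd' _) x (lift_mem _ _), degree_swap hσ hd,
      degree_congr hσ (hd' _) y (lift_mem _ _), degree_swap hσ hd]
  have hz : ∀ x : V → ℝ, ∀ u ∈ σ, (x - Φ.lift σ x) u = 0 := fun x u hu => by
    simp [lift_apply hσ x hu]
  have := mul_le_sq_of_functional (degreeBilin hσ hd) (fun x y => degree_swap hσ hd x y)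
    (fun x => ∀ u ∈ σ, x u = 0) (fun a b x y hx hy u hu => by simp [hx u hu, hy u hu]) φ hφ
    (hz x) (hz t) (by
      rw [degreeBilin_apply, hred]
      refine degree_pos _ hσ (by simp only [List.length_cons]; omega) ?_
      simpa [ht] using hts)
  simpa only [degreeBilin_apply, hred] using this

theorem exists_functional (hΦ : Φ.IsHyperbolic) (ts : List (V → ℝ)) : ∀ {σ : Finset V},
    Φ.face σ → σ.card + ts.length + 2 = Φ.dim → (∀ t ∈ ts, Φ.Ample t) →
    ∃ φ : (V → ℝ) →ₗ[ℝ] ℝ, ∀ x, (∀ u ∈ σ, x u = 0) → φ x = 0 →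
      Φ.degree σ (x :: x :: ts) ≤ 0 := by
  induction ts with
  | nil => exact fun hσ hd _ => hΦ.signature _ hσ (by simpa using hd)
  | cons t₀ ts ih =>
    intro σ hσ hd hts
    simp only [List.length_cons] at hd
    have hts' : ∀ t ∈ ts, Φ.Ample t := fun t ht => hts t (List.mem_cons_of_mem _ ht)
    obtain ⟨ℓ, hℓ, h1, h2⟩ := hts t₀ List.mem_cons_self σ hσ
    set t := t₀ - ℓ with ht_def
    have ht : Φ.Ample t := (hts t₀ List.mem_cons_self).sub_mem hℓ
    have ht0 : ∀ u ∈ σ, t u = 0 := fun u hu => by simp [ht_def, h1 u hu]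
    have htpos : ∀ v ∈ Φ.link σ, 0 < t v := fun v hv => by simp [ht_def, h2 v hv]
    have hface : ∀ v ∈ Φ.link σ, Φ.face (insert v σ) := fun v hv => (mem_link.1 hv).2
    have hdv : ∀ v ∈ Φ.link σ, (insert v σ).card + ts.length + 2 = Φ.dim := fun v hv => by
      rw [card_insert_link hv]; omega
    have hdv1 : ∀ v ∈ Φ.link σ, ∀ y : V → ℝ,
        (insert v σ).card + (y :: ts).length + 1 = Φ.dim := fun v hv y => by
      rw [List.length_cons, ← hdv v hv]; omega
    have hperm : ∀ x y z : V → ℝ, Φ.degree σ (x :: y :: z :: ts) =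
        Φ.degree σ (z :: x :: y :: ts) := fun x y z =>
      degree_perm (((List.Perm.swap z y ts).cons x).trans (List.Perm.swap z x _)) hσ
        (by simp only [List.length_cons]; omega)
    have hlen : ∀ x y : V → ℝ, σ.card + (x :: y :: ts).length + 1 = Φ.dim := fun x y => by
      simp only [List.length_cons]; omega
    have ht₀ : ∀ x y, Φ.degree σ (x :: y :: t₀ :: ts) = Φ.degree σ (x :: y :: t :: ts) := by
      intro x y
      rw [hperm, hperm x y t, ht_def, degree_congr hσ (hlen x y) t₀ hℓ]
    have hQ : ∀ x y, Φ.degree σ (x :: y :: t :: ts) =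
        ∑ v ∈ Φ.link σ, t v * Φ.degree (insert v σ) (x :: y :: ts) := by
      intro x y
      rw [hperm, degree_cons_of_eq_zero hσ (hlen x y) ht0]
    have hQ' : ∀ x y, (∀ u ∈ σ, x u = 0) → Φ.degree σ (x :: y :: t :: ts) =
        ∑ v ∈ Φ.link σ, x v * Φ.degree (insert v σ) (y :: t :: ts) := by
      intro x y hx
      rw [degree_cons_of_eq_zero hσ (hlen y t) hx]
    let M : Φ.link σ → Φ.link σ → ℝ :=
      fun v w => Φ.degree (insert v.1 σ) (Pi.single w.1 1 :: t :: ts)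
    let n : Φ.link σ → ℝ := fun v => Φ.degree (insert v.1 σ) (t :: t :: ts)
    have hsingle : ∀ w ∈ Φ.link σ, ∀ u ∈ σ, (Pi.single w 1 : V → ℝ) u = 0 := by
      intro w hw u hu
      refine Pi.single_eq_of_ne ?_ _
      rintro rfl
      exact (mem_link.1 hw).1 hu
    have hMapply : ∀ x : V → ℝ, (∀ u ∈ σ, x u = 0) → ∀ v : Φ.link σ,
        ∑ w : Φ.link σ, M v w * x w = Φ.degree (insert v.1 σ) (x :: t :: ts) := by
      intro x hx v
      have : Φ.degree (insert v.1 σ) (x :: t :: ts) = degreeLinear (hface v v.2) (hdv1 v v.2 t)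
          (∑ w : Φ.link σ, x w • Pi.single w.1 1) := by
        have hv : ∀ v' ∈ Φ.link σ, x v' = (∑ w : Φ.link σ, x w • Pi.single w.1 (1 : ℝ)) v' := by
          intro v' hv'
          rw [Finset.sum_apply, Finset.sum_eq_single ⟨v', hv'⟩]
          · simp
          · intro b _ hb
            have : v' ≠ b.1 := fun h => hb (Subtype.ext h.symm)
            simp [this]
          · simp
        refine degree_congr_link (hface v v.2) (hdv1 v v.2 t) ?_ ?_
        · intro u hu
          rcases Finset.mem_insert.1 hu with rfl | hu
          · exact hv _ v.2
          · rw [Finset.sum_apply, Finset.sum_eq_zero, hx u hu]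
            intro w _
            simp [hsingle w.1 w.2 u hu]
        · intro w hw
          obtain ⟨h3, h4⟩ := mem_link.1 hw
          refine hv w (mem_link.2 ⟨fun h => h3 (Finset.mem_insert_of_mem h),
            Φ.face_mono _ _ h4 ?_⟩)
          exact Finset.insert_subset_insert _ (Finset.subset_insert _ _)
      rw [this, map_sum]
      refine Finset.sum_congr rfl fun w _ => ?_
      rw [map_smul, smul_eq_mul, mul_comm]
      rfl
    have hMsymm : ∀ v w, M v w = M w v := by
      intro v w
      have key : ∀ v w : Φ.link σ, M v w =
          Φ.degree σ (Pi.single v.1 1 :: Pi.single w.1 1 :: t :: ts) := by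
        intro v w
        rw [hQ' _ _ (hsingle v.1 v.2), Finset.sum_eq_single v.1]
        · simp [M]
        · intro b _ hb
          simp [hb]
        · exact fun h => absurd v.2 h
      rw [key, key, degree_swap hσ (by simp only [List.length_cons]; omega)]
    have hedge : ∀ v w : Φ.link σ, v ≠ w → M v w =
        if w.1 ∈ Φ.link (insert v.1 σ) then
          Φ.degree (insert w.1 (insert v.1 σ)) (t :: ts) else 0 := by
      intro v w hvw
      have hne : w.1 ≠ v.1 := fun h => hvw (Subtype.ext h.symm)
      simp only [M]
      rw [degree_cons_of_eq_zero (hface v v.2) (hdv1 v v.2 t)]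
      · split_ifs with h
        · rw [Finset.sum_eq_single w.1]
          · simp
          · intro b _ hb
            simp [hb]
          · exact fun h' => absurd h h'
        · refine Finset.sum_eq_zero fun b hb => ?_
          have : b ≠ w.1 := by
            rintro rfl
            exact h hb
          simp [this]
      · intro u hu
        rcases Finset.mem_insert.1 hu with rfl | hu
        · simp [hne.symm]
        · exact hsingle w.1 w.2 u hu
    have hedge_pos : ∀ v w : Φ.link σ, w.1 ∈ Φ.link (insert v.1 σ) →
        0 < Φ.degree (insert w.1 (insert v.1 σ)) (t :: ts) := by
      intro v w h
      refine degree_pos _ (mem_link.1 h).2 ?_ (by simpa [ht] using hts')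
      rw [card_insert_link h, card_insert_link v.2, List.length_cons]
      omega
    have hn : ∀ v, 0 < n v := by
      intro v
      refine degree_pos _ (hface v v.2) ?_ (by simpa [ht] using hts')
      simp only [List.length_cons]
      rw [← hdv v v.2]; omega
    refine ⟨degreeLinear hσ (xs := t :: t :: ts) (hlen t t), fun x hx hφ => ?_⟩
    have hmain := bilin_nonpos_of_orthogonal (M := M) hMsymm (t := fun v => t v.1) (n := n)
      (fun v => htpos v.1 v.2) hn (fun v => hMapply t ht0 v)
      (by
        intro v w hvw
        rw [hedge v w hvw]
        split_ifs with h
        · exact (hedge_pos v w h).le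
        · exact le_rfl)
      (by
        intro f hf v w
        have := hΦ.connected σ hσ (by omega)
          (fun v => if h : v ∈ Φ.link σ then f ⟨v, h⟩ else 0) (by
            intro v hv w hw
            have hw' : w ∈ Φ.link σ := by
              obtain ⟨h3, h4⟩ := mem_link.1 hw
              exact mem_link.2 ⟨fun h => h3 (Finset.mem_insert_of_mem h),
                Φ.face_mono _ _ h4 (Finset.insert_subset_insert _ (Finset.subset_insert _ _))⟩
            have hne : (⟨v, hv⟩ : Φ.link σ) ≠ ⟨w, hw'⟩ := by
              intro h
              have : v = w := congrArg Subtype.val h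
              subst this
              exact (mem_link.1 hw).1 (Finset.mem_insert_self _ _)
            simp only [hv, hw', dif_pos]
            refine hf _ _ hne ?_
            rw [hedge _ _ hne, if_pos hw]
            exact (hedge_pos ⟨v, hv⟩ ⟨w, hw'⟩ hw).ne') v.1 v.2 w.1 w.2
        simpa using this)
      (by
        intro z
        set x : V → ℝ := fun v => if h : v ∈ Φ.link σ then z ⟨v, h⟩ else 0 with hxdef
        have hxz : ∀ v : Φ.link σ, z v = x v.1 := fun v => by simp [hxdef]
        have hx : ∀ u ∈ σ, x u = 0 := fun u hu => by
          have : u ∉ Φ.link σ := fun h => (mem_link.1 h).1 hu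
          simp [hxdef, this]
        simp only [hxz, hMapply x hx]
        have e1 : ∑ v : Φ.link σ, x v.1 * Φ.degree (insert v.1 σ) (x :: t :: ts) =
            ∑ v : Φ.link σ, t v.1 * Φ.degree (insert v.1 σ) (x :: x :: ts) := by
          rw [Finset.sum_coe_sort (Φ.link σ)
              (fun v => x v * Φ.degree (insert v σ) (x :: t :: ts)),
            Finset.sum_coe_sort (Φ.link σ)
              (fun v => t v * Φ.degree (insert v σ) (x :: x :: ts)), ← hQ, ← hQ' _ _ hx]
        rw [e1]
        refine Finset.sum_le_sum fun v _ => ?_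
        have := degree_mul_le_sq_of_functional (hface v v.2) (hdv v v.2) hts'
          (ih (hface v v.2) (hdv v v.2) hts') x ht
        rw [div_mul_eq_mul_div, mul_div_assoc]
        refine mul_le_mul_of_nonneg_left ?_ (htpos v v.2).le
        rw [le_div_iff₀ (hn v)]
        exact this)
      (x := fun v => x v.1)
      (by
        have : Φ.degree σ (x :: t :: t :: ts) = 0 := hφ
        rw [hQ' _ _ hx] at this
        rw [← this]
        exact Finset.sum_coe_sort (Φ.link σ)
              (fun v => x v * Φ.degree (insert v σ) (t :: t :: ts)))
    simp only [hMapply x hx] at hmain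
    rw [ht₀, hQ' _ _ hx]
    refine le_trans (le_of_eq ?_) hmain
    exact (Finset.sum_coe_sort (Φ.link σ)
              (fun v => x v * Φ.degree (insert v σ) (x :: t :: ts))).symm

theorem continuous_degree (zs : List ((V → ℝ) × (V → ℝ))) : ∀ {σ : Finset V}, Φ.face σ →
    σ.card + zs.length = Φ.dim →
    Continuous fun ε : ℝ => Φ.degree σ (zs.map fun z => z.1 + ε • z.2) := by
  induction zs with
  | nil => intro σ _ _; simpa [degree] using continuous_const
  | cons z zs ih =>
    intro σ hσ hd
    simp only [List.length_cons] at hd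
    have hd' : ∀ ε : ℝ, σ.card + (zs.map fun z => z.1 + ε • z.2).length + 1 = Φ.dim :=
      fun ε => by rw [List.length_map]; omega
    simp only [List.map_cons]
    have : ∀ ε : ℝ, Φ.degree σ ((z.1 + ε • z.2) :: zs.map fun z => z.1 + ε • z.2) =
        ∑ v ∈ Φ.link σ, (z.1 v - Φ.lift σ z.1 v + ε * (z.2 v - Φ.lift σ z.2 v)) *
          Φ.degree (insert v σ) (zs.map fun z => z.1 + ε • z.2) := by
      intro ε
      rw [degree_add hσ (hd' ε), degree_smul hσ (hd' ε), degree, degree, Finset.mul_sum,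
        ← Finset.sum_add_distrib]
      exact Finset.sum_congr rfl fun v _ => by ring
    simp only [this]
    refine continuous_finsetSum _ fun v hv => Continuous.mul (by fun_prop) ?_
    exact ih (mem_link.1 hv).2 (by rw [card_insert_link hv]; omega)

/-- The Alexandrov–Fenchel type inequality for nef piecewise linear functions. -/
theorem degree_mul_le_sq (hΦ : Φ.IsHyperbolic) {η : V → ℝ} (hη : Φ.Ample η)
    {ts : List (V → ℝ)} (hd : ts.length + 2 = Φ.dim) (hts : ∀ t ∈ ts, Φ.Nef t)
    (x : V → ℝ) {y : V → ℝ} (hy : Φ.Nef y) :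
    Φ.degree ∅ (x :: x :: ts) * Φ.degree ∅ (y :: y :: ts) ≤ Φ.degree ∅ (x :: y :: ts) ^ 2 := by
  have hcont : ∀ a b : V → ℝ, Filter.Tendsto (fun ε : ℝ => Φ.degree ∅
      ((a + ε • η) :: (b + ε • η) :: ts.map fun z => z + ε • η)) (nhdsWithin 0 (Set.Ioi 0))
      (nhds (Φ.degree ∅ (a :: b :: ts))) := by
    intro a b
    have := (continuous_degree (Φ := Φ) ((a :: b :: ts).map fun z => (z, η)) Φ.face_empty
      (by simp only [List.length_map, List.length_cons, Finset.card_empty]; omega)).tendsto 0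
    simp only [List.map_cons, List.map_map, Function.comp_def, zero_smul, add_zero,
      List.map_id'] at this
    exact this.mono_left nhdsWithin_le_nhds
  refine le_of_tendsto_of_tendsto ((hcont x x).mul (hcont y y)) ((hcont x y).pow 2) ?_
  filter_upwards [self_mem_nhdsWithin] with ε hε
  have hts' : ∀ t ∈ ts.map (fun z => z + ε • η), Φ.Ample t := by
    intro t ht
    obtain ⟨z, hz, rfl⟩ := List.mem_map.1 ht
    exact (hts z hz).add_smul_ample hη hε
  have hd' : (∅ : Finset V).card + (ts.map fun z => z + ε • η).length + 2 = Φ.dim := by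
    simpa using hd
  exact degree_mul_le_sq_of_functional Φ.face_empty hd' hts'
    (exists_functional hΦ _ Φ.face_empty hd' hts') _ (hy.add_smul_ample hη hε)

end BalancedFan

/-- Matroid rank functions on a finite ground set. -/
structure IsRankFunction {E : Type*} [DecidableEq E] (r : Finset E → ℕ) : Prop where
  empty : r ∅ = 0
  mono : ∀ A B, A ⊆ B → r A ≤ r B
  insert_le : ∀ e A, r (insert e A) ≤ r A + 1
  submod : ∀ A B, r (A ∪ B) + r (A ∩ B) ≤ r A + r B

namespace IsRankFunction

variable {E : Type*} [Fintype E] [DecidableEq E] {r : Finset E → ℕ}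

/-- The closure operator of a rank function. -/
def cl (r : Finset E → ℕ) (A : Finset E) : Finset E :=
  Finset.univ.filter fun e => r (insert e A) = r A

theorem mem_cl {A : Finset E} {e : E} : e ∈ cl r A ↔ r (insert e A) = r A := by simp [cl]

/-- The flats of a rank function. -/
def IsFlat (r : Finset E → ℕ) (F : Finset E) : Prop := cl r F = F

theorem subset_cl (A : Finset E) : A ⊆ cl r A := fun e he => by
  rw [mem_cl, Finset.insert_eq_of_mem he]

variable (hr : IsRankFunction r)
include hr

theorem rank_union_eq {A : Finset E} (B : Finset E) (hB : B ⊆ cl r A) : r (A ∪ B) = r A := by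
  induction B using Finset.induction_on with
  | empty => simp
  | insert e B _ ih =>
    have h1 := ih fun x hx => hB (Finset.mem_insert_of_mem hx)
    have h2 := mem_cl.1 (hB (Finset.mem_insert_self e B))
    have h3 := hr.submod (A ∪ B) (insert e A)
    have h4 : A ∪ B ∪ insert e A = A ∪ insert e B := by
      ext x; simp only [Finset.mem_union, Finset.mem_insert]; tauto
    have h5 := hr.mono A ((A ∪ B) ∩ insert e A) (Finset.subset_inter Finset.subset_union_left
      (Finset.subset_insert _ _))
    have h6 := hr.mono A (A ∪ insert e B) Finset.subset_union_left
    rw [h4] at h3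
    omega

theorem rank_cl (A : Finset E) : r (cl r A) = r A := by
  have := hr.rank_union_eq (cl r A) (Finset.Subset.refl _)
  rwa [Finset.union_eq_right.2 (subset_cl A)] at this

theorem cl_mono {A B : Finset E} (h : A ⊆ B) : cl r A ⊆ cl r B := by
  intro e he
  rw [mem_cl] at he ⊢
  by_cases heB : e ∈ B
  · rw [Finset.insert_eq_of_mem heB]
  have h1 := hr.submod B (insert e A)
  have h2 : B ∪ insert e A = insert e B := by
    ext x; simp only [Finset.mem_union, Finset.mem_insert]
    have := @h x
    tauto
  have h3 := hr.mono A (B ∩ insert e A) (Finset.subset_inter h (Finset.subset_insert _ _))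
  have h4 := hr.mono B (insert e B) (Finset.subset_insert _ _)
  rw [h2] at h1
  omega

theorem isFlat_cl (A : Finset E) : IsFlat r (cl r A) := by
  refine Finset.Subset.antisymm (fun e he => ?_) (subset_cl _)
  rw [mem_cl, hr.rank_cl] at he
  rw [mem_cl]
  have h1 := hr.mono (insert e A) (insert e (cl r A)) (Finset.insert_subset_insert _ (subset_cl A))
  have h2 := hr.mono A (insert e A) (Finset.subset_insert _ _)
  omega

theorem cl_subset {A F : Finset E} (hF : IsFlat r F) (h : A ⊆ F) : cl r A ⊆ F := by
  have := hr.cl_mono h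
  rwa [hF] at this

omit hr in
theorem isFlat_univ : IsFlat r Finset.univ := Finset.univ_subset_iff.1 (subset_cl _)

theorem isFlat_inter {F F' : Finset E} (hF : IsFlat r F) (hF' : IsFlat r F') :
    IsFlat r (F ∩ F') :=
  Finset.Subset.antisymm (Finset.subset_inter (hr.cl_subset hF Finset.inter_subset_left)
    (hr.cl_subset hF' Finset.inter_subset_right)) (subset_cl _)

theorem cl_empty_subset {F : Finset E} (hF : IsFlat r F) : cl r ∅ ⊆ F :=
  hr.cl_subset hF (Finset.empty_subset _)

theorem rank_insert {F : Finset E} (hF : IsFlat r F) {e : E} (he : e ∉ F) :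
    r (insert e F) = r F + 1 := by
  have h1 : r (insert e F) ≠ r F := fun h => he (by rw [← hF]; exact mem_cl.2 h)
  have h2 := hr.insert_le e F
  have h3 := hr.mono F (insert e F) (Finset.subset_insert _ _)
  omega

theorem rank_lt {F F' : Finset E} (hF : IsFlat r F) (h : F ⊂ F') : r F < r F' := by
  obtain ⟨e, he, heF⟩ := Finset.exists_of_ssubset h
  have h1 := hr.rank_insert hF heF
  have h2 := hr.mono (insert e F) F' (Finset.insert_subset he h.1)
  omega

theorem eq_of_subset_of_rank_le {F F' : Finset E} (hF : IsFlat r F) (h : F ⊆ F')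
    (hle : r F' ≤ r F) : F = F' := by
  by_contra hne
  exact absurd (hr.rank_lt hF (h.ssubset_of_ne hne)) hle.not_gt

/-- Flats of every intermediate rank exist between two flats. -/
theorem exists_flat_between {G H : Finset E} (hG : IsFlat r G) (hH : IsFlat r H) (h : G ⊆ H)
    {i : ℕ} (h1 : r G ≤ i) (h2 : i ≤ r H) : ∃ F, IsFlat r F ∧ G ⊆ F ∧ F ⊆ H ∧ r F = i := by
  induction i, h1 using Nat.le_induction with
  | base => exact ⟨G, hG, Finset.Subset.refl _, h, rfl⟩
  | succ i _ ih =>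
    obtain ⟨F, hF, hGF, hFH, hFi⟩ := ih (by omega)
    have hne : F ⊂ H := hFH.ssubset_of_ne (by rintro rfl; omega)
    obtain ⟨e, he, heF⟩ := Finset.exists_of_ssubset hne
    refine ⟨cl r (insert e F), hr.isFlat_cl _,
      hGF.trans ((Finset.subset_insert _ _).trans (subset_cl _)),
      hr.cl_subset hH (Finset.insert_subset he hFH), ?_⟩
    rw [hr.rank_cl, hr.rank_insert hF heF, hFi]

theorem eq_cl_insert_iff {G F : Finset E} (hG : IsFlat r G) (hF : IsFlat r F) (hGF : G ⊆ F)
    (hrk : r F = r G + 1) {e : E} (he : e ∉ G) : cl r (insert e G) = F ↔ e ∈ F := by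
  constructor
  · rintro rfl
    exact subset_cl _ (Finset.mem_insert_self _ _)
  · intro heF
    refine hr.eq_of_subset_of_rank_le (hr.isFlat_cl _)
      (hr.cl_subset hF (Finset.insert_subset heF hGF)) ?_
    rw [hr.rank_cl, hr.rank_insert hG he, hrk]

/-- The flats covering `G` partition the complement of `G`. -/
theorem sum_covers {R : Type*} [AddCommMonoid R] {G H : Finset E} (hG : IsFlat r G)
    (hH : IsFlat r H) (hGH : G ⊆ H) {s : Finset (Finset E)}
    (hs : ∀ F, F ∈ s ↔ IsFlat r F ∧ G ⊆ F ∧ F ⊆ H ∧ r F = r G + 1) (a : Finset E → E → R) :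
    ∑ F ∈ s, ∑ e ∈ F \ G, a F e = ∑ e ∈ H \ G, a (cl r (insert e G)) e := by
  have hmaps : ∀ e ∈ H \ G, cl r (insert e G) ∈ s := by
    intro e he
    rw [Finset.mem_sdiff] at he
    rw [hs]
    refine ⟨hr.isFlat_cl _, (Finset.subset_insert _ _).trans (subset_cl _),
      hr.cl_subset hH (Finset.insert_subset he.1 hGH), ?_⟩
    rw [hr.rank_cl, hr.rank_insert hG he.2]
  rw [← Finset.sum_fiberwise_of_maps_to hmaps]
  refine Finset.sum_congr rfl fun F hF => ?_
  obtain ⟨h1, h2, h3, h4⟩ := (hs F).1 hF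
  have : (H \ G).filter (fun e => cl r (insert e G) = F) = F \ G := by
    ext e
    simp only [Finset.mem_filter, Finset.mem_sdiff]
    constructor
    · rintro ⟨⟨_, he⟩, hcl⟩
      exact ⟨(hr.eq_cl_insert_iff hG h1 h2 h4 he).1 hcl, he⟩
    · rintro ⟨heF, he⟩
      exact ⟨⟨h3 heF, he⟩, (hr.eq_cl_insert_iff hG h1 h2 h4 he).2 heF⟩
  rw [← this]
  refine Finset.sum_congr rfl fun e he => ?_
  rw [(Finset.mem_filter.1 he).2]

end IsRankFunction

namespace BergmanFan

open IsRankFunction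

variable {E : Type*} [Fintype E] [DecidableEq E] {r : Finset E → ℕ}

/-- Chains of proper flats. -/
def Face (r : Finset E → ℕ) (σ : Finset (Finset E)) : Prop :=
  (∀ F ∈ σ, IsFlat r F ∧ cl r ∅ ⊂ F ∧ F ⊂ Finset.univ) ∧
    ∀ F ∈ σ, ∀ F' ∈ σ, F ⊆ F' ∨ F' ⊆ F

/-- The chain `σ` together with the smallest and the largest flat. -/
def extended (r : Finset E → ℕ) (σ : Finset (Finset E)) : Finset (Finset E) :=
  insert (cl r ∅) (insert Finset.univ σ)

/-- Two consecutive members of the extended chain. -/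
structure Gap (r : Finset E → ℕ) (σ : Finset (Finset E)) (G H : Finset E) : Prop where
  left : G ∈ extended r σ
  right : H ∈ extended r σ
  lt : G ⊂ H
  sep : ∀ K ∈ extended r σ, K ⊆ G ∨ H ⊆ K

theorem mem_extended {σ : Finset (Finset E)} {K : Finset E} :
    K ∈ extended r σ ↔ K = cl r ∅ ∨ K = Finset.univ ∨ K ∈ σ := by simp [extended]

theorem mem_extended_of_mem {σ : Finset (Finset E)} {K : Finset E} (h : K ∈ σ) :
    K ∈ extended r σ := mem_extended.2 (Or.inr (Or.inr h))

theorem extended_subset_insert (σ : Finset (Finset E)) (F : Finset E) :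
    extended r σ ⊆ extended r (insert F σ) := by
  intro K hK
  rw [mem_extended] at hK ⊢
  rw [Finset.mem_insert]
  tauto

theorem Face.insert_iff {σ : Finset (Finset E)} {F : Finset E} (hσ : Face r σ) :
    Face r (insert F σ) ↔ (IsFlat r F ∧ cl r ∅ ⊂ F ∧ F ⊂ Finset.univ) ∧
      ∀ K ∈ σ, F ⊆ K ∨ K ⊆ F := by
  constructor
  · rintro ⟨h1, h2⟩
    exact ⟨h1 F (Finset.mem_insert_self _ _), fun K hK =>
      h2 F (Finset.mem_insert_self _ _) K (Finset.mem_insert_of_mem hK)⟩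
  · rintro ⟨h1, h2⟩
    refine ⟨fun K hK => ?_, fun K hK K' hK' => ?_⟩
    · rcases Finset.mem_insert.1 hK with rfl | hK
      exacts [h1, hσ.1 K hK]
    · rcases Finset.mem_insert.1 hK with rfl | hKσ <;>
        rcases Finset.mem_insert.1 hK' with rfl | hKσ'
      · exact Or.inl (Finset.Subset.refl _)
      · exact h2 K' hKσ'
      · exact (h2 K hKσ).symm
      · exact hσ.2 K hKσ K' hKσ'

variable (hr : IsRankFunction r)
include hr

theorem Face.isFlat {σ : Finset (Finset E)} (hσ : Face r σ) {K : Finset E}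
    (hK : K ∈ extended r σ) : IsFlat r K := by
  rcases mem_extended.1 hK with rfl | rfl | hK
  exacts [hr.isFlat_cl _, isFlat_univ, (hσ.1 K hK).1]

theorem Face.comparable {σ : Finset (Finset E)} (hσ : Face r σ) {K K' : Finset E}
    (hK : K ∈ extended r σ) (hK' : K' ∈ extended r σ) : K ⊆ K' ∨ K' ⊆ K := by
  rcases mem_extended.1 hK with rfl | rfl | h
  · exact Or.inl (hr.cl_empty_subset (hσ.isFlat hr hK'))
  · exact Or.inr (Finset.subset_univ _)
  · rcases mem_extended.1 hK' with rfl | rfl | h'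
    · exact Or.inr (hr.cl_empty_subset (hσ.isFlat hr hK))
    · exact Or.inl (Finset.subset_univ _)
    · exact hσ.2 K h K' h'

theorem Face.subset_of_rank_le {σ : Finset (Finset E)} (hσ : Face r σ) {K K' : Finset E}
    (hK : K ∈ extended r σ) (hK' : K' ∈ extended r σ) (h : r K ≤ r K') : K ⊆ K' := by
  rcases hσ.comparable hr hK hK' with h' | h'
  · exact h'
  · rw [hr.eq_of_subset_of_rank_le (hσ.isFlat hr hK') h' h]

theorem Face.exists_gap {σ : Finset (Finset E)} (hσ : Face r σ) {i : ℕ} (h0 : 0 < i)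
    (hi : i ≤ r Finset.univ) : ∃ G H, Gap r σ G H ∧ r G < i ∧ i ≤ r H := by
  have hL : cl r ∅ ∈ extended r σ := mem_extended.2 (Or.inl rfl)
  have hU : Finset.univ ∈ extended r σ := mem_extended.2 (Or.inr (Or.inl rfl))
  have hL0 : r (cl r ∅) = 0 := by rw [hr.rank_cl, hr.empty]
  obtain ⟨G, hG, hGmax⟩ := ((extended r σ).filter fun K => r K < i).exists_max_image r
    ⟨_, Finset.mem_filter.2 ⟨hL, by omega⟩⟩
  obtain ⟨H, hH, hHmin⟩ := ((extended r σ).filter fun K => i ≤ r K).exists_min_image r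
    ⟨_, Finset.mem_filter.2 ⟨hU, hi⟩⟩
  simp only [Finset.mem_filter, and_imp] at hG hH hGmax hHmin
  refine ⟨G, H, ⟨hG.1, hH.1, ?_, fun K hK => ?_⟩, hG.2, hH.2⟩
  · refine (hσ.subset_of_rank_le hr hG.1 hH.1 (by omega)).ssubset_of_ne ?_
    rintro rfl
    omega
  · by_cases h : r K < i
    · exact Or.inl (hσ.subset_of_rank_le hr hK hG.1 (hGmax K hK h))
    · exact Or.inr (hσ.subset_of_rank_le hr hH.1 hK (hHmin K hK (by omega)))

theorem Face.exists_gap_below {σ : Finset (Finset E)} (hσ : Face r σ) {F : Finset E}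
    (hF : F ∈ extended r σ) (h : cl r ∅ ⊂ F) : ∃ G, Gap r σ G F := by
  obtain ⟨G, H, hgap, h1, h2⟩ := hσ.exists_gap hr (i := r F)
    ((Nat.zero_le _).trans_lt (hr.rank_lt (hr.isFlat_cl _) h)) (hr.mono _ _ (Finset.subset_univ _))
  have : F = H := by
    rcases hgap.sep F hF with h3 | h3
    · exact absurd (hr.mono _ _ h3) (by omega)
    · exact Finset.Subset.antisymm (hσ.subset_of_rank_le hr hF hgap.right h2) h3
  exact ⟨G, this ▸ hgap⟩

theorem Face.exists_gap_above {σ : Finset (Finset E)} (hσ : Face r σ) {F : Finset E}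
    (hF : F ∈ extended r σ) (h : F ⊂ Finset.univ) : ∃ H, Gap r σ F H := by
  obtain ⟨G, H, hgap, h1, h2⟩ := hσ.exists_gap hr (i := r F + 1) (by omega)
    (hr.rank_lt (hσ.isFlat hr hF) h)
  have : F = G := by
    rcases hgap.sep F hF with h3 | h3
    · exact Finset.Subset.antisymm h3 (hσ.subset_of_rank_le hr hgap.left hF (by omega))
    · exact absurd (hr.mono _ _ h3) (by omega)
  exact ⟨H, this ▸ hgap⟩

/-- The ranks not attained on the chain. -/
theorem Face.card_missing {σ : Finset (Finset E)} (hσ : Face r σ) :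
    ((Finset.Ioo 0 (r Finset.univ)).filter fun i => ∀ K ∈ σ, r K ≠ i).card + σ.card =
      r Finset.univ - 1 := by
  have himg : (σ.image r).card = σ.card := Finset.card_image_of_injOn fun K hK K' hK' h =>
    Finset.Subset.antisymm
      (hσ.subset_of_rank_le hr (mem_extended_of_mem hK) (mem_extended_of_mem hK') h.le)
      (hσ.subset_of_rank_le hr (mem_extended_of_mem hK') (mem_extended_of_mem hK) h.ge)
  have hsub : σ.image r ⊆ Finset.Ioo 0 (r Finset.univ) := by
    intro i hi
    obtain ⟨K, hK, rfl⟩ := Finset.mem_image.1 hi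
    obtain ⟨h1, h2, h3⟩ := hσ.1 K hK
    exact Finset.mem_Ioo.2 ⟨(Nat.zero_le _).trans_lt (hr.rank_lt (hr.isFlat_cl _) h2),
      hr.rank_lt h1 h3⟩
  have : (Finset.Ioo 0 (r Finset.univ)).filter (fun i => ∀ K ∈ σ, r K ≠ i) =
      Finset.Ioo 0 (r Finset.univ) \ σ.image r := by
    ext i
    simp [Finset.mem_filter, Finset.mem_sdiff]
  rw [this, ← himg, Finset.card_sdiff_add_card_eq_card hsub, Nat.card_Ioo]
  omega

theorem Gap.ioo_subset {σ : Finset (Finset E)} {G H : Finset E} (hgap : Gap r σ G H) :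
    Finset.Ioo (r G) (r H) ⊆
      (Finset.Ioo 0 (r Finset.univ)).filter fun i => ∀ K ∈ σ, r K ≠ i := by
  intro i hi
  rw [Finset.mem_Ioo] at hi
  have := hr.mono H _ (Finset.subset_univ _)
  refine Finset.mem_filter.2 ⟨Finset.mem_Ioo.2 ⟨by omega, by omega⟩, fun K hK hKi => ?_⟩
  rcases hgap.sep K (mem_extended_of_mem hK) with h | h
  · have := hr.mono _ _ h; omega
  · have := hr.mono _ _ h; omega

theorem Gap.insert_mem {σ : Finset (Finset E)} (hσ : Face r σ) {G H F : Finset E}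
    (hgap : Gap r σ G H) (hF : IsFlat r F) (hGF : G ⊂ F) (hFH : F ⊂ H) :
    F ∉ σ ∧ Face r (insert F σ) := by
  refine ⟨fun h => ?_, hσ.insert_iff.2 ⟨⟨hF, ?_, ?_⟩, fun K hK => ?_⟩⟩
  · rcases hgap.sep F (mem_extended_of_mem h) with h | h
    exacts [hGF.2 h, hFH.2 h]
  · exact Finset.ssubset_of_subset_of_ssubset (hr.cl_empty_subset (hσ.isFlat hr hgap.left)) hGF
  · exact Finset.ssubset_of_ssubset_of_subset hFH (Finset.subset_univ _)
  · rcases hgap.sep K (mem_extended_of_mem hK) with h | h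
    exacts [Or.inr (h.trans hGF.1), Or.inl (hFH.1.trans h)]

omit hr in
theorem Gap.insert_of_subset {σ : Finset (Finset E)} {G H F : Finset E}
    (hgap : Gap r σ G H) (h : F ⊆ G ∨ H ⊆ F) : Gap r (insert F σ) G H := by
  have hsub := extended_subset_insert (r := r) σ F
  refine ⟨hsub hgap.left, hsub hgap.right, hgap.lt, fun K hK => ?_⟩
  rcases mem_extended.1 hK with hK | hK | hK
  · exact hgap.sep K (mem_extended.2 (Or.inl hK))
  · exact hgap.sep K (mem_extended.2 (Or.inr (Or.inl hK)))
  · rcases Finset.mem_insert.1 hK with rfl | hK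
    exacts [h, hgap.sep K (mem_extended_of_mem hK)]

omit hr in
theorem Gap.insert_below {σ : Finset (Finset E)} {G H F : Finset E}
    (hgap : Gap r σ G H) (hGF : G ⊂ F) (hFH : F ⊂ H) : Gap r (insert F σ) G F := by
  refine ⟨?_, mem_extended_of_mem (Finset.mem_insert_self _ _), hGF, fun K hK => ?_⟩
  · have := mem_extended.1 hgap.left
    rw [mem_extended, Finset.mem_insert]; tauto
  · by_cases hKF : K = F
    · exact Or.inr hKF.ge
    · have hK' : K ∈ extended r σ := by
        rw [mem_extended] at hK ⊢
        rw [Finset.mem_insert] at hK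
        tauto
      exact (hgap.sep K hK').imp_right hFH.1.trans

omit hr in
theorem Gap.insert_above {σ : Finset (Finset E)} {G H F : Finset E}
    (hgap : Gap r σ G H) (hGF : G ⊂ F) (hFH : F ⊂ H) : Gap r (insert F σ) F H := by
  refine ⟨mem_extended_of_mem (Finset.mem_insert_self _ _), ?_, hFH, fun K hK => ?_⟩
  · have := mem_extended.1 hgap.right
    rw [mem_extended, Finset.mem_insert]; tauto
  · by_cases hKF : K = F
    · exact Or.inl hKF.le
    · have hK' : K ∈ extended r σ := by
        rw [mem_extended] at hK ⊢
        rw [Finset.mem_insert] at hK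
        tauto
      exact (hgap.sep K hK').imp_left fun h => h.trans hGF.1

theorem Face.exists_gap_of_insert {σ : Finset (Finset E)} (hσ : Face r σ) {F : Finset E}
    (hFσ : F ∉ σ) (hF : Face r (insert F σ)) : ∃ G H, Gap r σ G H ∧ G ⊂ F ∧ F ⊂ H := by
  obtain ⟨⟨h1, h2, h3⟩, h4⟩ := hσ.insert_iff.1 hF
  obtain ⟨G, H, hgap, hG, hH⟩ := hσ.exists_gap hr (i := r F)
    ((Nat.zero_le _).trans_lt (hr.rank_lt (hr.isFlat_cl _) h2)) (hr.mono _ _ (Finset.subset_univ _))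
  have hsub := extended_subset_insert (r := r) σ F
  have hFe : F ∈ extended r (insert F σ) := mem_extended_of_mem (Finset.mem_insert_self _ _)
  refine ⟨G, H, hgap, (hF.subset_of_rank_le hr (hsub hgap.left) hFe hG.le).ssubset_of_ne ?_,
    (hF.subset_of_rank_le hr hFe (hsub hgap.right) hH).ssubset_of_ne ?_⟩
  · rintro rfl
    omega
  · rintro rfl
    rcases mem_extended.1 hgap.right with h | h | h
    exacts [h2.ne h.symm, h3.ne h, hFσ h]

/-- If a gap contains all missing ranks, then it contains the whole link. -/
theorem Gap.between {σ : Finset (Finset E)} (hσ : Face r σ) {G H F : Finset E}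
    (hgap : Gap r σ G H) (hfull : σ.card + (r H - r G) = r Finset.univ)
    (hFσ : F ∉ σ) (hF : Face r (insert F σ)) : G ⊂ F ∧ F ⊂ H := by
  obtain ⟨G', H', hgap', h1, h2⟩ := hσ.exists_gap_of_insert hr hFσ hF
  have hrG := hr.rank_lt (hσ.isFlat hr hgap.left) hgap.lt
  have heq := Finset.eq_of_subset_of_card_le (hgap.ioo_subset hr) (by
    have := hσ.card_missing hr
    rw [Nat.card_Ioo]
    omega)
  have hFlat := (hF.1 F (Finset.mem_insert_self _ _)).1
  have hmem : r F ∈ Finset.Ioo (r G) (r H) := by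
    rw [heq]
    refine hgap'.ioo_subset hr (Finset.mem_Ioo.2 ⟨hr.rank_lt (hσ.isFlat hr hgap'.left) h1,
      hr.rank_lt hFlat h2⟩)
  rw [Finset.mem_Ioo] at hmem
  have hsub := extended_subset_insert (r := r) σ F
  have hFe : F ∈ extended r (insert F σ) := mem_extended_of_mem (Finset.mem_insert_self _ _)
  refine ⟨(hF.subset_of_rank_le hr (hsub hgap.left) hFe hmem.1.le).ssubset_of_ne ?_,
    (hF.subset_of_rank_le hr hFe (hsub hgap.right) hmem.2.le).ssubset_of_ne ?_⟩
  · rintro rfl; omega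
  · rintro rfl; omega

end BergmanFan

namespace BergmanFan

open IsRankFunction

variable {E : Type*} [Fintype E] [DecidableEq E] {r : Finset E → ℕ}

/-- The linear functions on the Bergman fan. -/
def linearFunctions (r : Finset E → ℕ) : Submodule ℝ (Finset E → ℝ) where
  carrier := {ℓ | ∃ a : E → ℝ, ∑ e, a e = 0 ∧ ∑ e ∈ cl r ∅, a e = 0 ∧ ∀ F, ℓ F = ∑ e ∈ F, a e}
  zero_mem' := ⟨0, by simp⟩
  add_mem' := by
    rintro ℓ ℓ' ⟨a, h1, h2, h3⟩ ⟨a', h1', h2', h3'⟩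
    exact ⟨a + a', by simp [Finset.sum_add_distrib, h1, h1'],
      by simp [Finset.sum_add_distrib, h2, h2'],
      fun F => by simp [Finset.sum_add_distrib, h3, h3']⟩
  smul_mem' := by
    rintro c ℓ ⟨a, h1, h2, h3⟩
    exact ⟨c • a, by simp [← Finset.mul_sum, h1], by simp [← Finset.mul_sum, h2],
      fun F => by simp [← Finset.mul_sum, h3]⟩

theorem apply_eq_zero_of_mem_extended {ℓ : Finset E → ℝ} (hℓ : ℓ ∈ linearFunctions r)
    {σ : Finset (Finset E)} (h : ∀ K ∈ σ, ℓ K = 0) {K : Finset E} (hK : K ∈ extended r σ) :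
    ℓ K = 0 := by
  obtain ⟨a, h1, h2, h3⟩ := hℓ
  rcases mem_extended.1 hK with rfl | rfl | hK
  exacts [(h3 _).trans h2, (h3 _).trans h1, h K hK]

variable (hr : IsRankFunction r)
include hr

theorem Face.exists_dual {σ : Finset (Finset E)} (hσ : Face r σ) {F : Finset E} (hF : F ∈ σ) :
    ∃ a : E → ℝ, (∑ e ∈ F, a e = 1 ∧ ∀ K ∈ extended r σ, K ≠ F → ∑ e ∈ K, a e = 0) ∧
      ∀ e e', (∀ K ∈ extended r σ, e ∈ K ↔ e' ∈ K) → a e = a e' := by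
  obtain ⟨-, hLF, hFU⟩ := hσ.1 F hF
  obtain ⟨G, hG⟩ := hσ.exists_gap_below hr (mem_extended_of_mem hF) hLF
  obtain ⟨H, hH⟩ := hσ.exists_gap_above hr (mem_extended_of_mem hF) hFU
  have hGF : ((F \ G).card : ℝ) ≠ 0 := by
    rw [Nat.cast_ne_zero, Finset.card_ne_zero]
    exact Finset.sdiff_nonempty.2 hG.lt.2
  have hFH : ((H \ F).card : ℝ) ≠ 0 := by
    rw [Nat.cast_ne_zero, Finset.card_ne_zero]
    exact Finset.sdiff_nonempty.2 hH.lt.2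
  have hsum : ∀ K : Finset E, ∑ e ∈ K, (((F \ G).card : ℝ)⁻¹ * (if e ∈ F \ G then 1 else 0) -
      ((H \ F).card : ℝ)⁻¹ * (if e ∈ H \ F then 1 else 0)) =
      ((F \ G).card : ℝ)⁻¹ * (K ∩ (F \ G)).card - ((H \ F).card : ℝ)⁻¹ * (K ∩ (H \ F)).card := by
    intro K
    rw [Finset.sum_sub_distrib, ← Finset.mul_sum, ← Finset.mul_sum, Finset.sum_boole,
      Finset.sum_boole, Finset.filter_mem_eq_inter, Finset.filter_mem_eq_inter]
  refine ⟨fun e => ((F \ G).card : ℝ)⁻¹ * (if e ∈ F \ G then 1 else 0) -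
    ((H \ F).card : ℝ)⁻¹ * (if e ∈ H \ F then 1 else 0), ⟨?_, fun K hK hKF => ?_⟩,
    fun e e' h => ?_⟩
  · rw [hsum, Finset.inter_eq_right.2 Finset.sdiff_subset, Finset.inter_sdiff_self]
    simp [hGF]
  · rw [hsum]
    rcases hG.sep K hK with h | h
    · rw [Finset.disjoint_iff_inter_eq_empty.1 (Finset.disjoint_sdiff.mono_left h),
        Finset.disjoint_iff_inter_eq_empty.1
          (Finset.disjoint_sdiff.mono_left (h.trans hG.lt.1))]
      simp
    · have hHK := (hH.sep K hK).resolve_left fun h' => hKF (Finset.Subset.antisymm h' h)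
      rw [Finset.inter_eq_right.2 (Finset.sdiff_subset.trans h),
        Finset.inter_eq_right.2 (Finset.sdiff_subset.trans hHK), inv_mul_cancel₀ hGF,
        inv_mul_cancel₀ hFH, sub_self]
  · simp only [Finset.mem_sdiff, h F (mem_extended_of_mem hF), h G hG.left, h H hH.right]

/-- Every function on a face extends to a linear function with constant weights on each gap. -/
theorem Face.exists_lift {σ : Finset (Finset E)} (hσ : Face r σ) {x : Finset E → ℝ}
    (hx : x (cl r ∅) = 0) (hx' : x Finset.univ = 0) :
    ∃ ℓ ∈ linearFunctions r, (∀ K ∈ extended r σ, ℓ K = x K) ∧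
      ∀ G H F, Gap r σ G H → G ⊆ F → F ⊆ H →
        ℓ F * ((H.card : ℝ) - G.card) =
          x G * ((H.card : ℝ) - F.card) + x H * ((F.card : ℝ) - G.card) := by
  choose! a ha hunif using fun F (hF : F ∈ σ) => hσ.exists_dual hr hF
  have hK : ∀ K ∈ extended r σ, ∑ e ∈ K, ∑ F ∈ σ, x F * a F e = x K := by
    intro K hK
    rw [Finset.sum_comm]
    simp_rw [← Finset.mul_sum]
    by_cases hKσ : K ∈ σ
    · rw [Finset.sum_eq_single_of_mem K hKσ fun F hF hFK => by
        rw [(ha F hF).2 K hK hFK.symm, mul_zero], (ha K hKσ).1, mul_one]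
    · rw [Finset.sum_eq_zero fun F hF => by
        rw [(ha F hF).2 K hK (by rintro rfl; exact hKσ hF), mul_zero]]
      rcases mem_extended.1 hK with rfl | rfl | h
      exacts [hx.symm, hx'.symm, absurd h hKσ]
  have hL : cl r ∅ ∈ extended r σ := mem_extended.2 (Or.inl rfl)
  have hU : Finset.univ ∈ extended r σ := mem_extended.2 (Or.inr (Or.inl rfl))
  refine ⟨fun K => ∑ e ∈ K, ∑ F ∈ σ, x F * a F e,
    ⟨_, (hK _ hU).trans hx', (hK _ hL).trans hx, fun _ => rfl⟩, hK, ?_⟩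
  intro G H F hgap hGF hFH
  obtain ⟨e₀, he₀H, he₀G⟩ := Finset.exists_of_ssubset hgap.lt
  have hconst : ∀ e ∈ H \ G, ∑ F ∈ σ, x F * a F e = ∑ F ∈ σ, x F * a F e₀ := by
    intro e he
    rw [Finset.mem_sdiff] at he
    refine Finset.sum_congr rfl fun F hF => ?_
    rw [hunif F hF e e₀ fun K hK => ?_]
    rcases hgap.sep K hK with h | h
    · exact iff_of_false (fun h' => he.2 (h h')) (fun h' => he₀G (h h'))
    · exact iff_of_true (h he.1) (h he₀H)
  have hsum : ∀ K, G ⊆ K → K ⊆ H → ∑ e ∈ K, ∑ F ∈ σ, x F * a F e =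
      x G + ((K.card : ℝ) - G.card) * ∑ F ∈ σ, x F * a F e₀ := by
    intro K hGK hKH
    rw [← Finset.sum_sdiff hGK, hK G hgap.left, Finset.sum_congr rfl fun e he =>
      hconst e (Finset.sdiff_subset_sdiff hKH (Finset.Subset.refl _) he), Finset.sum_const,
      Finset.card_sdiff_of_subset hGK, nsmul_eq_mul, Nat.cast_sub (Finset.card_le_card hGK)]
    ring
  have hH := hsum H hgap.lt.1 (Finset.Subset.refl _)
  rw [hK H hgap.right] at hH
  change (∑ e ∈ F, ∑ F ∈ σ, x F * a F e) * _ = _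
  rw [hsum F hGF hFH, hH]
  ring

theorem Face.exists_gap_of_missing {σ : Finset (Finset E)} (hσ : Face r σ) {i : ℕ}
    (hi : i ∈ (Finset.Ioo 0 (r Finset.univ)).filter fun i => ∀ K ∈ σ, r K ≠ i) :
    ∃ G H, Gap r σ G H ∧ r G < i ∧ i < r H := by
  rw [Finset.mem_filter, Finset.mem_Ioo] at hi
  obtain ⟨G, H, hgap, h1, h2⟩ := hσ.exists_gap hr hi.1.1 hi.1.2.le
  refine ⟨G, H, hgap, h1, h2.lt_of_ne ?_⟩
  rcases mem_extended.1 hgap.right with h | h | h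
  · rw [h, hr.rank_cl, hr.empty]; omega
  · rw [h]; omega
  · exact (hi.2 H h).symm

theorem Face.exists_insert {σ : Finset (Finset E)} (hσ : Face r σ)
    (h : σ.card < r Finset.univ - 1) : ∃ F, F ∉ σ ∧ Face r (insert F σ) := by
  have hcard := hσ.card_missing hr
  obtain ⟨i, hi⟩ := Finset.card_pos.1 (show 0 < ((Finset.Ioo 0 (r Finset.univ)).filter
    fun i => ∀ K ∈ σ, r K ≠ i).card by omega)
  obtain ⟨G, H, hgap, h1, h2⟩ := hσ.exists_gap_of_missing hr hi
  obtain ⟨F, hF, hGF, hFH, hFi⟩ := hr.exists_flat_between (hσ.isFlat hr hgap.left)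
    (hσ.isFlat hr hgap.right) hgap.lt.1 h1.le h2.le
  exact ⟨F, hgap.insert_mem hr hσ hF (hGF.ssubset_of_ne (by rintro rfl; omega))
    (hFH.ssubset_of_ne (by rintro rfl; omega))⟩

theorem Face.exists_full_gap {σ : Finset (Finset E)} (hσ : Face r σ)
    (h : σ.card + 2 = r Finset.univ) : ∃ G H, Gap r σ G H ∧ r H = r G + 2 := by
  have hcard := hσ.card_missing hr
  obtain ⟨i, hi⟩ := Finset.card_pos.1 (show 0 < ((Finset.Ioo 0 (r Finset.univ)).filter
    fun i => ∀ K ∈ σ, r K ≠ i).card by omega)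
  obtain ⟨G, H, hgap, h1, h2⟩ := hσ.exists_gap_of_missing hr hi
  have := Finset.card_le_card (hgap.ioo_subset hr)
  rw [Nat.card_Ioo] at this
  exact ⟨G, H, hgap, by omega⟩

omit hr in
open Classical in
/-- The flats covering `G` inside `H`. -/
noncomputable def covers (r : Finset E → ℕ) (G H : Finset E) : Finset (Finset E) :=
  Finset.univ.filter fun F => IsFlat r F ∧ G ⊆ F ∧ F ⊆ H ∧ r F = r G + 1

omit hr in
theorem mem_covers {G H F : Finset E} :
    F ∈ covers r G H ↔ IsFlat r F ∧ G ⊆ F ∧ F ⊆ H ∧ r F = r G + 1 := by simp [covers]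

theorem sum_covers_linear {G H : Finset E} (hG : IsFlat r G) (hH : IsFlat r H) (hGH : G ⊆ H)
    {ℓ : Finset E → ℝ} (hℓ : ℓ ∈ linearFunctions r) :
    ∑ F ∈ covers r G H, (ℓ F - ℓ G) = ℓ H - ℓ G := by
  obtain ⟨a, -, -, ha⟩ := hℓ
  have hdiff : ∀ K, G ⊆ K → ℓ K - ℓ G = ∑ e ∈ K \ G, a e := by
    intro K hK
    rw [ha, ha, ← Finset.sum_sdiff hK, add_sub_cancel_right]
  rw [Finset.sum_congr rfl fun F hF => hdiff F (mem_covers.1 hF).2.1,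
    hr.sum_covers hG hH hGH (fun F => mem_covers) fun _ => a, ← hdiff H hGH]

theorem Gap.mem_covers_iff {σ : Finset (Finset E)} (hσ : Face r σ) {G H : Finset E}
    (hgap : Gap r σ G H) (hrk : r H = r G + 2) (hcard : σ.card + 2 = r Finset.univ)
    {F : Finset E} : F ∈ covers r G H ↔ F ∉ σ ∧ Face r (insert F σ) := by
  rw [mem_covers]
  constructor
  · rintro ⟨hF, h3, h4, h5⟩
    exact hgap.insert_mem hr hσ hF (h3.ssubset_of_ne (by rintro rfl; omega))
      (h4.ssubset_of_ne (by rintro rfl; omega))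
  · rintro ⟨h1, h2⟩
    have hF := (h2.1 F (Finset.mem_insert_self _ _)).1
    obtain ⟨h3, h4⟩ := hgap.between hr hσ (by omega) h1 h2
    have := hr.rank_lt (hσ.isFlat hr hgap.left) h3
    have := hr.rank_lt hF h4
    exact ⟨hF, h3.1, h4.1, by omega⟩

theorem Face.sum_eq_zero {σ : Finset (Finset E)} (hσ : Face r σ)
    (hcard : σ.card + 2 = r Finset.univ) {ℓ : Finset E → ℝ} (hℓ : ℓ ∈ linearFunctions r)
    (h0 : ∀ K ∈ σ, ℓ K = 0) {s : Finset (Finset E)}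
    (hs : ∀ F, F ∈ s ↔ F ∉ σ ∧ Face r (insert F σ)) : ∑ F ∈ s, ℓ F = 0 := by
  obtain ⟨G, H, hgap, hrk⟩ := hσ.exists_full_gap hr hcard
  have hs' : s = covers r G H := by
    ext F
    rw [hs, hgap.mem_covers_iff hr hσ hrk hcard]
  have := sum_covers_linear hr (hσ.isFlat hr hgap.left) (hσ.isFlat hr hgap.right) hgap.lt.1 hℓ
  rw [apply_eq_zero_of_mem_extended hℓ h0 hgap.left,
    apply_eq_zero_of_mem_extended hℓ h0 hgap.right] at this
  simpa [hs'] using this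

end BergmanFan

open BergmanFan IsRankFunction in
/-- The Bergman fan of a matroid given by its rank function. -/
def bergmanFan {E : Type*} [Fintype E] [DecidableEq E] {r : Finset E → ℕ}
    (hr : IsRankFunction r) : BalancedFan (Finset E) where
  Λ := linearFunctions r
  face := Face r
  dim := r Finset.univ - 1
  face_empty := ⟨by simp, by simp⟩
  face_mono _ _ h hsub := ⟨fun F hF => h.1 F (hsub hF), fun F hF F' hF' =>
    h.2 F (hsub hF) F' (hsub hF')⟩
  card_le σ hσ := by have := hσ.card_missing hr; omega
  extend σ hσ h := hσ.exists_insert hr h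
  unimodular σ hσ F hF := by
    have hF' := hσ.1 F hF
    obtain ⟨ℓ, hℓ, h1, -⟩ := hσ.exists_lift hr (x := Pi.single F 1)
      (Pi.single_eq_of_ne hF'.2.1.ne _) (Pi.single_eq_of_ne hF'.2.2.ne' _)
    refine ⟨ℓ, hℓ, ?_, fun K hK hKF => ?_⟩
    · rw [h1 F (mem_extended_of_mem hF), Pi.single_eq_same]
    · rw [h1 K (mem_extended_of_mem hK), Pi.single_eq_of_ne hKF]
  balanced σ hσ hcard ℓ hℓ h0 s hs := hσ.sum_eq_zero hr (by omega) hℓ h0 hs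

namespace BergmanFan

open IsRankFunction

variable {E : Type*} [Fintype E] [DecidableEq E] {r : Finset E → ℕ} (hr : IsRankFunction r)

theorem mem_link_iff {σ : Finset (Finset E)} {F : Finset E} :
    F ∈ (bergmanFan hr).link σ ↔ F ∉ σ ∧ Face r (insert F σ) := BalancedFan.mem_link

theorem mem_link_insert {σ : Finset (Finset E)} {v w : Finset E}
    (hv : v ∈ (bergmanFan hr).link σ) (hw : w ∈ (bergmanFan hr).link σ) (hne : v ≠ w)
    (h : v ⊆ w ∨ w ⊆ v) : w ∈ (bergmanFan hr).link (insert v σ) := by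
  rw [mem_link_iff] at hv hw ⊢
  have h1 := hw.2.1 w (Finset.mem_insert_self _ _)
  refine ⟨by simp [hne.symm, hw.1], hv.2.insert_iff.2 ⟨h1, fun K hK => ?_⟩⟩
  rcases Finset.mem_insert.1 hK with rfl | hK
  · exact h.symm
  · exact hw.2.2 w (Finset.mem_insert_self _ _) K (Finset.mem_insert_of_mem hK)

theorem Gap.mem_link {σ : Finset (Finset E)} (hσ : Face r σ) {G H F : Finset E}
    (hgap : Gap r σ G H) (hF : IsFlat r F) (hGF : G ⊂ F) (hFH : F ⊂ H) :
    F ∈ (bergmanFan hr).link σ :=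
  (mem_link_iff hr).2 (hgap.insert_mem hr hσ hF hGF hFH)

theorem Face.connected {σ : Finset (Finset E)} (hσ : Face r σ)
    (hcard : σ.card + 3 ≤ r Finset.univ) {f : Finset E → ℝ}
    (hf : ∀ v ∈ (bergmanFan hr).link σ, ∀ w ∈ (bergmanFan hr).link (insert v σ), f v = f w) :
    ∀ v ∈ (bergmanFan hr).link σ, ∀ w ∈ (bergmanFan hr).link σ, f v = f w := by
  have hcomp : ∀ v ∈ (bergmanFan hr).link σ, ∀ w ∈ (bergmanFan hr).link σ, v ⊆ w ∨ w ⊆ v →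
      f v = f w := by
    intro v hv w hw h
    by_cases hne : v = w
    · rw [hne]
    · exact hf v hv w (mem_link_insert hr hv hw hne h)
  intro v hv w hw
  by_cases hvw : v ⊆ w
  · exact hcomp v hv w hw (Or.inl hvw)
  by_cases hwv : w ⊆ v
  · exact hcomp v hv w hw (Or.inr hwv)
  have hv' := (mem_link_iff hr).1 hv
  have hw' := (mem_link_iff hr).1 hw
  obtain ⟨⟨hvf, hLv, hvU⟩, hvc⟩ := hσ.insert_iff.1 hv'.2
  obtain ⟨⟨hwf, hLw, -⟩, hwc⟩ := hσ.insert_iff.1 hw'.2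
  have hIf := hr.isFlat_inter hvf hwf
  have hJf := hr.isFlat_cl (v ∪ w)
  have hvJ : v ⊂ cl r (v ∪ w) := ⟨Finset.subset_union_left.trans (subset_cl _), fun h =>
    hwv ((Finset.subset_union_right.trans (subset_cl _)).trans h)⟩
  have hwJ : w ⊂ cl r (v ∪ w) := ⟨Finset.subset_union_right.trans (subset_cl _), fun h =>
    hvw ((Finset.subset_union_left.trans (subset_cl _)).trans h)⟩
  have hIv : v ∩ w ⊂ v := ⟨Finset.inter_subset_left, fun h =>
    hvw (h.trans Finset.inter_subset_right)⟩
  have hIw : v ∩ w ⊂ w := ⟨Finset.inter_subset_right, fun h =>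
    hwv (h.trans Finset.inter_subset_left)⟩
  have hsep : ∀ K ∈ σ, K ⊆ v ∩ w ∨ cl r (v ∪ w) ⊆ K := by
    intro K hK
    rcases hvc K hK with h1 | h1 <;> rcases hwc K hK with h2 | h2
    · exact Or.inr (hr.cl_subset (hσ.1 K hK).1 (Finset.union_subset h1 h2))
    · exact absurd (h1.trans h2) hvw
    · exact absurd (h2.trans h1) hwv
    · exact Or.inl (Finset.subset_inter h1 h2)
  have hLI := hr.cl_empty_subset hIf
  by_cases hJ : cl r (v ∪ w) ∈ extended r σ
  swap
  · have hmem : cl r (v ∪ w) ∈ (bergmanFan hr).link σ := by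
      rw [mem_link_iff]
      refine ⟨fun h => hJ (mem_extended_of_mem h), hσ.insert_iff.2 ⟨⟨hJf,
        Finset.ssubset_of_ssubset_of_subset hLv hvJ.1,
        (Finset.subset_univ _).ssubset_of_ne fun h => hJ (by rw [mem_extended]; tauto)⟩,
        fun K hK => ?_⟩⟩
      exact (hsep K hK).elim (fun h => Or.inr ((h.trans hIv.1).trans hvJ.1)) Or.inl
    rw [hcomp v hv _ hmem (Or.inl hvJ.1), hcomp w hw _ hmem (Or.inl hwJ.1)]
  by_cases hI : v ∩ w ∈ extended r σ
  swap
  · have hmem : v ∩ w ∈ (bergmanFan hr).link σ := by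
      rw [mem_link_iff]
      refine ⟨fun h => hI (mem_extended_of_mem h), hσ.insert_iff.2 ⟨⟨hIf,
        hLI.ssubset_of_ne fun h => hI (by rw [mem_extended]; exact Or.inl h.symm),
        Finset.ssubset_of_ssubset_of_subset hIv hvU.1⟩, fun K hK => ?_⟩⟩
      exact (hsep K hK).elim Or.inr fun h => Or.inl ((hIv.1.trans hvJ.1).trans h)
    rw [hcomp v hv _ hmem (Or.inr hIv.1), hcomp w hw _ hmem (Or.inr hIw.1)]
  have hgap : Gap r σ (v ∩ w) (cl r (v ∪ w)) := by
    refine ⟨hI, hJ, Finset.ssubset_of_ssubset_of_subset hIv hvJ.1, fun K hK => ?_⟩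
    rcases mem_extended.1 hK with rfl | rfl | h
    exacts [Or.inl hLI, Or.inr (Finset.subset_univ _), hsep K h]
  have hrI := hr.rank_lt hIf hIv
  have hrJ := hr.rank_lt hvf hvJ
  by_cases h3 : r (v ∩ w) + 3 ≤ r (cl r (v ∪ w))
  · obtain ⟨e, hev, heI⟩ := Finset.exists_of_ssubset hIv
    obtain ⟨e', hew, heI'⟩ := Finset.exists_of_ssubset hIw
    have hpt : ∀ u, v ∩ w ⊆ u → u ⊂ cl r (v ∪ w) → IsFlat r u → ∀ e ∈ u, e ∉ v ∩ w →
        cl r (insert e (v ∩ w)) ⊆ u ∧ cl r (insert e (v ∩ w)) ∈ (bergmanFan hr).link σ := by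
      intro u hIu huJ hu e heu heI
      have h1 := hr.cl_subset hu (Finset.insert_subset heu hIu)
      refine ⟨h1, hgap.mem_link hr hσ (hr.isFlat_cl _) ⟨?_, fun h => heI (h ?_)⟩
        (Finset.ssubset_of_subset_of_ssubset h1 huJ)⟩
      · exact (Finset.subset_insert _ _).trans (subset_cl _)
      · exact subset_cl _ (Finset.mem_insert_self _ _)
    obtain ⟨h4, h5⟩ := hpt v hIv.1 hvJ hvf e hev heI
    obtain ⟨h6, h7⟩ := hpt w hIw.1 hwJ hwf e' hew heI'
    have h8 : cl r (insert e (insert e' (v ∩ w))) ∈ (bergmanFan hr).link σ := by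
      refine hgap.mem_link hr hσ (hr.isFlat_cl _) ⟨?_, fun h => heI (h ?_)⟩ ⟨?_, fun h => ?_⟩
      · exact ((Finset.subset_insert _ _).trans (Finset.subset_insert _ _)).trans (subset_cl _)
      · exact subset_cl _ (Finset.mem_insert_self _ _)
      · exact hr.cl_subset hJf (Finset.insert_subset (hvJ.1 hev)
          (Finset.insert_subset (hwJ.1 hew) hgap.lt.1))
      · have h9 := hr.mono _ _ h
        rw [hr.rank_cl (insert e _)] at h9
        have := hr.insert_le e (insert e' (v ∩ w))
        have := hr.insert_le e' (v ∩ w)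
        omega
    rw [← hcomp _ h5 _ hv (Or.inl h4), ← hcomp _ h7 _ hw (Or.inl h6),
      hcomp _ h5 _ h8 (Or.inl (hr.cl_mono
        (Finset.insert_subset_insert _ (Finset.subset_insert _ _)))),
      hcomp _ h7 _ h8 (Or.inl (hr.cl_mono (Finset.subset_insert _ _)))]
  · have hmiss := hσ.card_missing hr
    obtain ⟨i, hi, hiI⟩ := Finset.exists_mem_notMem_of_card_lt_card
      (show (Finset.Ioo (r (v ∩ w)) (r (cl r (v ∪ w)))).card <
        ((Finset.Ioo 0 (r Finset.univ)).filter fun i => ∀ K ∈ σ, r K ≠ i).card by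
        rw [Nat.card_Ioo]; omega)
    obtain ⟨G, H, hgap', h1, h2⟩ := hσ.exists_gap_of_missing hr hi
    obtain ⟨F, hF, hGF, hFH, rfl⟩ := hr.exists_flat_between (hσ.isFlat hr hgap'.left)
      (hσ.isFlat hr hgap'.right) hgap'.lt.1 h1.le h2.le
    have hFl := hgap'.mem_link hr hσ hF (hGF.ssubset_of_ne (by rintro rfl; omega))
      (hFH.ssubset_of_ne (by rintro rfl; omega))
    rw [Finset.mem_Ioo] at hiI
    have hcases : F ⊆ v ∩ w ∨ cl r (v ∪ w) ⊆ F := by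
      rcases hgap.sep G hgap'.left with h3 | h3
      · rcases hgap.sep H hgap'.right with h4 | h4
        · exact Or.inl (hFH.trans h4)
        · rcases hgap'.sep _ hI with h5 | h5
          · rcases hgap'.sep _ hJ with h6 | h6
            · exact Or.inr (h6.trans hGF)
            · have := hr.mono _ _ h5
              have := hr.mono _ _ h6
              omega
          · exact Or.inl (hFH.trans h5)
      · exact Or.inr (h3.trans hGF)
    rcases hcases with h | h
    · rw [hcomp v hv F hFl (Or.inr (h.trans hIv.1)), hcomp w hw F hFl (Or.inr (h.trans hIw.1))]
    · rw [hcomp v hv F hFl (Or.inl (hvJ.1.trans h)), hcomp w hw F hFl (Or.inl (hwJ.1.trans h))]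

end BergmanFan

namespace BergmanFan

open IsRankFunction

variable {E : Type*} [Fintype E] [DecidableEq E] {r : Finset E → ℕ} (hr : IsRankFunction r)

theorem dim_eq : (bergmanFan hr).dim = r Finset.univ - 1 := rfl

theorem Gap.link_eq {σ : Finset (Finset E)} (hσ : Face r σ) {G H : Finset E}
    (hgap : Gap r σ G H) (hrk : r H = r G + 2) (hcard : σ.card + 2 = r Finset.univ) :
    (bergmanFan hr).link σ = covers r G H := by
  ext F
  rw [mem_link_iff, hgap.mem_covers_iff hr hσ hrk hcard]

theorem Gap.degree_singleton {σ : Finset (Finset E)} {A B v : Finset E}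
    (hv : v ∈ (bergmanFan hr).link σ) (hgap : Gap r (insert v σ) A B) (hrk : r B = r A + 2)
    (hcard : σ.card + 3 = r Finset.univ) {x : Finset E → ℝ} (hx : ∀ u ∈ σ, x u = 0) :
    (bergmanFan hr).degree (insert v σ) [x] =
      ∑ w ∈ covers r A B, (x w - (Pi.single v (x v) : Finset E → ℝ) A) -
        ((Pi.single v (x v) : Finset E → ℝ) B - (Pi.single v (x v) : Finset E → ℝ) A) := by
  have hv' := (mem_link_iff hr).1 hv
  have hcard' : (insert v σ).card + 2 = r Finset.univ := by
    rw [BalancedFan.card_insert_link hv]; omega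
  have hvf := hv'.2.1 v (Finset.mem_insert_self _ _)
  obtain ⟨ℓ, hℓ, h1, -⟩ := hv'.2.exists_lift hr (x := Pi.single v (x v))
    (Pi.single_eq_of_ne hvf.2.1.ne _) (Pi.single_eq_of_ne hvf.2.2.ne' _)
  rw [BalancedFan.degree_cons (Φ := bergmanFan hr) hv'.2 (by
    rw [dim_eq, List.length_nil]; omega) x hℓ, hgap.link_eq hr hv'.2 hrk hcard']
  · simp only [BalancedFan.degree, mul_one]
    rw [← h1 A hgap.left, ← h1 B hgap.right, ← sum_covers_linear hr (hv'.2.isFlat hr hgap.left)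
      (hv'.2.isFlat hr hgap.right) hgap.lt.1 hℓ, ← Finset.sum_sub_distrib]
    exact Finset.sum_congr rfl fun w _ => by ring
  · intro u hu
    rw [h1 u (mem_extended_of_mem hu)]
    rcases Finset.mem_insert.1 hu with rfl | huσ
    · rw [Pi.single_eq_same]
    · rw [Pi.single_eq_of_ne (by rintro rfl; exact hv'.1 huσ), hx u huσ]

include hr in
/-- Any two points of an interval span a unique line. -/
theorem sum_lines {G H p : Finset E} (hH : IsFlat r H)
    (hp : p ∈ covers r G H) (x : Finset E → ℝ) :
    ∑ l ∈ covers r p H, (∑ q ∈ covers r G l, x q - x p) = ∑ q ∈ covers r G H, x q - x p := by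
  obtain ⟨hpf, hGp, hpH, hrp⟩ := mem_covers.1 hp
  have hmaps : ∀ q ∈ (covers r G H).erase p, cl r (p ∪ q) ∈ covers r p H := by
    intro q hq
    obtain ⟨hqp, hq⟩ := Finset.mem_erase.1 hq
    obtain ⟨hqf, hGq, hqH, hrq⟩ := mem_covers.1 hq
    refine mem_covers.2 ⟨hr.isFlat_cl _, Finset.subset_union_left.trans (subset_cl _),
      hr.cl_subset hH (Finset.union_subset hpH hqH), ?_⟩
    have h1 := hr.submod p q
    have h2 := hr.mono G (p ∩ q) (Finset.subset_inter hGp hGq)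
    have h3 : p ⊂ p ∪ q := ⟨Finset.subset_union_left, fun h => hqp
      (hr.eq_of_subset_of_rank_le hqf (Finset.subset_union_right.trans h) (by omega))⟩
    have h4 := hr.rank_lt hpf h3
    rw [hr.rank_cl]
    omega
  rw [← Finset.sum_erase_eq_sub hp, ← Finset.sum_fiberwise_of_maps_to hmaps]
  refine Finset.sum_congr rfl fun l hl => ?_
  obtain ⟨hlf, hpl, hlH, hrl⟩ := mem_covers.1 hl
  rw [← Finset.sum_erase_eq_sub (mem_covers.2 ⟨hpf, hGp, hpl, hrp⟩)]
  refine Finset.sum_congr ?_ fun _ _ => rfl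
  ext q
  simp only [Finset.mem_erase, Finset.mem_filter, mem_covers]
  constructor
  · rintro ⟨h1, h2, h3, h4, h5⟩
    have hq : q ∈ (covers r G H).erase p :=
      Finset.mem_erase.2 ⟨h1, mem_covers.2 ⟨h2, h3, h4.trans hlH, h5⟩⟩
    refine ⟨⟨h1, h2, h3, h4.trans hlH, h5⟩, ?_⟩
    refine hr.eq_of_subset_of_rank_le (hr.isFlat_cl _)
      (hr.cl_subset hlf (Finset.union_subset hpl h4)) ?_
    rw [hrl, (mem_covers.1 (hmaps q hq)).2.2.2]
  · rintro ⟨⟨h1, h2, h3, h4, h5⟩, rfl⟩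
    exact ⟨h1, h2, h3, Finset.subset_union_right.trans (subset_cl _), h5⟩

theorem Gap.signature {σ : Finset (Finset E)} (hσ : Face r σ) {G H : Finset E}
    (hgap : Gap r σ G H) (hrk : r H = r G + 3) (hcard : σ.card + 3 = r Finset.univ)
    {x : Finset E → ℝ} (hx : ∀ u ∈ σ, x u = 0) (hφ : ∑ p ∈ covers r G H, x p = 0) :
    (bergmanFan hr).degree σ [x, x] ≤ 0 := by
  have hG := hσ.isFlat hr hgap.left
  have hH := hσ.isFlat hr hgap.right
  rw [BalancedFan.degree_cons_of_eq_zero (Φ := bergmanFan hr) hσ (by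
    rw [dim_eq, List.length_singleton]; omega) hx]
  set Q := (bergmanFan hr).link σ \ covers r G H with hQ
  have hlink : ∀ F, F ∈ (bergmanFan hr).link σ ↔ IsFlat r F ∧ G ⊂ F ∧ F ⊂ H := by
    intro F
    constructor
    · intro h
      have h' := (mem_link_iff hr).1 h
      exact ⟨(h'.2.1 F (Finset.mem_insert_self _ _)).1,
        hgap.between hr hσ (by omega) h'.1 h'.2⟩
    · rintro ⟨h1, h2, h3⟩
      exact hgap.mem_link hr hσ h1 h2 h3
  have hPsub : covers r G H ⊆ (bergmanFan hr).link σ := by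
    intro F hF
    obtain ⟨h1, h2, h3, h4⟩ := mem_covers.1 hF
    exact (hlink F).2 ⟨h1, h2.ssubset_of_ne (by rintro rfl; omega),
      h3.ssubset_of_ne (by rintro rfl; omega)⟩
  have hQmem : ∀ F, F ∈ Q ↔ IsFlat r F ∧ G ⊆ F ∧ F ⊆ H ∧ r F = r G + 2 := by
    intro F
    rw [hQ, Finset.mem_sdiff, hlink, mem_covers]
    constructor
    · rintro ⟨⟨h1, h2, h3⟩, h4⟩
      have := hr.rank_lt hG h2
      have := hr.rank_lt h1 h3
      refine ⟨h1, h2.1, h3.1, ?_⟩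
      by_contra h
      exact h4 ⟨h1, h2.1, h3.1, by omega⟩
    · rintro ⟨h1, h2, h3, h4⟩
      exact ⟨⟨h1, h2.ssubset_of_ne (by rintro rfl; omega),
        h3.ssubset_of_ne (by rintro rfl; omega)⟩, fun h => by omega⟩
  have hp : ∀ p ∈ covers r G H, x p * (bergmanFan hr).degree (insert p σ) [x] =
      x p * ∑ l ∈ covers r p H, (x l - x p) + x p ^ 2 := by
    intro p hp
    obtain ⟨-, h2, h3⟩ := (hlink p).1 (hPsub hp)
    rw [(hgap.insert_above h2 h3).degree_singleton hr (hPsub hp)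
      (by rw [(mem_covers.1 hp).2.2.2]; omega) hcard hx, Pi.single_eq_same,
      Pi.single_eq_of_ne h3.ne']
    ring
  have hl : ∀ l ∈ Q, x l * (bergmanFan hr).degree (insert l σ) [x] =
      x l * ∑ p ∈ covers r G l, x p - x l ^ 2 := by
    intro l hl
    have hll := (Finset.mem_sdiff.1 hl).1
    obtain ⟨-, h2, h3⟩ := (hlink l).1 hll
    rw [(hgap.insert_below h2 h3).degree_singleton hr hll
      ((hQmem l).1 hl).2.2.2 hcard hx, Pi.single_eq_same,
      Pi.single_eq_of_ne h2.ne]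
    simp only [sub_zero]
    ring
  have hcomm : ∀ f : Finset E → Finset E → ℝ, ∑ p ∈ covers r G H, ∑ l ∈ covers r p H, f p l =
      ∑ l ∈ Q, ∑ p ∈ covers r G l, f p l := by
    intro f
    apply Finset.sum_comm'
    intro p l
    rw [mem_covers, mem_covers, mem_covers, hQmem]
    constructor
    · rintro ⟨⟨h1, h2, h3, h4⟩, h5, h6, h7, h8⟩
      exact ⟨⟨h1, h2, h6, h4⟩, h5, h2.trans h6, h7, by omega⟩
    · rintro ⟨⟨h1, h2, h3, h4⟩, h5, h6, h7, h8⟩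
      exact ⟨⟨h1, h2, h3.trans h7, h4⟩, h5, h3, h7, by omega⟩
  have hpairs : ∑ p ∈ covers r G H, ∑ l ∈ covers r p H, x p * (∑ q ∈ covers r G l, x q - x p) =
      - ∑ p ∈ covers r G H, x p ^ 2 := by
    rw [← Finset.sum_neg_distrib]
    refine Finset.sum_congr rfl fun p hp => ?_
    rw [← Finset.mul_sum, sum_lines hr hH hp, hφ]
    ring
  have hP : ∑ p ∈ covers r G H, x p * ∑ l ∈ covers r p H, (x l - x p) =
      ∑ l ∈ Q, (x l * ∑ p ∈ covers r G l, x p - ∑ p ∈ covers r G l, x p ^ 2) := by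
    simp_rw [Finset.mul_sum]
    rw [hcomm]
    refine Finset.sum_congr rfl fun l _ => ?_
    rw [← Finset.sum_sub_distrib]
    exact Finset.sum_congr rfl fun p _ => by ring
  have hpairs' : ∑ l ∈ Q, ((∑ p ∈ covers r G l, x p) ^ 2 - ∑ p ∈ covers r G l, x p ^ 2) =
      - ∑ p ∈ covers r G H, x p ^ 2 := by
    rw [← hpairs, hcomm]
    refine Finset.sum_congr rfl fun l _ => ?_
    rw [sq (∑ p ∈ covers r G l, x p), Finset.sum_mul, ← Finset.sum_sub_distrib]
    exact Finset.sum_congr rfl fun p _ => by ring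
  rw [← Finset.sum_sdiff hPsub, ← hQ, Finset.sum_congr rfl hp, Finset.sum_congr rfl hl,
    Finset.sum_add_distrib, hP]
  have hfin : ∑ l ∈ Q, (x l * ∑ p ∈ covers r G l, x p - x l ^ 2) +
      (∑ l ∈ Q, (x l * ∑ p ∈ covers r G l, x p - ∑ p ∈ covers r G l, x p ^ 2) +
        ∑ p ∈ covers r G H, x p ^ 2) = - ∑ l ∈ Q, (x l - ∑ p ∈ covers r G l, x p) ^ 2 := by
    have : ∑ p ∈ covers r G H, x p ^ 2 = - ∑ l ∈ Q, ((∑ p ∈ covers r G l, x p) ^ 2 -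
        ∑ p ∈ covers r G l, x p ^ 2) := by rw [hpairs', neg_neg]
    rw [this, ← Finset.sum_neg_distrib, ← Finset.sum_neg_distrib, ← Finset.sum_add_distrib,
      ← Finset.sum_add_distrib]
    exact Finset.sum_congr rfl fun l _ => by ring
  rw [hfin, neg_nonpos]
  exact Finset.sum_nonneg fun l _ => sq_nonneg _

theorem Gap.signature_of_gap {σ : Finset (Finset E)} (hσ : Face r σ) {G H G' H' : Finset E}
    (hgap : Gap r σ G H) (hrk : r H = r G + 2) (hgap' : Gap r σ G' H') (hrk' : r H' = r G' + 2)
    (hle : H ⊆ G') (hcard : σ.card + 3 = r Finset.univ)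
    {x : Finset E → ℝ} (hx : ∀ u ∈ σ, x u = 0) (hφ : ∑ p ∈ covers r G H, x p = 0) :
    (bergmanFan hr).degree σ [x, x] ≤ 0 := by
  have hmem : ∀ {A B F}, Gap r σ A B → r B = r A + 2 → F ∈ covers r A B →
      F ∈ (bergmanFan hr).link σ := by
    intro A B F hAB hrk hF
    obtain ⟨h1, h2, h3, h4⟩ := mem_covers.1 hF
    exact hAB.mem_link hr hσ h1 (h2.ssubset_of_ne (by rintro rfl; omega))
      (h3.ssubset_of_ne (by rintro rfl; omega))
  have hdeg : ∀ {A B v}, Gap r σ A B → r B = r A + 2 → v ∈ (bergmanFan hr).link σ →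
      (v ⊆ A ∨ B ⊆ v) →
      (bergmanFan hr).degree (insert v σ) [x] = ∑ w ∈ covers r A B, x w := by
    intro A B v hAB hrk hv h
    have hne : ∀ K ∈ extended r σ, K ≠ v := by
      rintro K hK rfl
      obtain ⟨h1, h2⟩ := (mem_link_iff hr).1 hv
      obtain ⟨-, h3, h4⟩ := h2.1 K (Finset.mem_insert_self _ _)
      rcases mem_extended.1 hK with h | h | h
      exacts [h3.ne h.symm, h4.ne h, h1 h]
    rw [(hAB.insert_of_subset h).degree_singleton hr hv hrk hcard hx,
      Pi.single_eq_of_ne (hne A hAB.left), Pi.single_eq_of_ne (hne B hAB.right)]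
    simp
  rw [BalancedFan.degree_cons_of_eq_zero (Φ := bergmanFan hr) hσ (by
    rw [dim_eq, List.length_singleton]; omega) hx]
  have hlink : (bergmanFan hr).link σ = covers r G H ∪ covers r G' H' := by
    refine Finset.Subset.antisymm (fun F hF => ?_) (Finset.union_subset (fun F => hmem hgap hrk)
      fun F => hmem hgap' hrk')
    obtain ⟨h1, h2⟩ := (mem_link_iff hr).1 hF
    obtain ⟨A, B, hAB, h3, h4⟩ := hσ.exists_gap_of_insert hr h1 h2
    have hFf := (h2.1 F (Finset.mem_insert_self _ _)).1
    have hmiss := hσ.card_missing hr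
    have hrH : r H ≤ r G' := hr.mono _ _ hle
    have hsub : Finset.Ioo (r G) (r H) ∪ Finset.Ioo (r G') (r H') =
        (Finset.Ioo 0 (r Finset.univ)).filter fun i => ∀ K ∈ σ, r K ≠ i := by
      refine Finset.eq_of_subset_of_card_le
        (Finset.union_subset (hgap.ioo_subset hr) (hgap'.ioo_subset hr)) ?_
      rw [Finset.card_union_of_disjoint, Nat.card_Ioo, Nat.card_Ioo]
      · omega
      · rw [Finset.disjoint_left]
        intro i hi hi'
        rw [Finset.mem_Ioo] at hi hi'
        omega
    have hFi := hAB.ioo_subset hr (Finset.mem_Ioo.2 ⟨hr.rank_lt (hσ.isFlat hr hAB.left) h3,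
      hr.rank_lt hFf h4⟩)
    rw [← hsub, Finset.mem_union, Finset.mem_Ioo, Finset.mem_Ioo] at hFi
    have hext := extended_subset_insert (r := r) σ F
    have hFe : F ∈ extended r (insert F σ) := mem_extended_of_mem (Finset.mem_insert_self _ _)
    rw [Finset.mem_union, mem_covers, mem_covers]
    rcases hFi with hFi | hFi
    · exact Or.inl ⟨hFf, h2.subset_of_rank_le hr (hext hgap.left) hFe (by omega),
        h2.subset_of_rank_le hr hFe (hext hgap.right) (by omega), by omega⟩
    · exact Or.inr ⟨hFf, h2.subset_of_rank_le hr (hext hgap'.left) hFe (by omega),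
        h2.subset_of_rank_le hr hFe (hext hgap'.right) (by omega), by omega⟩
  have hdisj : Disjoint (covers r G H) (covers r G' H') := by
    rw [Finset.disjoint_left]
    intro F hF hF'
    have := hr.mono _ _ hle
    have := (mem_covers.1 hF).2.2.2
    have := (mem_covers.1 hF').2.2.2
    omega
  rw [hlink, Finset.sum_union hdisj, Finset.sum_congr rfl fun v hv => by
    rw [hdeg hgap' hrk' (hmem hgap hrk hv) (Or.inl ((mem_covers.1 hv).2.2.1.trans hle))],
    ← Finset.sum_mul, hφ, zero_mul, zero_add, Finset.sum_congr rfl fun v hv => by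
    rw [hdeg hgap hrk (hmem hgap' hrk' hv) (Or.inr (hle.trans (mem_covers.1 hv).2.1))], hφ]
  simp

theorem isHyperbolic : (bergmanFan hr).IsHyperbolic where
  connected σ hσ hcard f hf := by
    rw [dim_eq] at hcard
    exact Face.connected hr hσ (by omega) hf
  signature σ hσ hcard := by
    have hσ' : Face r σ := hσ
    rw [dim_eq] at hcard
    have hmiss := hσ'.card_missing hr
    let φ : Finset E → Finset E → (Finset E → ℝ) →ₗ[ℝ] ℝ := fun G H =>
      ∑ p ∈ covers r G H, LinearMap.proj p
    have hφ : ∀ G H x, φ G H x = ∑ p ∈ covers r G H, x p := fun G H x => by simp [φ]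
    obtain ⟨i, hi⟩ := Finset.card_pos.1 (show 0 < ((Finset.Ioo 0 (r Finset.univ)).filter
      fun i => ∀ K ∈ σ, r K ≠ i).card by omega)
    obtain ⟨G, H, hgap, h1, h2⟩ := hσ'.exists_gap_of_missing hr hi
    have hle := Finset.card_le_card (hgap.ioo_subset hr)
    rw [Nat.card_Ioo] at hle
    by_cases h3 : r H = r G + 3
    · exact ⟨φ G H, fun x hx hφx => hgap.signature hr hσ' h3 (by omega) hx (by rwa [← hφ])⟩
    obtain ⟨k, hk, hki⟩ := Finset.exists_mem_notMem_of_card_lt_card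
      (show (Finset.Ioo (r G) (r H)).card < ((Finset.Ioo 0 (r Finset.univ)).filter
        fun i => ∀ K ∈ σ, r K ≠ i).card by rw [Nat.card_Ioo]; omega)
    obtain ⟨G', H', hgap', h1', h2'⟩ := hσ'.exists_gap_of_missing hr hk
    rw [Finset.mem_Ioo] at hki
    have hGG : r G < r H := by omega
    have hdisj : r H' ≤ r G ∨ r H ≤ r G' := by
      rcases hgap.sep H' hgap'.right with h | h
      · exact Or.inl (hr.mono _ _ h)
      · rcases hgap.sep G' hgap'.left with h' | h'
        · rcases hgap'.sep G hgap.left with h4 | h4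
          · rcases hgap'.sep H hgap.right with h5 | h5
            · exact Or.inr (hr.mono _ _ h5)
            · have := hr.mono _ _ h4
              have := hr.mono _ _ h5
              omega
          · exact Or.inl (hr.mono _ _ h4)
        · exact Or.inr (hr.mono _ _ h')
    have hle' := Finset.card_le_card (hgap'.ioo_subset hr)
    rw [Nat.card_Ioo] at hle'
    have hrk : r H = r G + 2 := by omega
    have hrk' : r H' = r G' + 2 := by
      by_contra hne
      have heq := Finset.eq_of_subset_of_card_le (hgap'.ioo_subset hr) (by
        rw [Nat.card_Ioo]; omega)
      rw [← heq, Finset.mem_Ioo] at hi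
      omega
    rcases hdisj with h | h
    · exact ⟨φ G' H', fun x hx hφx => hgap'.signature_of_gap hr hσ' hrk' hgap hrk
        (hσ'.subset_of_rank_le hr hgap'.right hgap.left h) (by omega) hx (by rwa [← hφ])⟩
    · exact ⟨φ G H, fun x hx hφx => hgap.signature_of_gap hr hσ' hrk hgap' hrk'
        (hσ'.subset_of_rank_le hr hgap.right hgap'.left h) (by omega) hx (by rwa [← hφ])⟩

end BergmanFan

namespace IsRankFunction

open Polynomial

variable {E : Type*} [DecidableEq E] {r : Finset E → ℕ}

/-- The contribution of `B` to the spanning subset polynomial of the interval from `G` to `H`. -/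
noncomputable def spanningTerm (r : Finset E → ℕ) (G H B : Finset E) : ℝ[X] :=
  if r (G ∪ B) = r H then (X - 1) ^ (B.card - (r H - r G)) else 0

/-- The generating function of the spanning sets of the minor from `G` to `H`, with elements
of `G` considered as loops. -/
noncomputable def spanningPoly (r : Finset E → ℕ) (G H : Finset E) : ℝ[X] :=
  ∑ B ∈ H.powerset, spanningTerm r G H B

/-- The part of the spanning subset polynomial consisting of sets that contain `e`. -/
noncomputable def spanningPolyAt (r : Finset E → ℕ) (G H : Finset E) (e : E) : ℝ[X] :=
  ∑ B ∈ (H.erase e).powerset, spanningTerm r G H (insert e B)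

theorem sum_powerset_split {R : Type*} [AddCommMonoid R] {H : Finset E} {e : E} (he : e ∈ H)
    (f : Finset E → R) : ∑ B ∈ H.powerset, f B =
      ∑ B ∈ (H.erase e).powerset, (f B + f (insert e B)) := by
  conv_lhs => rw [← Finset.insert_erase he]
  rw [Finset.sum_powerset_insert (Finset.notMem_erase e H), Finset.sum_add_distrib]

theorem notMem_of_mem_powerset_erase {H B : Finset E} {e : E}
    (hB : B ∈ (H.erase e).powerset) : e ∉ B := fun h =>
  Finset.notMem_erase e H (Finset.mem_powerset.1 hB h)

variable (hr : IsRankFunction r)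
include hr

theorem rank_union_le (G B : Finset E) : r (G ∪ B) ≤ r G + B.card := by
  induction B using Finset.induction_on with
  | empty => simp
  | insert e B he ih =>
    rw [Finset.card_insert_of_notMem he, Finset.union_insert]
    have := hr.insert_le e (G ∪ B)
    omega

theorem X_mul_spanningPolyAt_of_mem {G H : Finset E} (hGH : G ⊆ H) {e : E} (he : e ∈ G) :
    X * spanningPolyAt r G H e = (X - 1) * spanningPoly r G H := by
  rw [spanningPoly, spanningPolyAt, sum_powerset_split (hGH he), Finset.mul_sum, Finset.mul_sum]
  refine Finset.sum_congr rfl fun B hB => ?_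
  have heB := notMem_of_mem_powerset_erase hB
  have h1 : G ∪ insert e B = G ∪ B := by
    rw [Finset.union_insert, Finset.insert_eq_of_mem (Finset.mem_union_left _ he)]
  unfold spanningTerm
  rw [h1]
  split_ifs with h
  · have := hr.rank_union_le G B
    rw [Finset.card_insert_of_notMem heB, show B.card + 1 - (r H - r G) =
      B.card - (r H - r G) + 1 by omega, pow_succ]
    ring
  · simp

theorem spanningPoly_cl_insert [Fintype E] {G H : Finset E} (hG : IsFlat r G)
    (hGH : G ⊆ H) {e : E} (heH : e ∈ H) (heG : e ∉ G) :
    spanningPoly r (cl r (insert e G)) H = X * spanningPolyAt r G H e := by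
  rw [spanningPoly, spanningPolyAt, sum_powerset_split heH, Finset.mul_sum]
  refine Finset.sum_congr rfl fun B hB => ?_
  have heB := notMem_of_mem_powerset_erase hB
  have hunion : ∀ C, r (cl r (insert e G) ∪ C) = r (G ∪ insert e C) := by
    intro C
    apply le_antisymm
    · rw [← hr.rank_cl (G ∪ insert e C)]
      refine hr.mono _ _ (Finset.union_subset (hr.cl_mono ?_) ?_)
      · rw [Finset.union_insert]
        exact Finset.insert_subset_insert _ Finset.subset_union_left
      · exact ((Finset.subset_insert e C).trans Finset.subset_union_right).trans (subset_cl _)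
    · refine hr.mono _ _ (Finset.union_subset ?_ (Finset.insert_subset ?_ ?_))
      · exact ((Finset.subset_insert e G).trans (subset_cl _)).trans Finset.subset_union_left
      · exact Finset.mem_union_left _ (subset_cl _ (Finset.mem_insert_self _ _))
      · exact Finset.subset_union_right
  have hrk := hr.rank_insert hG heG
  have hle := hr.mono _ _ (Finset.insert_subset heH hGH)
  unfold spanningTerm
  rw [hunion, hunion, Finset.insert_idem, hr.rank_cl, hrk]
  split_ifs with h
  · have := hr.rank_union_le G (insert e B)
    rw [Finset.card_insert_of_notMem heB] at this ⊢
    rw [show B.card + 1 - (r H - (r G + 1)) = B.card + 1 - (r H - r G) + 1 by omega,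
      show B.card - (r H - (r G + 1)) = B.card + 1 - (r H - r G) by omega, pow_succ]
    ring
  · simp

theorem sum_spanningPolyAt (G H : Finset E) : ∑ e ∈ H, spanningPolyAt r G H e =
    (X - 1) * derivative (spanningPoly r G H) +
      C ((r H : ℝ) - r G) * spanningPoly r G H := by
  have h1 : ∀ e ∈ H, spanningPolyAt r G H e =
      ∑ B ∈ H.powerset, if e ∈ B then spanningTerm r G H B else 0 := by
    intro e he
    rw [spanningPolyAt, sum_powerset_split he]
    refine Finset.sum_congr rfl fun B hB => ?_
    simp [notMem_of_mem_powerset_erase hB]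
  rw [Finset.sum_congr rfl h1, Finset.sum_comm, spanningPoly, derivative_sum, Finset.mul_sum,
    Finset.mul_sum, ← Finset.sum_add_distrib]
  refine Finset.sum_congr rfl fun B hB => ?_
  rw [← Finset.sum_filter, Finset.filter_mem_eq_inter,
    Finset.inter_eq_right.2 (Finset.mem_powerset.1 hB), Finset.sum_const, nsmul_eq_mul]
  unfold spanningTerm
  split_ifs with h
  · have h2 := hr.rank_union_le G B
    have h3 := hr.mono G (G ∪ B) Finset.subset_union_left
    obtain ⟨k, hk⟩ := Nat.exists_eq_add_of_le (show r H - r G ≤ B.card by omega)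
    have hk' : (B.card : ℝ) = (r H : ℝ) - r G + k := by
      rw [hk, Nat.cast_add, Nat.cast_sub (by omega)]
    rw [show B.card - (r H - r G) = k by omega, ← Polynomial.C_eq_natCast, hk']
    rcases k with - | k
    · simp
    · rw [derivative_pow]
      simp only [map_add, map_sub, Nat.cast_add, Nat.cast_one, derivative_X, derivative_one,
        C_eq_natCast, Nat.add_sub_cancel, map_one]
      ring
  · simp

theorem sum_covers_spanningPoly [Fintype E] {G H : Finset E} (hG : IsFlat r G)
    (hH : IsFlat r H) (hGH : G ⊆ H) {s : Finset (Finset E)}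
    (hs : ∀ F, F ∈ s ↔ IsFlat r F ∧ G ⊆ F ∧ F ⊆ H ∧ r F = r G + 1) :
    ∑ F ∈ s, C ((F.card : ℝ) - G.card) * spanningPoly r F H =
      X * ∑ e ∈ H, spanningPolyAt r G H e - C (G.card : ℝ) * ((X - 1) * spanningPoly r G H) := by
  have h1 : ∀ F ∈ s, C ((F.card : ℝ) - G.card) * spanningPoly r F H =
      ∑ e ∈ F \ G, spanningPoly r F H := by
    intro F hF
    have hGF := ((hs F).1 hF).2.1
    rw [Finset.sum_const, Finset.card_sdiff_of_subset hGF, nsmul_eq_mul,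
      Nat.cast_sub (Finset.card_le_card hGF)]
    simp
  rw [Finset.sum_congr rfl h1, hr.sum_covers hG hH hGH hs fun F _ => spanningPoly r F H,
    ← Finset.sum_sdiff hGH, mul_add, Finset.mul_sum, Finset.mul_sum,
    Finset.sum_congr rfl fun e he => hr.X_mul_spanningPolyAt_of_mem hGH he,
    Finset.sum_const, nsmul_eq_mul, C_eq_natCast, add_sub_cancel_right]
  refine Finset.sum_congr rfl fun e he => ?_
  rw [Finset.mem_sdiff] at he
  exact hr.spanningPoly_cl_insert hG hGH he.1 he.2

theorem sum_cocovers_at [Fintype E] {G H : Finset E} (hH : IsFlat r H) (hGH : G ⊆ H)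
    (hrk : r G < r H) {s : Finset (Finset E)}
    (hs : ∀ F, F ∈ s ↔ IsFlat r F ∧ G ⊆ F ∧ F ⊆ H ∧ r F + 1 = r H) {e : E} (he : e ∈ H) :
    ∑ F ∈ s with e ∉ F, spanningPoly r G F =
      X * spanningPolyAt r G H e - (X - 1) * spanningPoly r G H := by
  set t := H.powerset.filter fun B => r (G ∪ B) + 1 = r H ∧ r (insert e (G ∪ B)) = r H with ht
  have hmaps : ∀ B ∈ t, cl r (G ∪ B) ∈ s.filter fun F => e ∉ F := by
    intro B hB
    rw [ht, Finset.mem_filter, Finset.mem_powerset] at hB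
    rw [Finset.mem_filter, hs, hr.rank_cl, mem_cl]
    exact ⟨⟨hr.isFlat_cl _, Finset.subset_union_left.trans (subset_cl _),
      hr.cl_subset hH (Finset.union_subset hGH hB.1), hB.2.1⟩, by omega⟩
  have h1 : ∑ B ∈ t, (X - 1 : ℝ[X]) ^ (B.card + 1 - (r H - r G)) =
      ∑ F ∈ s with e ∉ F, spanningPoly r G F := by
    rw [← Finset.sum_fiberwise_of_maps_to hmaps]
    refine Finset.sum_congr rfl fun F hF => ?_
    rw [Finset.mem_filter, hs] at hF
    obtain ⟨⟨hF, hGF, hFH, hrF⟩, heF⟩ := hF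
    unfold spanningPoly spanningTerm
    rw [← Finset.sum_filter]
    have : t.filter (fun B => cl r (G ∪ B) = F) =
        F.powerset.filter fun B => r (G ∪ B) = r F := by
      ext B
      rw [ht, Finset.mem_filter, Finset.mem_filter, Finset.mem_filter, Finset.mem_powerset,
        Finset.mem_powerset]
      constructor
      · rintro ⟨-, rfl⟩
        exact ⟨Finset.subset_union_right.trans (subset_cl _), (hr.rank_cl _).symm⟩
      · rintro ⟨h1, h2⟩
        have h3 : cl r (G ∪ B) = F := hr.eq_of_subset_of_rank_le (hr.isFlat_cl _)
          (hr.cl_subset hF (Finset.union_subset hGF h1)) (by rw [hr.rank_cl, h2])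
        have h4 : r (insert e (G ∪ B)) ≠ r (G ∪ B) := fun h => heF (by rw [← h3, mem_cl, h])
        have h5 := hr.insert_le e (G ∪ B)
        have h6 := hr.mono _ _ (Finset.subset_insert e (G ∪ B))
        exact ⟨⟨h1.trans hFH, by omega, by omega⟩, h3⟩
    rw [this]
    refine Finset.sum_congr rfl fun B _ => ?_
    rw [show B.card + 1 - (r H - r G) = B.card - (r F - r G) by omega]
  rw [← h1, ht, Finset.sum_filter, sum_powerset_split he, spanningPoly, spanningPolyAt,
    sum_powerset_split he, Finset.mul_sum, Finset.mul_sum, ← Finset.sum_sub_distrib]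
  refine Finset.sum_congr rfl fun B hB => ?_
  have heB := notMem_of_mem_powerset_erase hB
  have h2 := hr.insert_le e (G ∪ B)
  have h3 := hr.mono _ _ (Finset.subset_insert e (G ∪ B))
  have h4 := hr.mono _ _ (Finset.union_subset hGH (Finset.insert_subset he
    ((Finset.mem_powerset.1 hB).trans (Finset.erase_subset _ _))))
  have h5 := hr.rank_union_le G B
  unfold spanningTerm
  rw [Finset.card_insert_of_notMem heB]
  rw [Finset.union_insert] at h4 ⊢
  rw [Finset.insert_idem]
  by_cases hc : r (insert e (G ∪ B)) = r H
  · by_cases hc' : r (G ∪ B) = r H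
    · rw [if_neg (by omega), if_neg (by omega), if_pos hc, if_pos hc',
        show B.card + 1 - (r H - r G) = B.card - (r H - r G) + 1 by omega, pow_succ]
      ring
    · rw [if_pos ⟨by omega, hc⟩, if_neg (by omega), if_pos hc, if_neg hc']
      ring
  · rw [if_neg (by tauto), if_neg (by tauto), if_neg hc, if_neg (by omega)]
    ring

theorem sum_cocovers_spanningPoly [Fintype E] {G H : Finset E} (hH : IsFlat r H) (hGH : G ⊆ H)
    (hrk : r G < r H) {s : Finset (Finset E)}
    (hs : ∀ F, F ∈ s ↔ IsFlat r F ∧ G ⊆ F ∧ F ⊆ H ∧ r F + 1 = r H) :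
    ∑ F ∈ s, C ((H.card : ℝ) - F.card) * spanningPoly r G F =
      X * ∑ e ∈ H, spanningPolyAt r G H e - C (H.card : ℝ) * ((X - 1) * spanningPoly r G H) := by
  have h1 : ∀ F ∈ s, C ((H.card : ℝ) - F.card) * spanningPoly r G F =
      ∑ e ∈ H, if e ∉ F then spanningPoly r G F else 0 := by
    intro F hF
    have hFH := ((hs F).1 hF).2.2.1
    rw [← Finset.sum_filter, Finset.filter_notMem_eq_sdiff, Finset.sum_const,
      Finset.card_sdiff_of_subset hFH, nsmul_eq_mul, Nat.cast_sub (Finset.card_le_card hFH)]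
    simp
  rw [Finset.sum_congr rfl h1, Finset.sum_comm]
  simp_rw [← Finset.sum_filter]
  rw [Finset.sum_congr rfl fun e he => hr.sum_cocovers_at hH hGH hrk hs he,
    Finset.sum_sub_distrib, Finset.sum_const, ← Finset.mul_sum, nsmul_eq_mul, C_eq_natCast]

end IsRankFunction

namespace IsRankFunction

open Polynomial BergmanFan

variable {E : Type*} [Fintype E] [DecidableEq E] {r : Finset E → ℕ}

open Classical in
/-- The flats covered by `H` and containing `G`. -/
noncomputable def cocovers (r : Finset E → ℕ) (G H : Finset E) : Finset (Finset E) :=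
  Finset.univ.filter fun F => IsFlat r F ∧ G ⊆ F ∧ F ⊆ H ∧ r F + 1 = r H

theorem mem_cocovers {G H F : Finset E} :
    F ∈ cocovers r G H ↔ IsFlat r F ∧ G ⊆ F ∧ F ⊆ H ∧ r F + 1 = r H := by simp [cocovers]

/-- The polynomial interpolating between the sums over covers and over cocovers. -/
noncomputable def mixedPoly (r : Finset E → ℕ) (G H : Finset E) (j : ℝ) : ℝ[X] :=
  X * ((X - 1) * derivative (spanningPoly r G H) + C ((r H : ℝ) - r G) * spanningPoly r G H) -
    C j * ((X - 1) * spanningPoly r G H)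

theorem coeff_X_sub_one_mul_succ (p : ℝ[X]) (m : ℕ) :
    ((X - 1) * p).coeff (m + 1) = p.coeff m - p.coeff (m + 1) := by
  rw [sub_mul, one_mul, coeff_sub, coeff_X_mul]

theorem coeff_X_sub_one_mul_zero (p : ℝ[X]) : ((X - 1) * p).coeff 0 = - p.coeff 0 := by
  simp [sub_mul]

omit [Fintype E] in
theorem coeff_mixedPoly_zero (G H : Finset E) (j : ℝ) :
    (mixedPoly r G H j).coeff 0 = j * (spanningPoly r G H).coeff 0 := by
  rw [mixedPoly, coeff_sub, coeff_X_mul_zero, coeff_C_mul, coeff_X_sub_one_mul_zero]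
  ring

omit [Fintype E] in
theorem coeff_mixedPoly_succ (G H : Finset E) (j : ℝ) (m : ℕ) :
    (mixedPoly r G H j).coeff (m + 1) =
      ((m : ℝ) + r H - r G - j) * (spanningPoly r G H).coeff m +
        (j - (m + 1)) * (spanningPoly r G H).coeff (m + 1) := by
  rw [mixedPoly, coeff_sub, coeff_X_mul, coeff_C_mul, coeff_X_sub_one_mul_succ, coeff_add,
    coeff_C_mul]
  have : ((X - 1) * derivative (spanningPoly r G H)).coeff m =
      m * (spanningPoly r G H).coeff m - (m + 1) * (spanningPoly r G H).coeff (m + 1) := by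
    rcases m with - | m
    · rw [coeff_X_sub_one_mul_zero, coeff_derivative]
      simp
    · rw [coeff_X_sub_one_mul_succ, coeff_derivative, coeff_derivative]
      push_cast
      ring
  rw [this]
  ring

omit [Fintype E] in
theorem spanningPoly_self (G : Finset E) : spanningPoly r G G = X ^ G.card := by
  have h1 : ∀ B ∈ G.powerset, spanningTerm r G G B = (X - 1) ^ B.card := by
    intro B hB
    rw [spanningTerm, Finset.union_eq_left.2 (Finset.mem_powerset.1 hB), if_pos rfl,
      Nat.sub_self, Nat.sub_zero]
  rw [spanningPoly, Finset.sum_congr rfl h1]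
  have := Finset.sum_pow_mul_eq_add_pow (X - 1 : ℝ[X]) 1 G
  simpa using this

variable (hr : IsRankFunction r)
include hr

omit [Fintype E] in
theorem coeff_spanningPoly_of_lt {G H : Finset E} {m : ℕ} (hm : H.card < m + (r H - r G)) :
    (spanningPoly r G H).coeff m = 0 := by
  rw [spanningPoly, finsetSum_coeff]
  refine Finset.sum_eq_zero fun B hB => ?_
  have hcard := Finset.card_le_card (Finset.mem_powerset.1 hB)
  unfold spanningTerm
  split_ifs with h
  · have hle := hr.rank_union_le G B
    rw [h] at hle
    refine coeff_eq_zero_of_natDegree_lt ?_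
    rw [← C_1, natDegree_pow, natDegree_X_sub_C]
    omega
  · simp

theorem sum_covers_eq_mixedPoly {G H : Finset E} (hG : IsFlat r G) (hH : IsFlat r H)
    (hGH : G ⊆ H) : ∑ F ∈ covers r G H, C ((F.card : ℝ) - G.card) * spanningPoly r F H =
      mixedPoly r G H G.card := by
  rw [hr.sum_covers_spanningPoly hG hH hGH fun F => mem_covers, hr.sum_spanningPolyAt, mixedPoly]

theorem sum_cocovers_eq_mixedPoly {G H : Finset E} (hH : IsFlat r H)
    (hGH : G ⊆ H) (hrk : r G < r H) :
    ∑ F ∈ cocovers r G H, C ((H.card : ℝ) - F.card) * spanningPoly r G F =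
      mixedPoly r G H H.card := by
  rw [hr.sum_cocovers_spanningPoly hH hGH hrk fun F => mem_cocovers, hr.sum_spanningPolyAt,
    mixedPoly]

theorem coeff_mixedPoly {G H : Finset E} (hG : IsFlat r G) (hH : IsFlat r H)
    (hGH : G ⊆ H) (hrk : r G < r H) (j : ℝ) (m : ℕ) :
    ((H.card : ℝ) - G.card) * (mixedPoly r G H j).coeff m =
      (H.card - j) * ∑ F ∈ covers r G H,
        ((F.card : ℝ) - G.card) * (spanningPoly r F H).coeff m +
      (j - G.card) * ∑ F ∈ cocovers r G H,
        ((H.card : ℝ) - F.card) * (spanningPoly r G F).coeff m := by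
  have h1 := congrArg (fun p => coeff p m) (hr.sum_covers_eq_mixedPoly hG hH hGH)
  have h2 := congrArg (fun p => coeff p m) (hr.sum_cocovers_eq_mixedPoly hH hGH hrk)
  simp only [finsetSum_coeff, coeff_C_mul] at h1 h2
  rw [h1, h2]
  simp only [mixedPoly, coeff_sub, coeff_C_mul]
  ring

theorem coeff_spanningPoly_of_lt_card {G H : Finset E} (hG : IsFlat r G) (hH : IsFlat r H)
    (hGH : G ⊆ H) {m : ℕ} (hm : m < G.card) : (spanningPoly r G H).coeff m = 0 := by
  induction hn : r H - r G using Nat.strong_induction_on generalizing G H m with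
  | _ n ih =>
  rcases hGH.eq_or_ssubset with rfl | hlt
  · rw [spanningPoly_self, coeff_X_pow, if_neg hm.ne]
  have hrk := hr.rank_lt hG hlt
  have hpos : (0 : ℝ) < (H.card : ℝ) - G.card :=
    sub_pos.2 (Nat.cast_lt.2 (Finset.card_lt_card hlt))
  have h0 : ∀ k < G.card, ((X - 1) * spanningPoly r G H).coeff k = 0 := by
    intro k hk
    have h1 := congrArg (fun p => coeff p k) (hr.sum_covers_eq_mixedPoly hG hH hGH)
    have h2 := congrArg (fun p => coeff p k) (hr.sum_cocovers_eq_mixedPoly hH hGH hrk)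
    simp only [finsetSum_coeff, coeff_C_mul] at h1 h2
    rw [Finset.sum_eq_zero] at h1 h2
    · simp only [mixedPoly, coeff_sub, coeff_C_mul] at h1 h2
      have : ((H.card : ℝ) - G.card) * ((X - 1) * spanningPoly r G H).coeff k = 0 := by
        linarith
      exact (mul_eq_zero.1 this).resolve_left hpos.ne'
    · intro F hF
      obtain ⟨h3, h4, h5, h6⟩ := mem_cocovers.1 hF
      rw [ih (r F - r G) (by omega) hG h3 h4 hk rfl, mul_zero]
    · intro F hF
      obtain ⟨h3, h4, h5, h6⟩ := mem_covers.1 hF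
      rw [ih (r H - r F) (by omega) h3 hH h5 (hk.trans_le (Finset.card_le_card h4)) rfl, mul_zero]
  induction m with
  | zero => simpa [coeff_X_sub_one_mul_zero] using h0 0 hm
  | succ m ihm =>
    have := h0 (m + 1) hm
    rw [coeff_X_sub_one_mul_succ, ihm (by omega)] at this
    linarith

theorem coeff_spanningPoly_of_rank_one {G H : Finset E} (hG : IsFlat r G) (hH : IsFlat r H)
    (hGH : G ⊆ H) (hrk : r H = r G + 1) (m : ℕ) :
    (spanningPoly r G H).coeff m = if G.card ≤ m ∧ m < H.card then 1 else 0 := by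
  have hlt : G ⊂ H := hGH.ssubset_of_ne (by rintro rfl; omega)
  have hcard := Finset.card_lt_card hlt
  have hpos : (0 : ℝ) < (H.card : ℝ) - G.card := sub_pos.2 (Nat.cast_lt.2 hcard)
  have hcov : covers r G H = {H} := by
    ext F
    rw [mem_covers, Finset.mem_singleton]
    constructor
    · rintro ⟨h1, -, h3, h4⟩
      exact hr.eq_of_subset_of_rank_le h1 h3 (by omega)
    · rintro rfl
      exact ⟨hH, hGH, Finset.Subset.refl _, hrk⟩
  have hcocov : cocovers r G H = {G} := by
    ext F
    rw [mem_cocovers, Finset.mem_singleton]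
    constructor
    · rintro ⟨-, h2, h3, h4⟩
      exact (hr.eq_of_subset_of_rank_le hG h2 (by omega)).symm
    · rintro rfl
      exact ⟨hG, Finset.Subset.refl _, hGH, hrk.symm⟩
  have h0 : ∀ k, ((X - 1) * spanningPoly r G H).coeff k =
      (if k = H.card then 1 else 0) - if k = G.card then 1 else 0 := by
    intro k
    have h1 := congrArg (fun p => coeff p k) (hr.sum_covers_eq_mixedPoly hG hH hGH)
    have h2 := congrArg (fun p => coeff p k)
      (hr.sum_cocovers_eq_mixedPoly hH hGH (by omega))
    simp only [hcov, hcocov, Finset.sum_singleton, coeff_C_mul, spanningPoly_self, coeff_X_pow,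
      mixedPoly, coeff_sub] at h1 h2
    apply mul_left_cancel₀ hpos.ne'
    linarith
  induction m with
  | zero =>
    have := h0 0
    rw [coeff_X_sub_one_mul_zero, if_neg (by omega)] at this
    rw [← neg_inj, this]
    split_ifs <;> first | omega | simp
  | succ m ih =>
    have := h0 (m + 1)
    rw [coeff_X_sub_one_mul_succ, ih] at this
    split_ifs at this ⊢ <;> first | omega | linarith

omit [Fintype E] in
theorem rank_sub_le_card_sub {G H : Finset E} (hGH : G ⊆ H) :
    r H + G.card ≤ r G + H.card := by
  have h1 := hr.rank_union_le G (H \ G)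
  rw [Finset.union_sdiff_of_subset hGH, Finset.card_sdiff_of_subset hGH] at h1
  have := Finset.card_le_card hGH
  omega

theorem coeff_spanningPoly_mul {G H : Finset E} (hG : IsFlat r G) (hH : IsFlat r H)
    (hGH : G ⊆ H) (hrk : r G < r H) (m : ℕ) :
    ((H.card : ℝ) - G.card) * (((r H : ℝ) - r G - 1) * (spanningPoly r G H).coeff m) =
      (H.card - ((m : ℝ) + 1)) * ∑ F ∈ covers r G H,
        ((F.card : ℝ) - G.card) * (spanningPoly r F H).coeff (m + 1) +
      (((m : ℝ) + 1) - G.card) * ∑ F ∈ cocovers r G H,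
        ((H.card : ℝ) - F.card) * (spanningPoly r G F).coeff (m + 1) := by
  rw [← hr.coeff_mixedPoly hG hH hGH hrk, coeff_mixedPoly_succ]
  ring

theorem coeff_spanningPoly_nonneg {G H : Finset E} (hG : IsFlat r G) (hH : IsFlat r H)
    (hGH : G ⊆ H) (m : ℕ) : 0 ≤ (spanningPoly r G H).coeff m ∧
      (r G < r H → G.card ≤ m → m + (r H - r G) ≤ H.card → 0 < (spanningPoly r G H).coeff m) := by
  induction hn : r H - r G using Nat.strong_induction_on generalizing G H m with
  | _ n ih =>
  rcases hGH.eq_or_ssubset with rfl | hlt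
  · rw [spanningPoly_self, coeff_X_pow]
    refine ⟨by split_ifs <;> simp, fun h => absurd h (lt_irrefl _)⟩
  have hrk := hr.rank_lt hG hlt
  have hpos : (0 : ℝ) < (H.card : ℝ) - G.card :=
    sub_pos.2 (Nat.cast_lt.2 (Finset.card_lt_card hlt))
  by_cases h1 : r H = r G + 1
  · rw [hr.coeff_spanningPoly_of_rank_one hG hH hGH h1]
    refine ⟨by split_ifs <;> simp, fun _ h2 h3 => ?_⟩
    rw [if_pos ⟨h2, by omega⟩]
    exact one_pos
  by_cases hm : m < G.card
  · rw [hr.coeff_spanningPoly_of_lt_card hG hH hGH hm]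
    exact ⟨le_rfl, fun _ h => absurd hm h.not_gt⟩
  by_cases hm' : H.card < m + (r H - r G)
  · rw [hr.coeff_spanningPoly_of_lt hm']
    exact ⟨le_rfl, fun _ _ h => absurd (hn ▸ h) hm'.not_ge⟩
  have h2 : (0 : ℝ) < H.card - ((m : ℝ) + 1) := by
    rw [sub_pos]
    exact_mod_cast (show m + 1 < H.card by omega)
  have h3 : (0 : ℝ) < ((m : ℝ) + 1) - G.card := by
    rw [sub_pos]
    exact_mod_cast (show G.card < m + 1 by omega)
  have h4 : (0 : ℝ) < (r H : ℝ) - r G - 1 := by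
    have : (r G : ℝ) + 1 < r H := by exact_mod_cast (show r G + 1 < r H by omega)
    linarith
  suffices h : 0 < (spanningPoly r G H).coeff m from ⟨h.le, fun _ _ _ => h⟩
  have hcov : ∀ F ∈ covers r G H, 0 ≤ ((F.card : ℝ) - G.card) *
      (spanningPoly r F H).coeff (m + 1) := by
    intro F hF
    obtain ⟨h5, h6, h7, h8⟩ := mem_covers.1 hF
    exact mul_nonneg (sub_nonneg.2 (Nat.cast_le.2 (Finset.card_le_card h6)))
      (ih (r H - r F) (by omega) h5 hH h7 _ rfl).1
  have hcocov : ∀ F ∈ cocovers r G H, 0 ≤ ((H.card : ℝ) - F.card) *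
      (spanningPoly r G F).coeff (m + 1) := by
    intro F hF
    obtain ⟨h5, h6, h7, h8⟩ := mem_cocovers.1 hF
    exact mul_nonneg (sub_nonneg.2 (Nat.cast_le.2 (Finset.card_le_card h7)))
      (ih (r F - r G) (by omega) hG h5 h6 _ rfl).1
  have hmul := hr.coeff_spanningPoly_mul hG hH hGH hrk m
  suffices h : 0 < ∑ F ∈ covers r G H, ((F.card : ℝ) - G.card) *
      (spanningPoly r F H).coeff (m + 1) ∨ 0 < ∑ F ∈ cocovers r G H, ((H.card : ℝ) - F.card) *
      (spanningPoly r G F).coeff (m + 1) by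
    have h5 := Finset.sum_nonneg hcov
    have h6 := Finset.sum_nonneg hcocov
    refine pos_of_mul_pos_right (a := ((H.card : ℝ) - G.card) * ((r H : ℝ) - r G - 1)) ?_
      (mul_pos hpos h4).le
    rw [mul_assoc, hmul]
    rcases h with h | h
    · exact add_pos_of_pos_of_nonneg (mul_pos h2 h) (mul_nonneg h3.le h6)
    · exact add_pos_of_nonneg_of_pos (mul_nonneg h2.le h5) (mul_pos h3 h)
  obtain ⟨F, hF, hGF, hFH, hrF⟩ := hr.exists_flat_between hG hH hGH
    (show r G ≤ r G + 1 by omega) (by omega)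
  obtain ⟨F', hF', hFF', hFH', hrF'⟩ := hr.exists_flat_between hF hH hFH
    (show r F ≤ r H - 1 by omega) (by omega)
  have hFcard : G.card < F.card :=
    Finset.card_lt_card (hGF.ssubset_of_ne (by rintro rfl; omega))
  have hFcard' : F'.card < H.card :=
    Finset.card_lt_card (hFH'.ssubset_of_ne (by rintro rfl; omega))
  by_cases hFm : F.card ≤ m + 1
  · left
    refine Finset.sum_pos' hcov ⟨F, mem_covers.2 ⟨hF, hGF, hFH, hrF⟩, ?_⟩
    refine mul_pos (sub_pos.2 (Nat.cast_lt.2 hFcard)) ?_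
    exact (ih (r H - r F) (by omega) hF hH hFH _ rfl).2 (by omega) hFm (by omega)
  · right
    refine Finset.sum_pos' hcocov ⟨F', mem_cocovers.2 ⟨hF', hGF.trans hFF', hFH', by omega⟩, ?_⟩
    refine mul_pos (sub_pos.2 (Nat.cast_lt.2 hFcard')) ?_
    have := hr.rank_sub_le_card_sub hFF'
    exact (ih (r F' - r G) (by omega) hG hF' (hGF.trans hFF') _ rfl).2 (by omega) (by omega)
      (by omega)

end IsRankFunction

namespace BergmanFan

open IsRankFunction

/-- The difference between `g` at `q` and the linear interpolation of `g` between `p` and `s`. -/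
noncomputable def slack (g : ℕ → ℝ) (p q s : ℕ) : ℝ :=
  g q - (g p * ((s : ℝ) - q) + g s * ((q : ℝ) - p)) / ((s : ℝ) - p)

theorem slack_mul (g : ℕ → ℝ) {p q s : ℕ} (hps : p < s) :
    slack g p q s * ((s : ℝ) - p) =
      g q * ((s : ℝ) - p) - (g p * ((s : ℝ) - q) + g s * ((q : ℝ) - p)) := by
  have : (s : ℝ) - p ≠ 0 := (sub_pos.2 (Nat.cast_lt.2 hps)).ne'
  rw [slack, sub_mul, div_mul_cancel₀ _ this]

/-- The function `t ↦ min t j`. -/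
def truncation (j : ℕ) : ℕ → ℝ := fun t => ((min t j : ℕ) : ℝ)

theorem slack_truncation_of_le {j p q s : ℕ} (hpq : p ≤ q) (hps : p < s)
    (hj : j ≤ p ∨ s ≤ j) (hqs : q ≤ s) : slack (truncation j) p q s = 0 := by
  have h : (s : ℝ) - p ≠ 0 := (sub_pos.2 (Nat.cast_lt.2 hps)).ne'
  apply mul_right_cancel₀ h
  rw [slack_mul _ hps]
  unfold truncation
  rcases hj with hj | hj
  · rw [min_eq_right hj, min_eq_right (hj.trans hpq), min_eq_right (hj.trans hps.le)]
    ring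
  · rw [min_eq_left hj, min_eq_left (hqs.trans hj), min_eq_left (hps.le.trans hj)]
    ring

theorem slack_truncation_of_ge {j p q s : ℕ} (hps : p < s) (hpj : p ≤ j) (hjs : j ≤ s)
    (hjq : j ≤ q) :
    slack (truncation j) p q s * ((s : ℝ) - p) = ((j : ℝ) - p) * ((s : ℝ) - q) := by
  rw [slack_mul _ hps]
  unfold truncation
  rw [min_eq_left hpj, min_eq_right hjs, min_eq_right hjq]
  ring

theorem slack_truncation_of_le_right {j p q s : ℕ} (hps : p < s) (hpj : p ≤ j) (hjs : j ≤ s)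
    (hqj : q ≤ j) :
    slack (truncation j) p q s * ((s : ℝ) - p) = ((s : ℝ) - j) * ((q : ℝ) - p) := by
  rw [slack_mul _ hps]
  unfold truncation
  rw [min_eq_left hpj, min_eq_right hjs, min_eq_left hqj]
  ring

theorem slack_truncation_nonneg {j p q s : ℕ} (hpq : p ≤ q) (hqs : q ≤ s) (hps : p < s) :
    0 ≤ slack (truncation j) p q s := by
  have h : (0 : ℝ) < (s : ℝ) - p := sub_pos.2 (Nat.cast_lt.2 hps)
  by_cases hj : j ≤ p ∨ s ≤ j
  · exact (slack_truncation_of_le hpq hps hj hqs).ge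
  · push Not at hj
    refine le_of_mul_le_mul_right ?_ h
    rw [zero_mul]
    have h1 : (p : ℝ) ≤ j := Nat.cast_le.2 hj.1.le
    have h2 : (j : ℝ) ≤ s := Nat.cast_le.2 hj.2.le
    have h3 : (p : ℝ) ≤ q := Nat.cast_le.2 hpq
    have h4 : (q : ℝ) ≤ s := Nat.cast_le.2 hqs
    rcases le_total j q with hjq | hqj
    · rw [slack_truncation_of_ge hps hj.1.le hj.2.le hjq]
      exact mul_nonneg (sub_nonneg.2 h1) (sub_nonneg.2 h4)
    · rw [slack_truncation_of_le_right hps hj.1.le hj.2.le hqj]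
      exact mul_nonneg (sub_nonneg.2 h2) (sub_nonneg.2 h3)

theorem slack_neg_sq_pos {p q s : ℕ} (hpq : p < q) (hqs : q < s) :
    0 < slack (fun t => -(t : ℝ) ^ 2) p q s := by
  have h1 : (0 : ℝ) < (q : ℝ) - p := sub_pos.2 (Nat.cast_lt.2 hpq)
  have h2 : (0 : ℝ) < (s : ℝ) - q := sub_pos.2 (Nat.cast_lt.2 hqs)
  refine pos_of_mul_pos_left (b := (s : ℝ) - p) ?_ (by linarith)
  rw [slack_mul _ (hpq.trans hqs)]
  have : 0 < ((q : ℝ) - p) * ((s : ℝ) - q) * ((s : ℝ) - p) :=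
    mul_pos (mul_pos h1 h2) (by linarith)
  linarith [this]

variable {E : Type*} [Fintype E] [DecidableEq E] {r : Finset E → ℕ}

/-- The piecewise linear function given by a function of the cardinality of a flat, normalized
to vanish on the smallest and on the largest flat. -/
noncomputable def cardFunction (r : Finset E → ℕ) (g : ℕ → ℝ) : Finset E → ℝ := fun F =>
  slack g (cl r ∅).card F.card (Finset.univ : Finset E).card

variable (hr : IsRankFunction r)
include hr

theorem Face.exists_lift_card {σ : Finset (Finset E)} (hσ : Face r σ) (hpos : 0 < r Finset.univ)
    (g : ℕ → ℝ) : ∃ ℓ ∈ linearFunctions r, (∀ K ∈ σ, ℓ K = cardFunction r g K) ∧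
      ∀ G H F, Gap r σ G H → G ⊆ F → F ⊆ H →
        cardFunction r g F - ℓ F = slack g G.card F.card H.card := by
  have hn : (0 : ℝ) < (Finset.univ : Finset E).card - (cl r ∅).card := by
    rw [sub_pos, Nat.cast_lt]
    refine Finset.card_lt_card ((Finset.subset_univ _).ssubset_of_ne fun h => ?_)
    rw [← h, hr.rank_cl, hr.empty] at hpos
    exact lt_irrefl _ hpos
  have hslack : ∀ F, cardFunction r g F = slack g (cl r ∅).card F.card
      (Finset.univ : Finset E).card := fun _ => rfl
  obtain ⟨ℓ, hℓ, h1, h2⟩ := hσ.exists_lift hr (x := cardFunction r g)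
    (by rw [hslack, slack]; field_simp; ring) (by rw [hslack, slack]; field_simp; ring)
  refine ⟨ℓ, hℓ, fun K hK => h1 K (mem_extended_of_mem hK), fun G H F hgap hGF hFH => ?_⟩
  have h := Finset.card_lt_card hgap.lt
  have hGH : (0 : ℝ) < (H.card : ℝ) - G.card := sub_pos.2 (Nat.cast_lt.2 h)
  apply mul_right_cancel₀ hGH.ne'
  rw [sub_mul, h2 G H F hgap hGF hFH, slack_mul _ h, hslack, hslack, hslack]
  unfold slack
  field_simp
  ring

theorem degree_cons_card {σ : Finset (Finset E)} (hσ : Face r σ) (g : ℕ → ℝ)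
    {xs : List (Finset E → ℝ)} (hd : σ.card + xs.length + 2 = r Finset.univ) :
    ∃ c : Finset E → ℝ, (bergmanFan hr).degree σ (cardFunction r g :: xs) =
        ∑ v ∈ (bergmanFan hr).link σ, c v * (bergmanFan hr).degree (insert v σ) xs ∧
      ∀ G H F, Gap r σ G H → G ⊆ F → F ⊆ H → c F = slack g G.card F.card H.card := by
  obtain ⟨ℓ, hℓ, h1, h2⟩ := hσ.exists_lift_card hr (by omega) g
  exact ⟨_, BalancedFan.degree_cons (Φ := bergmanFan hr) hσ (by rw [dim_eq]; omega) _ hℓ h1, h2⟩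

theorem nef_truncation (j : ℕ) : (bergmanFan hr).Nef (cardFunction r (truncation j)) := by
  intro σ hσ
  by_cases hpos : 0 < r Finset.univ
  · obtain ⟨ℓ, hℓ, h1, h2⟩ := Face.exists_lift_card hr hσ hpos (truncation j)
    refine ⟨ℓ, hℓ, h1, fun v hv => ?_⟩
    obtain ⟨h3, h4⟩ := (mem_link_iff hr).1 hv
    obtain ⟨G, H, hgap, hG, hH⟩ := Face.exists_gap_of_insert hr hσ h3 h4
    rw [← sub_nonneg, h2 G H v hgap hG.1 hH.1]
    exact slack_truncation_nonneg (Finset.card_le_card hG.1) (Finset.card_le_card hH.1)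
      (Finset.card_lt_card hgap.lt)
  · obtain ⟨ℓ, hℓ, h1⟩ := BalancedFan.exists_lift (Φ := bergmanFan hr) hσ
      (cardFunction r (truncation j))
    refine ⟨ℓ, hℓ, h1, fun v hv => ?_⟩
    have h3 := ((mem_link_iff hr).1 hv).2.1 v (Finset.mem_insert_self _ _)
    have := hr.rank_lt h3.1 h3.2.2
    omega

theorem ample_neg_sq (hpos : 0 < r Finset.univ) :
    (bergmanFan hr).Ample (cardFunction r fun t => -(t : ℝ) ^ 2) := by
  intro σ hσ
  obtain ⟨ℓ, hℓ, h1, h2⟩ := Face.exists_lift_card hr hσ hpos fun t => -(t : ℝ) ^ 2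
  refine ⟨ℓ, hℓ, h1, fun v hv => ?_⟩
  obtain ⟨h3, h4⟩ := (mem_link_iff hr).1 hv
  obtain ⟨G, H, hgap, hG, hH⟩ := Face.exists_gap_of_insert hr hσ h3 h4
  rw [← sub_pos, h2 G H v hgap hG.1 hH.1]
  exact slack_neg_sq_pos (Finset.card_lt_card hG) (Finset.card_lt_card hH)

/-- The degree vanishes if no function in the list bends on a gap of length at least two. -/
theorem Gap.degree_eq_zero (js : List ℕ) : ∀ {σ : Finset (Finset E)}, Face r σ →
    ∀ {G H : Finset E}, Gap r σ G H → r G + 2 ≤ r H →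
    (∀ j ∈ js, j ≤ G.card ∨ H.card ≤ j) → σ.card + js.length + 1 = r Finset.univ →
    (bergmanFan hr).degree σ (js.map fun j => cardFunction r (truncation j)) = 0 := by
  induction js with
  | nil =>
    intro σ hσ G H hgap hrk _ hd
    have := Finset.card_le_card (hgap.ioo_subset hr)
    have := hσ.card_missing hr
    rw [Nat.card_Ioo] at *
    simp only [List.length_nil] at hd
    omega
  | cons j js ih =>
    intro σ hσ G H hgap hrk hjs hd
    rw [List.length_cons] at hd
    obtain ⟨c, h1, h2⟩ := degree_cons_card hr hσ (truncation j)
      (xs := js.map fun j => cardFunction r (truncation j)) (by rw [List.length_map]; omega)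
    rw [List.map_cons, h1]
    refine Finset.sum_eq_zero fun v hv => ?_
    have hcard := BalancedFan.card_insert_link hv
    obtain ⟨h3, h4⟩ := (mem_link_iff hr).1 hv
    have key : v ⊆ G ∨ H ⊆ v → c v * (bergmanFan hr).degree (insert v σ)
        (js.map fun j => cardFunction r (truncation j)) = 0 := fun h => by
      rw [ih h4 (hgap.insert_of_subset h) hrk (fun j hj => hjs j (List.mem_cons_of_mem _ hj))
        (by omega), mul_zero]
    obtain ⟨G', H', hgap', hG, hH⟩ := hσ.exists_gap_of_insert hr h3 h4
    rcases hgap.sep G' hgap'.left with h5 | h5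
    · rcases hgap.sep H' hgap'.right with h6 | h6
      · exact key (Or.inl (hH.1.trans h6))
      · have hGv : G ⊆ v := by
          rcases hgap'.sep G hgap.left with h7 | h7
          · exact h7.trans hG.1
          · exact absurd ((h6.trans h7)) hgap.lt.2
        have hvH : v ⊆ H := by
          rcases hgap'.sep H hgap.right with h7 | h7
          · exact absurd (h7.trans h5) hgap.lt.2
          · exact hH.1.trans h7
        rw [h2 G H v hgap hGv hvH, slack_truncation_of_le (Finset.card_le_card hGv)
          (Finset.card_lt_card hgap.lt) (hjs j List.mem_cons_self) (Finset.card_le_card hvH),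
          zero_mul]
    · exact key (Or.inr (h5.trans hG.1))

theorem degree_truncation_eq_zero {σ : Finset (Finset E)} (hσ : Face r σ) {K : Finset E}
    (hK : K ∈ σ) {xs : List (Finset E → ℝ)} (hd : σ.card + xs.length + 2 = r Finset.univ) :
    (bergmanFan hr).degree σ (cardFunction r (truncation K.card) :: xs) = 0 := by
  obtain ⟨c, h1, h2⟩ := degree_cons_card hr hσ (truncation K.card) hd
  rw [h1]
  refine Finset.sum_eq_zero fun v hv => ?_
  obtain ⟨h3, h4⟩ := (mem_link_iff hr).1 hv
  obtain ⟨G, H, hgap, hG, hH⟩ := hσ.exists_gap_of_insert hr h3 h4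
  rw [h2 G H v hgap hG.1 hH.1, slack_truncation_of_le (Finset.card_le_card hG.1)
    (Finset.card_lt_card hgap.lt) ((hgap.sep K (mem_extended_of_mem hK)).imp
    Finset.card_le_card Finset.card_le_card) (Finset.card_le_card hH.1), zero_mul]

theorem degree_truncation_eq_zero_of_mem {σ : Finset (Finset E)} (hσ : Face r σ) {K : Finset E}
    (hK : K ∈ σ) {js : List ℕ} (hj : K.card ∈ js) (hd : σ.card + js.length + 1 = r Finset.univ) :
    (bergmanFan hr).degree σ (js.map fun j => cardFunction r (truncation j)) = 0 := by
  have hperm := (List.perm_cons_erase hj).map fun j => cardFunction r (truncation j)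
  have hlen := (List.perm_cons_erase hj).length_eq
  rw [List.length_cons] at hlen
  rw [BalancedFan.degree_perm (Φ := bergmanFan hr) hperm hσ
    (by rw [dim_eq, List.length_map]; omega), List.map_cons]
  exact degree_truncation_eq_zero hr hσ hK (by rw [List.length_map]; omega)

end BergmanFan

namespace BergmanFan

open IsRankFunction

variable {E : Type*} [Fintype E] [DecidableEq E] {r : Finset E → ℕ} (hr : IsRankFunction r)

/-- The degree of a product of functions `truncation j`. -/
noncomputable def truncationDegree (σ : Finset (Finset E)) (js : List ℕ) : ℝ :=
  (bergmanFan hr).degree σ (js.map fun j => cardFunction r (truncation j))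

/-- The degree of the functions `truncation j` for `m < j ≤ m + k` is a multiple of a coefficient
of the spanning subset polynomial of the gap. -/
def WindowFormula (k : ℕ) : Prop :=
  ∀ (σ : Finset (Finset E)) (G H : Finset E) (m : ℕ), Face r σ → Gap r σ G H →
    r H = r G + (k + 1) → σ.card + (k + 1) = r Finset.univ →
    (k = 0 → G.card ≤ m ∧ m < H.card) →
    truncationDegree hr σ (List.range' (m + 1) k) = k.factorial * (spanningPoly r G H).coeff m

theorem WindowFormula.cons_term {k : ℕ} (hk : WindowFormula hr k) {σ : Finset (Finset E)}
    {G H v : Finset E} {j p : ℕ} (hσ : Face r σ) (hgap : Gap r σ G H)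
    (hrk : r H = r G + (k + 2)) (hcard : σ.card + (k + 2) = r Finset.univ)
    (hGj : G.card < j) (hjH : j < H.card) (hpj : p ≤ j) (hjp : j ≤ p + k + 1)
    (hk0 : k = 0 → G.card ≤ p ∧ p < H.card) (hvf : IsFlat r v) (hGv : G ⊂ v) (hvH : v ⊂ H) :
    slack (truncation j) G.card v.card H.card * ((H.card : ℝ) - G.card) *
        truncationDegree hr (insert v σ) (List.range' (p + 1) k) =
      (if v ∈ covers r G H then ((H.card : ℝ) - j) * (((v.card : ℝ) - G.card) *
        (k.factorial * (spanningPoly r v H).coeff p)) else 0) +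
      (if v ∈ cocovers r G H then ((j : ℝ) - G.card) * (((H.card : ℝ) - v.card) *
        (k.factorial * (spanningPoly r G v).coeff p)) else 0) := by
  have hlt := Finset.card_lt_card hgap.lt
  have hGf := hσ.isFlat hr hgap.left
  have hHf := hσ.isFlat hr hgap.right
  have hrv := hr.rank_lt hGf hGv
  have hrv' := hr.rank_lt hvf hvH
  obtain ⟨hvσ, hface⟩ := hgap.insert_mem hr hσ hvf hGv hvH
  have hcard' := Finset.card_insert_of_notMem hvσ
  have hcov : v ∈ covers r G H ↔ r v = r G + 1 := by
    rw [mem_covers]; exact ⟨fun h => h.2.2.2, fun h => ⟨hvf, hGv.1, hvH.1, h⟩⟩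
  have hcocov : v ∈ cocovers r G H ↔ r v + 1 = r H := by
    rw [mem_cocovers]; exact ⟨fun h => h.2.2.2, fun h => ⟨hvf, hGv.1, hvH.1, h⟩⟩
  have hle : v.card ≤ j → slack (truncation j) G.card v.card H.card * ((H.card : ℝ) - G.card) =
      ((H.card : ℝ) - j) * ((v.card : ℝ) - G.card) :=
    slack_truncation_of_le_right hlt hGj.le hjH.le
  have hge : j ≤ v.card → slack (truncation j) G.card v.card H.card * ((H.card : ℝ) - G.card) =
      ((j : ℝ) - G.card) * ((H.card : ℝ) - v.card) :=
    slack_truncation_of_ge hlt hGj.le hjH.le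
  rw [if_congr hcov rfl rfl, if_congr hcocov rfl rfl]
  rcases Nat.eq_zero_or_pos k with rfl | hkpos
  · obtain ⟨h1, h2⟩ := hk0 rfl
    rw [if_pos (by omega), if_pos (by omega),
      hr.coeff_spanningPoly_of_rank_one hvf hHf hvH.1 (by omega),
      hr.coeff_spanningPoly_of_rank_one hGf hvf hGv.1 (by omega)]
    have hD : truncationDegree hr (insert v σ) (List.range' (p + 1) 0) = 1 := rfl
    rw [hD]
    by_cases hvp : v.card ≤ p
    · rw [if_pos ⟨hvp, h2⟩, if_neg (by omega), hle (by omega)]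
      simp
    · rw [if_neg (by omega), if_pos ⟨h1, by omega⟩, hge (by omega)]
      simp
  by_cases h1 : r v = r G + 1
  · rw [if_pos h1, if_neg (by omega), hk _ v H p hface (hgap.insert_above hGv hvH) (by omega)
      (by omega) (by omega)]
    by_cases hvj : v.card ≤ j
    · rw [hle hvj]
      ring
    · rw [hr.coeff_spanningPoly_of_lt_card hvf hHf hvH.1 (by omega)]
      simp
  by_cases h2 : r v + 1 = r H
  · rw [if_neg h1, if_pos h2, hk _ G v p hface (hgap.insert_below hGv hvH) (by omega)
      (by omega) (by omega)]
    by_cases hvj : j ≤ v.card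
    · rw [hge hvj]
      ring
    · rw [hr.coeff_spanningPoly_of_lt (by omega)]
      simp
  rw [if_neg h1, if_neg h2, add_zero]
  refine mul_eq_zero_of_right _ ?_
  by_cases hmem : v.card ∈ List.range' (p + 1) k
  · exact degree_truncation_eq_zero_of_mem hr hface (Finset.mem_insert_self _ _) hmem
      (by rw [List.length_range']; omega)
  rw [List.mem_range'_1] at hmem
  by_cases hvp : v.card ≤ p
  · refine Gap.degree_eq_zero hr _ hface (hgap.insert_below hGv hvH) (by omega) (fun i hi => ?_)
      (by rw [List.length_range']; omega)
    rw [List.mem_range'_1] at hi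
    omega
  · refine Gap.degree_eq_zero hr _ hface (hgap.insert_above hGv hvH) (by omega) (fun i hi => ?_)
      (by rw [List.length_range']; omega)
    rw [List.mem_range'_1] at hi
    omega

theorem WindowFormula.cons {k : ℕ} (hk : WindowFormula hr k) {σ : Finset (Finset E)}
    {G H : Finset E} {j p : ℕ} (hσ : Face r σ) (hgap : Gap r σ G H)
    (hrk : r H = r G + (k + 2)) (hcard : σ.card + (k + 2) = r Finset.univ)
    (hGj : G.card < j) (hjH : j < H.card) (hpj : p ≤ j) (hjp : j ≤ p + k + 1)
    (hk0 : k = 0 → G.card ≤ p ∧ p < H.card) :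
    truncationDegree hr σ (j :: List.range' (p + 1) k) =
      k.factorial * (mixedPoly r G H j).coeff p := by
  have hlt := Finset.card_lt_card hgap.lt
  have hGf := hσ.isFlat hr hgap.left
  have hHf := hσ.isFlat hr hgap.right
  have hpos : (0 : ℝ) < (H.card : ℝ) - G.card := sub_pos.2 (Nat.cast_lt.2 hlt)
  apply mul_left_cancel₀ hpos.ne'
  rw [mul_left_comm _ (k.factorial : ℝ), hr.coeff_mixedPoly hGf hHf hgap.lt.1 (by omega)]
  obtain ⟨c, h1, h2⟩ := degree_cons_card hr hσ (truncation j)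
    (xs := (List.range' (p + 1) k).map fun j => cardFunction r (truncation j))
    (by rw [List.length_map, List.length_range']; omega)
  have hbetween : ∀ v ∈ (bergmanFan hr).link σ, IsFlat r v ∧ G ⊂ v ∧ v ⊂ H := fun v hv => by
    obtain ⟨h3, h4⟩ := (mem_link_iff hr).1 hv
    exact ⟨(h4.1 v (Finset.mem_insert_self _ _)).1, hgap.between hr hσ (by omega) h3 h4⟩
  have hterm : ∀ v ∈ (bergmanFan hr).link σ, ((H.card : ℝ) - G.card) * (c v *
      (bergmanFan hr).degree (insert v σ)
        ((List.range' (p + 1) k).map fun j => cardFunction r (truncation j))) =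
      (if v ∈ covers r G H then ((H.card : ℝ) - j) * (((v.card : ℝ) - G.card) *
        (k.factorial * (spanningPoly r v H).coeff p)) else 0) +
      (if v ∈ cocovers r G H then ((j : ℝ) - G.card) * (((H.card : ℝ) - v.card) *
        (k.factorial * (spanningPoly r G v).coeff p)) else 0) := fun v hv => by
    obtain ⟨hvf, hGv, hvH⟩ := hbetween v hv
    rw [← hk.cons_term hr hσ hgap hrk hcard hGj hjH hpj hjp hk0 hvf hGv hvH,
      h2 G H v hgap hGv.1 hvH.1, truncationDegree]
    ring
  rw [truncationDegree, List.map_cons, h1, Finset.mul_sum, Finset.sum_congr rfl hterm,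
    Finset.sum_add_distrib, ← Finset.sum_filter, ← Finset.sum_filter, mul_add, Finset.mul_sum,
    Finset.mul_sum, Finset.mul_sum, Finset.mul_sum]
  have hf1 : ((bergmanFan hr).link σ).filter (· ∈ covers r G H) = covers r G H := by
    ext F
    rw [Finset.mem_filter, and_iff_right_iff_imp]
    intro hF
    obtain ⟨h3, h4, h5, h6⟩ := mem_covers.1 hF
    exact hgap.mem_link hr hσ h3 (h4.ssubset_of_ne (by rintro rfl; omega))
      (h5.ssubset_of_ne (by rintro rfl; omega))
  have hf2 : ((bergmanFan hr).link σ).filter (· ∈ cocovers r G H) = cocovers r G H := by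
    ext F
    rw [Finset.mem_filter, and_iff_right_iff_imp]
    intro hF
    obtain ⟨h3, h4, h5, h6⟩ := mem_cocovers.1 hF
    exact hgap.mem_link hr hσ h3 (h4.ssubset_of_ne (by rintro rfl; omega))
      (h5.ssubset_of_ne (by rintro rfl; omega))
  rw [hf1, hf2]
  congr 1 <;> exact Finset.sum_congr rfl fun F _ => by ring

theorem truncationDegree_perm {σ : Finset (Finset E)} (hσ : Face r σ) {js js' : List ℕ}
    (h : js.Perm js') (hd : σ.card + js.length + 1 = r Finset.univ) :
    truncationDegree hr σ js = truncationDegree hr σ js' :=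
  BalancedFan.degree_perm (Φ := bergmanFan hr) (h.map _) hσ
    (by rw [dim_eq, List.length_map]; omega)

theorem windowFormula (k : ℕ) : WindowFormula hr k := by
  induction k with
  | zero =>
    intro σ G H m hσ hgap hrk _ h0
    rw [hr.coeff_spanningPoly_of_rank_one (hσ.isFlat hr hgap.left) (hσ.isFlat hr hgap.right)
      hgap.lt.1 (by omega), if_pos (h0 rfl)]
    simp [truncationDegree, BalancedFan.degree]
  | succ k ih =>
    intro σ G H m hσ hgap hrk hcard _
    have hcards := hr.rank_sub_le_card_sub hgap.lt.1
    have hGf := hσ.isFlat hr hgap.left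
    have hHf := hσ.isFlat hr hgap.right
    have hrk' : (r H : ℝ) = r G + k + 2 := by rw [hrk]; push_cast; ring
    by_cases h1 : H.card ≤ m + 1
    · rw [hr.coeff_spanningPoly_of_lt (by omega), mul_zero]
      refine Gap.degree_eq_zero hr _ hσ hgap (by omega) (fun i hi => ?_)
        (by rw [List.length_range']; omega)
      rw [List.mem_range'_1] at hi
      omega
    by_cases h2 : m + k + 1 ≤ G.card
    · rw [hr.coeff_spanningPoly_of_lt_card hGf hHf hgap.lt.1 (by omega), mul_zero]
      refine Gap.degree_eq_zero hr _ hσ hgap (by omega) (fun i hi => ?_)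
        (by rw [List.length_range']; omega)
      rw [List.mem_range'_1] at hi
      omega
    by_cases h3 : G.card < m + 1
    · rw [List.range'_succ, ih.cons hr hσ hgap (by omega) (by omega) h3 (by omega) le_rfl
        (by omega) (by omega), coeff_mixedPoly_succ, Nat.factorial_succ, hrk']
      push_cast
      ring
    · have hperm : (List.range' (m + 1) (k + 1)).Perm
          ((m + 1 + k) :: List.range' (m + 1) k) := by
        rw [List.range'_1_concat]
        exact List.perm_append_singleton _ _
      rw [truncationDegree_perm hr hσ hperm (by rw [List.length_range']; omega),
        ih.cons hr hσ hgap (by omega) (by omega) (by omega) (by omega) (by omega)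
        (by omega) (by omega), Nat.factorial_succ]
      rcases m with - | m
      · rw [coeff_mixedPoly_zero]
        push_cast
        ring
      · rw [coeff_mixedPoly_succ, hrk']
        push_cast
        ring

end BergmanFan

namespace BergmanFan

open IsRankFunction

variable {E : Type*} [Fintype E] [DecidableEq E] {r : Finset E → ℕ}

theorem gap_empty (h : cl r ∅ ⊂ Finset.univ) : Gap r ∅ (cl r ∅) Finset.univ := by
  refine ⟨mem_extended.2 (Or.inl rfl), mem_extended.2 (Or.inr (Or.inl rfl)), h, fun K hK => ?_⟩
  rcases mem_extended.1 hK with rfl | rfl | hK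
  · exact Or.inl (Finset.Subset.refl _)
  · exact Or.inr (Finset.Subset.refl _)
  · exact absurd hK (Finset.notMem_empty _)

variable (hr : IsRankFunction r)
include hr

/-- The Alexandrov–Fenchel inequality for consecutive coefficients. -/
theorem coeff_mul_coeff_le {k m : ℕ} (hk : r Finset.univ = k + 3) (hm : (cl r ∅).card ≤ m + 1)
    (hm' : m + k + 3 < (Finset.univ : Finset E).card) :
    ((k + 1) * (spanningPoly r (cl r ∅) Finset.univ).coeff m +
        (spanningPoly r (cl r ∅) Finset.univ).coeff (m + 1)) *
      ((k + 1) * (spanningPoly r (cl r ∅) Finset.univ).coeff (m + 2) +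
        (spanningPoly r (cl r ∅) Finset.univ).coeff (m + 1)) ≤
      ((k + 2) * (spanningPoly r (cl r ∅) Finset.univ).coeff (m + 1)) ^ 2 := by
  have hr0 : r (cl r ∅) = 0 := by rw [hr.rank_cl, hr.empty]
  have hlt : cl r ∅ ⊂ Finset.univ :=
    (Finset.subset_univ _).ssubset_of_ne fun h => by rw [h] at hr0; omega
  have hgap := gap_empty hlt
  have hface : Face r ∅ := (bergmanFan hr).face_empty
  have hcardlt := Finset.card_lt_card hlt
  have hk' : (r Finset.univ : ℝ) = k + 3 := by rw [hk]; push_cast; ring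
  have h := BalancedFan.degree_mul_le_sq (isHyperbolic hr) (ample_neg_sq hr (by omega))
    (ts := (List.range' (m + 3) k).map fun j => cardFunction r (truncation j))
    (by rw [dim_eq, List.length_map, List.length_range']; omega)
    (fun t ht => by
      obtain ⟨j, -, rfl⟩ := List.mem_map.1 ht
      exact nef_truncation hr j)
    (cardFunction r (truncation (m + 2))) (nef_truncation hr (m + k + 3))
  change truncationDegree hr ∅ ((m + 2) :: (m + 2) :: List.range' (m + 3) k) *
    truncationDegree hr ∅ ((m + k + 3) :: (m + k + 3) :: List.range' (m + 3) k) ≤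
    truncationDegree hr ∅ ((m + 2) :: (m + k + 3) :: List.range' (m + 3) k) ^ 2 at h
  have hperm : ((m + k + 3) :: List.range' (m + 3) k).Perm (List.range' (m + 3) (k + 1)) := by
    rw [List.range'_1_concat, show m + k + 3 = m + 3 + k by omega]
    exact (List.perm_append_singleton _ _).symm
  rw [← List.range'_succ (s := m + 2) (n := k) (step := 1),
    truncationDegree_perm hr hface (hperm.cons (m + k + 3))
      (by simp only [List.length_cons, List.length_range', Finset.card_empty]; omega),
    truncationDegree_perm hr hface (hperm.cons (m + 2))
      (by simp only [List.length_cons, List.length_range', Finset.card_empty]; omega),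
    ← List.range'_succ (s := m + 2) (n := k + 1) (step := 1),
    windowFormula hr (k + 2) ∅ _ _ (m + 1) hface hgap (by omega)
      (by rw [Finset.card_empty]; omega) (by omega),
    (windowFormula hr (k + 1)).cons hr hface hgap (p := m + 1) (by omega)
      (by rw [Finset.card_empty]; omega) (by omega) (by omega) (by omega) (by omega) (by omega),
    (windowFormula hr (k + 1)).cons hr hface hgap (p := m + 2) (by omega)
      (by rw [Finset.card_empty]; omega) (by omega) (by omega) (by omega) (by omega) (by omega),
    coeff_mixedPoly_succ, coeff_mixedPoly_succ, hr0, hk', Nat.factorial_succ (k + 1)] at h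
  have hfac : (0 : ℝ) < ((k + 1).factorial : ℝ) ^ 2 := by positivity
  refine le_of_mul_le_mul_left ?_ hfac
  push_cast at h
  linarith

theorem coeff_lt_or_eq_zero (hrank : 3 ≤ r Finset.univ) {m : ℕ}
    (h : (spanningPoly r (cl r ∅) Finset.univ).coeff (m + 1) <
      (spanningPoly r (cl r ∅) Finset.univ).coeff m) :
    (spanningPoly r (cl r ∅) Finset.univ).coeff (m + 2) <
      (spanningPoly r (cl r ∅) Finset.univ).coeff (m + 1) ∨
    ∀ j > m, (spanningPoly r (cl r ∅) Finset.univ).coeff j = 0 := by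
  have hr0 : r (cl r ∅) = 0 := by rw [hr.rank_cl, hr.empty]
  have hL := hr.isFlat_cl ∅
  have hnn := fun i => (hr.coeff_spanningPoly_nonneg hL isFlat_univ (Finset.subset_univ _) i).1
  have hpos := (hr.coeff_spanningPoly_nonneg hL isFlat_univ (Finset.subset_univ _) (m + 1)).2
  by_cases h1 : m + 1 < (cl r ∅).card
  · rw [hr.coeff_spanningPoly_of_lt_card hL isFlat_univ (Finset.subset_univ _)
      (show m < _ by omega)] at h
    exact absurd (hnn (m + 1)) h.not_ge
  by_cases h2 : (Finset.univ : Finset E).card < m + 1 + (r Finset.univ - r (cl r ∅))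
  · exact Or.inr fun j hj => hr.coeff_spanningPoly_of_lt (by omega)
  left
  have hb := hpos (by omega) (by omega) (by omega)
  obtain ⟨k, hk⟩ := Nat.exists_eq_add_of_le' hrank
  have hmain := coeff_mul_coeff_le hr hk (m := m) (by omega) (by omega)
  by_contra! hc
  have hk0 : (0 : ℝ) < (k : ℝ) + 1 := by positivity
  have h3 := mul_lt_mul_of_pos_left h hk0
  have h4 := mul_le_mul_of_nonneg_left hc hk0.le
  refine hmain.not_gt ?_
  rw [sq]
  have h5 : (k + 2) * (spanningPoly r (cl r ∅) Finset.univ).coeff (m + 1) <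
      (k + 1) * (spanningPoly r (cl r ∅) Finset.univ).coeff m +
        (spanningPoly r (cl r ∅) Finset.univ).coeff (m + 1) := by linarith
  have h6 : (k + 2) * (spanningPoly r (cl r ∅) Finset.univ).coeff (m + 1) ≤
      (k + 1) * (spanningPoly r (cl r ∅) Finset.univ).coeff (m + 2) +
        (spanningPoly r (cl r ∅) Finset.univ).coeff (m + 1) := by linarith
  have h7 : 0 < (k + 2) * (spanningPoly r (cl r ∅) Finset.univ).coeff (m + 1) := by positivity
  exact mul_lt_mul h5 h6 h7 (h7.trans h5).le

end BergmanFan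

/-- A nonnegative sequence whose first descent is followed by descents only is unimodal. -/
theorem exists_unimodal_of_descent {s : ℕ → ℝ} (h0 : ∀ m, 0 ≤ s m)
    (h : ∀ m, s (m + 1) < s m → s (m + 2) < s (m + 1) ∨ ∀ j > m, s j = 0) (d : ℕ) :
    ∃ m₀ ≤ d, (∀ i j : ℕ, i ≤ j → j ≤ m₀ → s i ≤ s j) ∧
      ∀ i j : ℕ, m₀ ≤ i → i ≤ j → j ≤ d → s j ≤ s i := by
  by_cases hex : ∃ m < d, s (m + 1) < s m
  · classical
    obtain ⟨hd, hlt⟩ := Nat.find_spec hex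
    have hmin := fun m (hm : m < Nat.find hex) => Nat.find_min hex hm
    set m₀ := Nat.find hex
    have hdesc : ∀ i, s (m₀ + i + 1) < s (m₀ + i) ∨ ∀ j > m₀ + i, s j = 0 := by
      intro i
      induction i with
      | zero => exact Or.inl hlt
      | succ i ih =>
        rcases ih with ih | ih
        · rcases h _ ih with h' | h'
          · exact Or.inl h'
          · exact Or.inr fun j hj => h' j (by omega)
        · exact Or.inr fun j hj => ih j (by omega)
    refine ⟨m₀, hd.le, fun i j hij hj => ?_, fun i j hi hij _ => ?_⟩
    · induction j, hij using Nat.le_induction with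
      | base => exact le_rfl
      | succ j hij ih =>
        refine (ih (by omega)).trans (not_lt.1 fun hlt' => hmin j (by omega) ⟨by omega, hlt'⟩)
    · induction j, hij using Nat.le_induction with
      | base => exact le_rfl
      | succ j hij ih =>
        refine le_trans ?_ (ih (by omega))
        obtain ⟨k, rfl⟩ := Nat.exists_eq_add_of_le (hi.trans hij)
        rcases hdesc k with h' | h'
        · exact h'.le
        · rw [h' _ (by omega)]
          exact h0 _
  · push Not at hex
    refine ⟨d, le_rfl, fun i j hij hj => ?_, fun i j hi hij hj => ?_⟩
    · induction j, hij using Nat.le_induction with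
      | base => exact le_rfl
      | succ j hij ih => exact (ih (by omega)).trans (hex j (by omega))
    · rw [show i = j by omega]

namespace Matroid

open IsRankFunction

section FiniteRank

variable {β : Type*}

/-- The rank function of a matroid on finite sets, with values in `ℕ`. -/
noncomputable def finsetRk (N : Matroid β) (A : Finset β) : ℕ := (N.eRk A).toNat

theorem coe_finsetRk (N : Matroid β) (A : Finset β) : (N.finsetRk A : ℕ∞) = N.eRk A :=
  ENat.natCast_toNat ((N.eRk_le_encard A).trans_lt A.finite_toSet.encard_lt_top).ne

theorem isRankFunction_finsetRk [DecidableEq β] (N : Matroid β) :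
    IsRankFunction N.finsetRk where
  empty := by simp [finsetRk]
  mono A B h := by
    have := N.eRk_mono (Finset.coe_subset.2 h)
    rw [← coe_finsetRk, ← coe_finsetRk] at this
    exact_mod_cast this
  insert_le e A := by
    have := N.eRk_insert_le_add_one e A
    rw [← Finset.coe_insert, ← coe_finsetRk, ← coe_finsetRk] at this
    exact_mod_cast this
  submod A B := by
    have := N.eRk_inter_add_eRk_union_le A B
    rw [← Finset.coe_inter, ← Finset.coe_union, ← coe_finsetRk, ← coe_finsetRk, ← coe_finsetRk,
      ← coe_finsetRk] at this
    rw [add_comm]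
    exact_mod_cast this

variable [Fintype β] {N : Matroid β}

theorem finsetRk_univ (N : Matroid β) : (N.finsetRk Finset.univ : ℕ∞) = N.eRank := by
  rw [coe_finsetRk, Finset.coe_univ, eRk_univ_eq]

theorem finsetRk_dual_univ (hN : N.E = Set.univ) {B : Set β} (hB : N.IsBase B) :
    N✶.finsetRk Finset.univ + B.ncard = Fintype.card β := by
  have h1 := hB.compl_isBase_dual.encard_eq_eRank
  rw [← finsetRk_univ, hN, ← Set.compl_eq_univ_sdiff, ← (Set.toFinite _).cast_ncard_eq] at h1
  have h2 := Set.ncard_add_ncard_compl B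
  rw [Nat.card_eq_fintype_card] at h2
  have h3 : Bᶜ.ncard = N✶.finsetRk Finset.univ := by exact_mod_cast h1
  omega

theorem finsetRk_dual_eq_univ_iff [DecidableEq β] (hN : N.E = Set.univ) (A : Finset β) :
    N✶.finsetRk A = N✶.finsetRk Finset.univ ↔ N.Indep ↑Aᶜ := by
  have h1 : N.Indep ↑Aᶜ ↔ N✶.Spanning (A : Set β) := by
    constructor
    · intro h
      have := h.coindep.compl_spanning
      rwa [dual_ground, hN, Finset.coe_compl, ← Set.compl_eq_univ_sdiff, compl_compl] at this
    · intro h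
      have := h.compl_coindep
      rwa [dual_ground, hN, ← Set.compl_eq_univ_sdiff, dual_coindep_iff, ← Finset.coe_compl] at this
  rw [h1, spanning_iff_eRk_le (by simp [hN]), ← coe_finsetRk, ← finsetRk_univ, Nat.cast_le]
  have := N✶.isRankFunction_finsetRk.mono A _ (Finset.subset_univ _)
  omega

open Classical in
theorem spanningPoly_dual [DecidableEq β] (hN : N.E = Set.univ) {B : Set β} (hB : N.IsBase B) :
    spanningPoly N✶.finsetRk (cl N✶.finsetRk ∅) Finset.univ =
      ∑ I ∈ ({I | N.Indep ↑I} : Finset (Finset β)), (X - 1 : ℝ[X]) ^ (B.ncard - I.card) := by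
  have hr := N✶.isRankFunction_finsetRk
  rw [Finset.sum_filter, spanningPoly, Finset.powerset_univ]
  refine Finset.sum_equiv compl_involutive.toPerm (by simp) fun A _ => ?_
  have h1 : N✶.finsetRk (cl N✶.finsetRk ∅ ∪ A) = N✶.finsetRk A := by
    rw [Finset.union_comm]
    exact hr.rank_union_eq _ (cl_mono hr (Finset.empty_subset A))
  rw [spanningTerm, h1, hr.rank_cl, hr.empty]
  simp only [finsetRk_dual_eq_univ_iff hN, Function.Involutive.coe_toPerm]
  refine if_congr Iff.rfl ?_ rfl
  have h2 := finsetRk_dual_univ hN hB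
  have h3 := Finset.card_add_card_compl A
  congr 1
  omega

end FiniteRank

section AddLoops

variable {α : Type*} (M : Matroid α)

/-- The matroid obtained by adjoining three loops. -/
noncomputable def addLoops : Matroid (α ⊕ Fin 3) :=
  (M.mapEmbedding ⟨Sum.inl, Sum.inl_injective⟩) ↾ Set.univ

variable {M}

theorem addLoops_indep_iff {I : Set (α ⊕ Fin 3)} :
    M.addLoops.Indep I ↔ M.Indep (Sum.inl ⁻¹' I) ∧ I ⊆ Set.range Sum.inl := by
  simp [addLoops]

theorem addLoops_indep_image_iff {I : Set α} :
    M.addLoops.Indep (Sum.inl '' I) ↔ M.Indep I := by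
  simp [addLoops_indep_iff, Set.preimage_image_eq _ Sum.inl_injective]

theorem IsBase.addLoops {B : Set α} (hB : M.IsBase B) :
    M.addLoops.IsBase (Sum.inl '' B) := by
  rw [isBase_iff_maximal_indep, maximal_subset_iff]
  refine ⟨addLoops_indep_image_iff.2 hB.indep, fun I hI hBI => ?_⟩
  obtain ⟨hI, hI'⟩ := addLoops_indep_iff.1 hI
  rw [hB.eq_of_subset_indep hI (Set.image_subset_iff.1 hBI), Set.image_preimage_eq_of_subset hI']

open Classical in
theorem sum_addLoops_indep [Fintype α] {R : Type*} [AddCommMonoid R] (f : ℕ → R) :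
    ∑ I ∈ ({I | M.addLoops.Indep ↑I} : Finset (Finset (α ⊕ Fin 3))), f I.card =
      ∑ I ∈ ({I | M.Indep ↑I} : Finset (Finset α)), f I.card := by
  symm
  refine Finset.sum_bij (fun I _ => I.map Function.Embedding.inl) (fun I hI => ?_)
    (fun I _ J _ h => Finset.map_injective _ h) (fun I hI => ?_) (fun I _ => by simp)
  · simpa [addLoops_indep_image_iff] using hI
  · obtain ⟨hI, hI'⟩ := addLoops_indep_iff.1 (Finset.mem_filter.1 hI).2
    have hI'' : Sum.inl '' (I.toLeft : Set α) = (I : Set (α ⊕ Fin 3)) := by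
      rw [← Set.image_preimage_eq_of_subset hI']
      congr 1
      ext
      simp
    refine ⟨I.toLeft, ?_, Finset.coe_injective (by simpa using hI'')⟩
    rw [← hI'', Set.preimage_image_eq _ Sum.inl_injective] at hI
    simpa using hI

end AddLoops

end Matroid

theorem exists_isBase_ncard_eq_matroidRank {α : Type*} [Fintype α] (M : Matroid α) :
    ∃ B, M.IsBase B ∧ B.ncard = matroidRank M Set.univ := by
  have hbdd : BddAbove {m | ∃ I ⊆ Set.univ, M.Indep I ∧ I.ncard = m} := by
    refine ⟨Nat.card α, ?_⟩
    rintro _ ⟨I, -, -, rfl⟩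
    exact Set.ncard_le_card I
  obtain ⟨I, -, hI, hd⟩ := Nat.sSup_mem
    (⟨_, ⟨∅, Set.empty_subset _, M.empty_indep, Set.ncard_empty α⟩⟩ :
      {m | ∃ I ⊆ Set.univ, M.Indep I ∧ I.ncard = m}.Nonempty)
    hbdd
  obtain ⟨B, hB, hIB⟩ := hI.exists_isBase_superset
  refine ⟨B, hB, le_antisymm (le_csSup hbdd ⟨B, Set.subset_univ _, hB.indep, rfl⟩) ?_⟩
  exact hd.symm.le.trans (Set.ncard_le_ncard hIB)

open Classical in
theorem indepCount_eq_card {α : Type*} [Fintype α] (M : Matroid α) (k : ℕ) :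
    indepCount M k = (Finset.univ.filter fun I : Finset α => M.Indep I ∧ I.card = k).card := by
  rw [indepCount, ← Set.ncard_coe_finset, ← Set.ncard_image_of_injective _ Finset.coe_injective]
  congr 1
  ext I
  constructor
  · rintro ⟨h1, h2⟩
    exact ⟨I.toFinset, by simpa [h1, Set.ncard_eq_toFinset_card'] using h2, by simp⟩
  · rintro ⟨J, hJ, rfl⟩
    simpa using hJ

open Classical in
theorem sum_indep_eq_sum_indepCount {α : Type*} [Fintype α] (M : Matroid α) {d : ℕ}
    (hd : ∀ I : Finset α, M.Indep I → I.card ≤ d) (f : ℕ → ℝ[X]) :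
    ∑ I ∈ ({I | M.Indep ↑I} : Finset (Finset α)), f I.card =
      ∑ k ∈ Finset.range (d + 1), C (indepCount M k : ℝ) * f k := by
  rw [← Finset.sum_fiberwise_of_maps_to (t := Finset.range (d + 1)) (g := Finset.card)]
  · refine Finset.sum_congr rfl fun k _ => ?_
    rw [Finset.sum_congr rfl fun I hI => by rw [(Finset.mem_filter.1 hI).2], Finset.sum_const,
      Finset.filter_filter, ← indepCount_eq_card, nsmul_eq_mul, C_eq_natCast]
  · intro I hI
    exact Finset.mem_range.2 (Nat.lt_succ_of_le (hd I (Finset.mem_filter.1 hI).2))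

/-- **Unimodality of the h-vector of the independence complex.**
If `M` is a matroid of rank `d` on a finite ground set and `h` is the h-vector of its
independence complex, defined by `Σ_{k=0}^{d} h_k q^{d−k} = Σ_{k=0}^{d} f_k (q−1)^{d−k}`
where `f_k` is the number of independent sets of cardinality `k`, then there is an index
`k₀ ≤ d` with `h_0 ≤ … ≤ h_{k₀} ≥ … ≥ h_d`. -/
theorem hvector_independence_unimodal {α : Type*} [Fintype α] (M : Matroid α)
    (hE : M.E = Set.univ) (d : ℕ) (hrank : matroidRank M Set.univ = d)
    (h : ℕ → ℤ)
    (hh : ∑ k ∈ Finset.range (d + 1), C (h k) * X ^ (d - k) =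
      ∑ k ∈ Finset.range (d + 1), C ((indepCount M k : ℤ)) * (X - 1) ^ (d - k)) :
    ∃ k₀ ≤ d,
      (∀ i j : ℕ, i ≤ j → j ≤ k₀ → h i ≤ h j) ∧
      (∀ i j : ℕ, k₀ ≤ i → i ≤ j → j ≤ d → h j ≤ h i) := by
  classical
  obtain ⟨B, hB, hBd⟩ := exists_isBase_ncard_eq_matroidRank M
  rw [hrank] at hBd
  have hcard : (Sum.inl '' B : Set (α ⊕ Fin 3)).ncard = d := by
    rw [Set.ncard_image_of_injective _ Sum.inl_injective, hBd]
  have hindep (I : Finset α) (hI : M.Indep I) : I.card ≤ d := by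
    have := hI.encard_le_eRank
    rw [← hB.encard_eq_eRank, ← (Set.toFinite B).cast_ncard_eq, hBd,
      Set.encard_coe_eq_coe_finsetCard] at this
    exact_mod_cast this
  have hr := M.addLoops✶.isRankFunction_finsetRk
  have hrk : 3 ≤ M.addLoops✶.finsetRk Finset.univ := by
    have h1 := Matroid.finsetRk_dual_univ rfl hB.addLoops
    have h2 := Set.ncard_le_card B
    rw [Nat.card_eq_fintype_card] at h2
    simp only [Fintype.card_sum, Fintype.card_fin] at h1
    omega
  have hS := Matroid.spanningPoly_dual rfl hB.addLoops
  rw [hcard, Matroid.sum_addLoops_indep fun k => (X - 1 : ℝ[X]) ^ (d - k),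
    sum_indep_eq_sum_indepCount M hindep fun k => (X - 1 : ℝ[X]) ^ (d - k)] at hS
  have hmap := congrArg (Polynomial.map (Int.castRingHom ℝ)) hh
  simp only [Polynomial.map_sum, Polynomial.map_mul, Polynomial.map_C, Polynomial.map_pow,
    Polynomial.map_sub, Polynomial.map_X, Polynomial.map_one, Int.coe_castRingHom,
    Int.cast_natCast] at hmap
  rw [← hmap] at hS
  have hcoeff (i : ℕ) (hi : i ≤ d) : (IsRankFunction.spanningPoly M.addLoops✶.finsetRk
      (IsRankFunction.cl M.addLoops✶.finsetRk ∅) Finset.univ).coeff (d - i) = h i := by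
    rw [hS, finsetSum_coeff, Finset.sum_eq_single_of_mem i (Finset.mem_range.2 (by omega))]
    · simp
    · intro k hk hki
      rw [coeff_C_mul, coeff_X_pow, if_neg, mul_zero]
      have := Finset.mem_range.1 hk
      omega
  obtain ⟨m, hm, h1, h2⟩ := exists_unimodal_of_descent
    (fun i => (hr.coeff_spanningPoly_nonneg (hr.isFlat_cl ∅) IsRankFunction.isFlat_univ
      (Finset.subset_univ _) i).1)
    (fun i hi => BergmanFan.coeff_lt_or_eq_zero hr hrk hi) d
  refine ⟨d - m, Nat.sub_le _ _, fun i j hij hj => ?_, fun i j hi hij hj => ?_⟩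
  · have := h2 (d - j) (d - i) (by omega) (by omega) (by omega)
    rw [hcoeff i (by omega), hcoeff j (by omega)] at this
    exact_mod_cast this
  · have := h1 (d - j) (d - i) (by omega) (by omega)
    rw [hcoeff i (by omega), hcoeff j (by omega)] at this
    exact_mod_cast this
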